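/- There exists β₀ > 0 such that for all β < β₀ the following holds. For all natural numbers n ≥ 1 and k₁,…,k_n ≥ 0 with k = k₁+⋯+k_n there is a constant K depending only on β₀, n, k (not on N) such that for every N ≥ 1, every h ≥ 0, and every (t₁,…,t_N) with t₁²+⋯+t_N² = 1, |E⟨∏_{l=1}^n S_l^{k_l}⟩ − (∏_{l=1}^n a(k_l)) · E⟨S₁²⟩^{k/2}| ≤ K · max_{i≤N}|t_i|. -/

import Mathlib

open MeasureTheory ProbabilityTheory Finset

noncomputable section

/-- A spin configuration on `N` sites. -/
abbrev Cfg (N : ℕ) := Fin N → Bool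

/-- The spin value `±1` of a Boolean. -/
def spin (b : Bool) : ℝ := if b then 1 else -1

/-- Minus the SK Hamiltonian. -/
def negH (N : ℕ) (β h : ℝ) (g : Fin N → Fin N → ℝ) (σ : Cfg N) : ℝ :=
  (β / Real.sqrt N) *
      ∑ i : Fin N, ∑ j : Fin N, (if i < j then g i j * spin (σ i) * spin (σ j) else 0) +
    h * ∑ i : Fin N, spin (σ i)

/-- Gibbs average `⟨f⟩` of a function of `ι`-indexed replicas. -/
def gibbs (N : ℕ) (β h : ℝ) (g : Fin N → Fin N → ℝ) {ι : Type} [DecidableEq ι] [Fintype ι]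
    (f : (ι → Cfg N) → ℝ) : ℝ :=
  (∑ σs : ι → Cfg N, f σs * ∏ l, Real.exp (negH N β h g (σs l))) /
    (∑ σ : Cfg N, Real.exp (negH N β h g σ)) ^ (Fintype.card ι)

/-- The law of the disorder: i.i.d. standard Gaussians. -/
def gaussN (N : ℕ) : Measure (Fin N → Fin N → ℝ) :=
  Measure.pi fun _ => Measure.pi fun _ => gaussianReal 0 1

/-- `ν(f) = E⟨f⟩`. -/
def nu (N : ℕ) (β h : ℝ) {ι : Type} [DecidableEq ι] [Fintype ι]
    (f : (ι → Cfg N) → ℝ) : ℝ :=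
  ∫ g, gibbs N β h g f ∂ gaussN N

/-- `S_l = Σ_i t_i (σ_i^{1(l)} - σ_i^{2(l)})`, replica pairs indexed by `Fin m × Fin 2`. -/
def Sbar (N m : ℕ) (t : Fin N → ℝ) (σs : Fin m × Fin 2 → Cfg N) (l : Fin m) : ℝ :=
  ∑ i, t i * (spin (σs (l, 0) i) - spin (σs (l, 1) i))

/-- `a(k)`: the `k`-th moment of a standard Gaussian. -/
def gaussMoment (k : ℕ) : ℝ := ∫ x, x ^ k ∂ (gaussianReal 0 1 : Measure ℝ)

/-- The overlap `R_{l,l'}` of two configurations. -/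
def overlap (N : ℕ) (σ τ : Cfg N) : ℝ := (∑ i, spin (σ i) * spin (τ i)) / N

/-- Gaussian integration by parts in dimension one. -/
lemma gaussian_stein {φ φ' : ℝ → ℝ} (hφ : ∀ x, HasDerivAt φ (φ' x) x)
    (h0 : Integrable φ (gaussianReal 0 1)) (h1 : Integrable (fun x => x * φ x) (gaussianReal 0 1))
    (h2 : Integrable φ' (gaussianReal 0 1)) :
    ∫ x, x * φ x ∂(gaussianReal 0 1) = ∫ x, φ' x ∂(gaussianReal 0 1) := by
  have key : ∀ f : ℝ → ℝ, Integrable f (gaussianReal 0 1) →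
      Integrable (fun x => f x * gaussianPDFReal 0 1 x) := by
    intro f hf
    rw [gaussianReal_of_var_ne_zero _ one_ne_zero,
      integrable_withDensity_iff_integrable_smul' (measurable_gaussianPDF 0 1)
        (Filter.Eventually.of_forall fun x => gaussianPDF_lt_top)] at hf
    refine hf.congr (Filter.Eventually.of_forall fun x => ?_)
    simp [toReal_gaussianPDF, mul_comm]
  have hpdf : ∀ x, HasDerivAt (gaussianPDFReal 0 1) (-x * gaussianPDFReal 0 1 x) x := by
    intro x
    have h := (((hasDerivAt_id x).pow 2).neg.div_const 2).exp.const_mul (√(2 * Real.pi * 1))⁻¹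
    have e : gaussianPDFReal 0 1 = fun x => (√(2 * Real.pi * 1))⁻¹ * Real.exp (-x ^ 2 / 2) := by
      ext x; simp [gaussianPDFReal]
    rw [e]
    refine h.congr_deriv ?_
    simp only [id, Pi.neg_apply, Pi.pow_apply]
    ring
  simp_rw [integral_gaussianReal_eq_integral_smul (one_ne_zero), smul_eq_mul]
  have := integral_mul_deriv_eq_deriv_mul_of_integrable (u := φ) (u' := φ')
    (v := gaussianPDFReal 0 1) (v' := fun x => -x * gaussianPDFReal 0 1 x)
    (fun x _ => hφ x) (fun x _ => hpdf x)
    ((key _ h1).neg.congr (Filter.Eventually.of_forall fun x => by simp; ring))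
    (key _ h2) (key _ h0)
  calc _ = -∫ x, φ x * (-x * gaussianPDFReal 0 1 x) := by
        rw [← integral_neg]; congr 1; ext x; ring
    _ = _ := by rw [this, neg_neg]; congr 1; ext x; ring

lemma integrable_pow_gaussian (k : ℕ) : Integrable (fun x : ℝ => x ^ k) (gaussianReal 0 1) := by
  have h := (memLp_id_gaussianReal' (μ := 0) (v := 1) k (by simp)).integrable_norm_pow' 
  have h' : Integrable (fun x : ℝ => ‖x ^ k‖) (gaussianReal 0 1) := by simpa using h
  exact (integrable_norm_iff (by fun_prop)).1 h'

lemma gaussMoment_zero : gaussMoment 0 = 1 := by simp [gaussMoment]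

lemma gaussMoment_one : gaussMoment 1 = 0 := by simp [gaussMoment]

lemma gaussMoment_add_two (k : ℕ) : gaussMoment (k + 2) = (k + 1) * gaussMoment k := by
  have := gaussian_stein (φ := fun x => x ^ (k + 1)) (φ' := fun x => (k + 1) * x ^ k)
    (fun x => by simpa using hasDerivAt_pow (k + 1) x) (integrable_pow_gaussian _)
    ((integrable_pow_gaussian (k + 2)).congr (Filter.Eventually.of_forall fun x => by ring))
    ((integrable_pow_gaussian k).const_mul _)
  rw [gaussMoment, gaussMoment, ← integral_const_mul, ← this]
  congr 1; ext x; ring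

lemma gaussMoment_odd (k : ℕ) (hk : Odd k) : gaussMoment k = 0 := by
  obtain ⟨m, rfl⟩ := hk
  induction m with
  | zero => exact gaussMoment_one
  | succ m ih =>
    rw [show 2 * (m + 1) + 1 = 2 * m + 1 + 2 by ring, gaussMoment_add_two, ih, mul_zero]

section Pi

variable {κ : Type} [Fintype κ] [DecidableEq κ]

/-- The standard Gaussian measure on `κ → ℝ`. -/
abbrev stdGauss (κ : Type) [Fintype κ] : Measure (κ → ℝ) := Measure.pi fun _ => gaussianReal 0 1

lemma measurePreserving_update (k : κ) :
    MeasurePreserving (fun p : (κ → ℝ) × ℝ => Function.update p.1 k p.2)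
      ((stdGauss κ).prod (gaussianReal 0 1)) (stdGauss κ) := by
  have hm : Measurable (fun p : (κ → ℝ) × ℝ => Function.update p.1 k p.2) := by
    refine measurable_pi_lambda _ fun j => ?_
    by_cases h : j = k
    · subst h; simpa using measurable_snd
    · simp only [Function.update_of_ne h]; fun_prop
  refine ⟨hm, (Measure.pi_eq fun s hs => ?_).symm⟩
  rw [Measure.map_apply hm (MeasurableSet.univ_pi hs)]
  have : (fun p : (κ → ℝ) × ℝ => Function.update p.1 k p.2) ⁻¹' Set.univ.pi s =
      (Set.univ.pi (Function.update s k Set.univ)) ×ˢ s k := by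
    ext ⟨x, y⟩
    simp only [Set.mem_preimage, Set.mem_pi, Set.mem_univ, true_imp_iff, Set.mem_prod]
    constructor
    · intro h
      refine ⟨fun j => ?_, by simpa using h k⟩
      by_cases hj : j = k
      · subst hj; simp
      · simpa [hj] using h j
    · rintro ⟨h1, h2⟩ j
      by_cases hj : j = k
      · subst hj; simpa using h2
      · simpa [hj] using h1 j
  rw [this, Measure.prod_prod, Measure.pi_pi, ← Finset.mul_prod_erase _ _ (Finset.mem_univ k),
    ← Finset.mul_prod_erase univ (fun i => gaussianReal 0 1 (s i)) (Finset.mem_univ k)]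
  simp only [Function.update_self, measure_univ, one_mul]
  rw [mul_comm]
  congr 1
  refine Finset.prod_congr rfl fun j hj => ?_
  rw [Function.update_of_ne (Finset.ne_of_mem_erase hj)]

omit [DecidableEq κ] in
lemma integrable_coord_stdGauss (k : κ) : Integrable (fun ω : κ → ℝ => ω k) (stdGauss κ) := by
  have h : Integrable (fun x : ℝ => x) (gaussianReal 0 1) := by
    simpa using integrable_pow_gaussian 1
  exact integrable_comp_eval (μ := fun _ : κ => gaussianReal 0 1) (i := k) h

/-- Gaussian integration by parts for a bounded function with bounded partial derivative. -/
lemma stdGauss_stein (k : κ) {F F' : (κ → ℝ) → ℝ} (hF : Measurable F) (hF' : Measurable F')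
    {C : ℝ} (hC : ∀ ω, |F ω| ≤ C) (hC' : ∀ ω, |F' ω| ≤ C)
    (hd : ∀ ω x, HasDerivAt (fun y => F (Function.update ω k y)) (F' (Function.update ω k x)) x) :
    ∫ ω, ω k * F ω ∂(stdGauss κ) = ∫ ω, F' ω ∂(stdGauss κ) := by
  have mp := measurePreserving_update k
  have i1 : Integrable (fun ω => ω k * F ω) (stdGauss κ) :=
    (integrable_coord_stdGauss k).mul_bdd (c := C) hF.aestronglyMeasurable
      (Filter.Eventually.of_forall hC)
  have i2 : Integrable F' (stdGauss κ) := Integrable.of_bound hF'.aestronglyMeasurable C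
    (Filter.Eventually.of_forall hC')
  have i1' := mp.integrable_comp_of_integrable i1
  have i2' := mp.integrable_comp_of_integrable i2
  have e : ∀ G : (κ → ℝ) → ℝ, Integrable G (stdGauss κ) → ∫ ω, G ω ∂(stdGauss κ) =
      ∫ ω, ∫ x, G (Function.update ω k x) ∂(gaussianReal 0 1) ∂(stdGauss κ) := by
    intro G hG
    have hmap := mp.map_eq
    conv_lhs => rw [← hmap]
    rw [integral_map mp.measurable.aemeasurable (by rw [hmap]; exact hG.aestronglyMeasurable)]
    exact integral_prod _ (mp.integrable_comp_of_integrable hG)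
  rw [e _ i1, e _ i2]
  congr 1; ext ω
  have hmu : Measurable (fun x : ℝ => Function.update ω k x) := measurable_update ω
  have b : ∀ G : (κ → ℝ) → ℝ, Measurable G → (∀ ω, |G ω| ≤ C) →
      Integrable (fun x => G (Function.update ω k x)) (gaussianReal 0 1) := fun G hG hb =>
    Integrable.of_bound (hG.comp hmu).aestronglyMeasurable C
      (Filter.Eventually.of_forall fun x => hb _)
  have h : Integrable (fun x : ℝ => x) (gaussianReal 0 1) := by
    simpa using integrable_pow_gaussian 1
  have := gaussian_stein (hd ω) (b F hF hC)
    (h.mul_bdd (c := C) (hF.comp hmu).aestronglyMeasurable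
      (Filter.Eventually.of_forall fun x => hC _))
    (b F' hF' hC')
  simpa using this

end Pi

/-- Boltzmann weights of an energy function. -/
def boltz {X : Type} [Fintype X] (E : X → ℝ) (x : X) : ℝ := Real.exp (E x) / ∑ y, Real.exp (E y)

section Boltz

variable {X : Type} [Fintype X] [Nonempty X]

lemma sum_exp_pos (E : X → ℝ) : 0 < ∑ y, Real.exp (E y) :=
  Finset.sum_pos (fun _ _ => Real.exp_pos _) Finset.univ_nonempty

lemma boltz_nonneg (E : X → ℝ) (x : X) : 0 ≤ boltz E x :=
  div_nonneg (Real.exp_pos _).le (sum_exp_pos E).le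

lemma sum_boltz (E : X → ℝ) : ∑ x, boltz E x = 1 := by
  simp only [boltz, ← Finset.sum_div]
  exact div_self (sum_exp_pos E).ne'

lemma boltz_le_one (E : X → ℝ) (x : X) : boltz E x ≤ 1 := by
  rw [← sum_boltz E]
  exact Finset.single_le_sum (fun y _ => boltz_nonneg E y) (Finset.mem_univ x)

lemma abs_sum_boltz_le (E g : X → ℝ) {B : ℝ} (hB : ∀ x, |g x| ≤ B) :
    |∑ x, boltz E x * g x| ≤ B := by
  calc |∑ x, boltz E x * g x| ≤ ∑ x, |boltz E x * g x| := Finset.abs_sum_le_sum_abs _ _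
    _ ≤ ∑ x, boltz E x * B := by
        refine Finset.sum_le_sum fun x _ => ?_
        rw [abs_mul, abs_of_nonneg (boltz_nonneg E x)]
        exact mul_le_mul_of_nonneg_left (hB x) (boltz_nonneg E x)
    _ = B := by rw [← Finset.sum_mul, sum_boltz, one_mul]

lemma hasDerivAt_boltz {E : ℝ → X → ℝ} {E' : X → ℝ} {s : ℝ}
    (h : ∀ x, HasDerivAt (fun s => E s x) (E' x) s) (x : X) :
    HasDerivAt (fun s => boltz (E s) x)
      (boltz (E s) x * (E' x - ∑ y, boltz (E s) y * E' y)) s := by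
  have hZ : HasDerivAt (fun s => ∑ y, Real.exp (E s y)) (∑ y, Real.exp (E s y) * E' y) s :=
    HasDerivAt.fun_sum fun y _ => (h y).exp
  refine ((h x).exp.fun_div hZ (sum_exp_pos (E s)).ne').congr_deriv ?_
  have hne := (sum_exp_pos (E s)).ne'
  have e : ∑ y, boltz (E s) y * E' y =
      (∑ y, Real.exp (E s y) * E' y) / ∑ y, Real.exp (E s y) := by
    rw [Finset.sum_div]
    exact Finset.sum_congr rfl fun y _ => by rw [boltz]; ring
  rw [e, boltz]
  field_simp

end Boltz

lemma triple_sum_mul {X : Type} [Fintype X] (U V W : X → ℝ) :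
    ∑ x, ∑ y, ∑ z, U x * V y * W z = (∑ x, U x) * (∑ y, V y) * ∑ z, W z := by
  rw [Finset.sum_mul_sum, Finset.sum_mul]
  refine Finset.sum_congr rfl fun x _ => ?_
  rw [Finset.sum_mul]
  exact Finset.sum_congr rfl fun y _ => by rw [Finset.mul_sum]

section Derivative

variable {X κ : Type} [Fintype X] [Nonempty X] [Fintype κ] [DecidableEq κ]

/-- A random energy, linear in the Gaussian coordinates `ω`. -/
def linEnergy (a : κ → X → ℝ) (c : X → ℝ) (ω : κ → ℝ) (x : X) : ℝ := ∑ k, ω k * a k x + c x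

omit [Fintype X] [Nonempty X] [DecidableEq κ] in
lemma measurable_linEnergy (a : κ → X → ℝ) (c : X → ℝ) (x : X) :
    Measurable (fun ω => linEnergy a c ω x) := by
  unfold linEnergy; fun_prop

omit [Nonempty X] [DecidableEq κ] in
lemma measurable_boltz_linEnergy (a : κ → X → ℝ) (c : X → ℝ) (x : X) :
    Measurable (fun ω => boltz (linEnergy a c ω) x) := by
  have := measurable_linEnergy a c
  unfold boltz; fun_prop

omit [Fintype X] [Nonempty X] in
lemma hasDerivAt_linEnergy_update (a : κ → X → ℝ) (c : X → ℝ) (ω : κ → ℝ) (k : κ) (x : X) (s : ℝ) :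
    HasDerivAt (fun y => linEnergy a c (Function.update ω k y) x) (a k x) s := by
  have : (fun y => linEnergy a c (Function.update ω k y) x) =
      fun y => y * a k x + (∑ j ∈ univ.erase k, ω j * a j x + c x) := by
    ext y
    simp only [linEnergy]
    rw [← Finset.add_sum_erase _ _ (Finset.mem_univ k)]
    simp only [Function.update_self]
    rw [add_assoc]; congr 2
    refine Finset.sum_congr rfl fun j hj => ?_
    rw [Function.update_of_ne (Finset.ne_of_mem_erase hj)]
  rw [this]
  simpa using ((hasDerivAt_id s).mul_const (a k x)).add_const
    (∑ j ∈ univ.erase k, ω j * a j x + c x)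

omit [Nonempty X] in
lemma sum_triple_expand (p f u v : X → ℝ) (hp : ∑ x, p x = 1) :
    ∑ x, ∑ y, ∑ z, f x * (p x * p y * p z) *
        (u x * v x - u y * v y + 2 * (u y * v z) - u x * v y - u y * v x) =
      ∑ x, f x * (p x * (v x - ∑ y, p y * v y) * (u x - ∑ y, p y * u y) +
        p x * (0 - ∑ y, p y * (v y - ∑ z, p z * v z) * u y)) := by
  set M := ∑ y, p y * v y with hM
  set M' := ∑ y, p y * u y with hM'
  have h1 : ∑ y, p y * (v y - M) * u y = ∑ y, p y * (u y * v y) - M * M' := by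
    rw [hM', Finset.mul_sum, ← Finset.sum_sub_distrib]
    exact Finset.sum_congr rfl fun y _ => by ring
  have e1 := triple_sum_mul (fun x => f x * p x * (u x * v x)) p p
  have e2 := triple_sum_mul (fun x => f x * p x) (fun y => p y * (u y * v y)) p
  have e3 := triple_sum_mul (fun x => f x * p x) (fun y => p y * u y) (fun y => p y * v y)
  have e4 := triple_sum_mul (fun x => f x * p x * u x) (fun y => p y * v y) p
  have e5 := triple_sum_mul (fun x => f x * p x * v x) (fun y => p y * u y) p
  rw [h1]
  simp only [← hM, ← hM', hp, mul_one] at e1 e2 e3 e4 e5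
  calc _ = (∑ x, ∑ y, ∑ z, f x * p x * (u x * v x) * p y * p z)
        - (∑ x, ∑ y, ∑ z, f x * p x * (p y * (u y * v y)) * p z)
        + 2 * (∑ x, ∑ y, ∑ z, f x * p x * (p y * u y) * (p z * v z))
        - (∑ x, ∑ y, ∑ z, f x * p x * u x * (p y * v y) * p z)
        - (∑ x, ∑ y, ∑ z, f x * p x * v x * (p y * u y) * p z) := by
        simp only [Finset.mul_sum, ← Finset.sum_add_distrib, ← Finset.sum_sub_distrib]
        refine Finset.sum_congr rfl fun x _ => Finset.sum_congr rfl fun y _ =>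
          Finset.sum_congr rfl fun z _ => by ring
    _ = _ := by
        rw [e1, e2, e3, e4, e5]
        generalize ∑ y, p y * (u y * v y) = Q
        simp only [Finset.sum_mul, Finset.mul_sum, ← Finset.sum_add_distrib,
          ← Finset.sum_sub_distrib]
        exact Finset.sum_congr rfl fun x _ => by ring

/-- Gaussian integration by parts for the numerator of the derivative of a Gibbs average. -/
lemma stein_gibbs (a : κ → X → ℝ) (c : X → ℝ) (f : X → ℝ) (b : X → ℝ) (k : κ) {B : ℝ}
    (hB : ∀ x, |a k x| ≤ B) (hb : ∀ x, |b x| ≤ B) :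
    Integrable (fun ω => ω k * ∑ x, f x * (boltz (linEnergy a c ω) x *
        (b x - ∑ y, boltz (linEnergy a c ω) y * b y))) (stdGauss κ) ∧
    ∫ ω, ω k * ∑ x, f x * (boltz (linEnergy a c ω) x *
        (b x - ∑ y, boltz (linEnergy a c ω) y * b y)) ∂(stdGauss κ) =
      ∫ ω, ∑ x, ∑ y, ∑ z, f x * (boltz (linEnergy a c ω) x * boltz (linEnergy a c ω) y *
        boltz (linEnergy a c ω) z) *
        (b x * a k x - b y * a k y + 2 * (b y * a k z) - b x * a k y - b y * a k x)
        ∂(stdGauss κ) := by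
  have hm := measurable_boltz_linEnergy a c
  have hB0 : 0 ≤ B := (abs_nonneg _).trans (hB (Classical.arbitrary X))
  simp_rw [sum_triple_expand _ f b (a k) (sum_boltz _)]
  have two : ∀ (E g : X → ℝ), (∀ x, |g x| ≤ B) → ∀ x, |g x - ∑ y, boltz E y * g y| ≤ 2 * B := by
    intro E g hg x
    calc _ ≤ |g x| + |∑ y, boltz E y * g y| := abs_sub _ _
      _ ≤ 2 * B := by linarith [hg x, abs_sum_boltz_le E g hg]
  have bp : ∀ (E : X → ℝ) (x : X), |boltz E x| ≤ 1 := fun E x => by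
    rw [abs_of_nonneg (boltz_nonneg E x)]; exact boltz_le_one E x
  have hC : ∀ ω, |∑ x, f x * (boltz (linEnergy a c ω) x *
        (b x - ∑ y, boltz (linEnergy a c ω) y * b y))| ≤ ∑ x, |f x| * (2 * B + 6 * B ^ 2) := by
    intro ω
    refine (Finset.abs_sum_le_sum_abs _ _).trans (Finset.sum_le_sum fun x _ => ?_)
    rw [abs_mul]
    refine mul_le_mul_of_nonneg_left ?_ (abs_nonneg _)
    rw [abs_mul]
    calc _ ≤ 1 * (2 * B) := mul_le_mul (bp _ _) (two _ _ hb x) (abs_nonneg _) zero_le_one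
      _ ≤ _ := by nlinarith
  have hF : Measurable fun ω => ∑ x, f x * (boltz (linEnergy a c ω) x *
        (b x - ∑ y, boltz (linEnergy a c ω) y * b y)) := by fun_prop
  refine ⟨?_, stdGauss_stein k hF (by fun_prop) hC ?_ ?_⟩
  · exact (integrable_coord_stdGauss k).mul_bdd (c := ∑ x, |f x| * (2 * B + 6 * B ^ 2))
      hF.aestronglyMeasurable (Filter.Eventually.of_forall hC)
  · intro ω
    refine (Finset.abs_sum_le_sum_abs _ _).trans (Finset.sum_le_sum fun x _ => ?_)
    rw [abs_mul]
    refine mul_le_mul_of_nonneg_left ?_ (abs_nonneg _)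
    set E := linEnergy a c ω
    have h1 : |∑ y, boltz E y * (a k y - ∑ z, boltz E z * a k z) * b y| ≤ 2 * B * B := by
      simp_rw [mul_assoc]
      refine abs_sum_boltz_le E _ fun y => ?_
      rw [abs_mul]
      have := mul_le_mul (two E _ hB y) (hb y) (abs_nonneg _) (by positivity)
      linarith
    have h2 : |boltz E x * (a k x - ∑ y, boltz E y * a k y) * (b x - ∑ y, boltz E y * b y)| ≤
        1 * (2 * B) * (2 * B) := by
      rw [abs_mul, abs_mul]
      exact mul_le_mul (mul_le_mul (bp _ _) (two _ _ hB x) (abs_nonneg _) zero_le_one)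
        (two _ _ hb x) (abs_nonneg _) (by positivity)
    have h3 : |boltz E x * (0 - ∑ y, boltz E y * (a k y - ∑ z, boltz E z * a k z) * b y)| ≤
        1 * (2 * B * B) := by
      rw [abs_mul, zero_sub, abs_neg]
      exact mul_le_mul (bp _ _) h1 (abs_nonneg _) zero_le_one
    refine (abs_add_le _ _).trans ?_
    nlinarith
  · intro ω s
    have hd := fun x => hasDerivAt_boltz (E := fun y => linEnergy a c (Function.update ω k y))
      (s := s) (fun x => hasDerivAt_linEnergy_update a c ω k x s) x
    refine HasDerivAt.fun_sum fun x _ => HasDerivAt.const_mul _ ?_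
    refine ((hd x).fun_mul ((hasDerivAt_const s (b x)).fun_sub
      (HasDerivAt.fun_sum fun y _ => (hd y).mul_const (b y)))).congr_deriv ?_
    ring

/-- Derivative of an averaged Gibbs expectation along a path of linear Gaussian energies. -/
theorem hasDerivAt_integral_gibbs (a a' : κ → X → ℝ → ℝ) (c f : X → ℝ) {B : ℝ}
    (ha : ∀ k x s, HasDerivAt (a k x) (a' k x s) s)
    (hB : ∀ k x s, |a k x s| ≤ B) (hB' : ∀ k x s, |a' k x s| ≤ B) (s : ℝ) :
    HasDerivAt (fun s => ∫ ω, ∑ x, f x * boltz (linEnergy (fun k x => a k x s) c ω) x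
        ∂(stdGauss κ))
      (∫ ω, ∑ x, ∑ y, ∑ z, f x * (boltz (linEnergy (fun k x => a k x s) c ω) x *
        boltz (linEnergy (fun k x => a k x s) c ω) y *
        boltz (linEnergy (fun k x => a k x s) c ω) z) *
        (∑ k, a' k x s * a k x s - ∑ k, a' k y s * a k y s + 2 * ∑ k, a' k y s * a k z s -
          ∑ k, a' k x s * a k y s - ∑ k, a' k y s * a k x s) ∂(stdGauss κ)) s := by
  have hB0 : 0 ≤ B ∨ IsEmpty κ := by
    rcases isEmpty_or_nonempty κ with h | ⟨⟨k⟩⟩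
    · exact Or.inr h
    · exact Or.inl ((abs_nonneg _).trans (hB k (Classical.arbitrary X) 0))
  set P : ℝ → (κ → ℝ) → X → ℝ := fun s ω => boltz (linEnergy (fun k x => a k x s) c ω) with hP
  have hm : ∀ s x, Measurable (fun ω => P s ω x) := fun s x => measurable_boltz_linEnergy _ c x
  have key := hasDerivAt_integral_of_dominated_loc_of_deriv_le (μ := stdGauss κ) (𝕜 := ℝ)
    (F := fun s ω => ∑ x, f x * P s ω x) (x₀ := s) (s := Set.univ)
    (F' := fun s ω => ∑ x, f x * (P s ω x * (∑ k, ω k * a' k x s -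
      ∑ y, P s ω y * ∑ k, ω k * a' k y s)))
    (bound := fun ω => ∑ x, |f x| * (2 * ∑ k, |ω k| * B)) Filter.univ_mem
    (Filter.Eventually.of_forall fun s => (by fun_prop : Measurable _).aestronglyMeasurable)
    (Integrable.of_bound (by fun_prop : Measurable _).aestronglyMeasurable (∑ x, |f x|)
      (Filter.Eventually.of_forall fun ω => ?_))
    (by fun_prop : Measurable _).aestronglyMeasurable
    (Filter.Eventually.of_forall fun ω s _ => ?_) ?_
    (Filter.Eventually.of_forall fun ω s _ => ?_)
  · refine key.2.congr_deriv ?_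
    have h1 : ∀ ω, ∑ x, f x * (P s ω x * (∑ k, ω k * a' k x s -
        ∑ y, P s ω y * ∑ k, ω k * a' k y s)) =
        ∑ k, ω k * ∑ x, f x * (P s ω x * (a' k x s - ∑ y, P s ω y * a' k y s)) := by
      intro ω
      simp only [Finset.mul_sum, mul_sub]
      simp only [Finset.sum_sub_distrib]
      rw [Finset.sum_comm]
      congr 1
      · exact Finset.sum_congr rfl fun k _ => Finset.sum_congr rfl fun x _ => by ring
      · simp_rw [Finset.sum_comm (s := (univ : Finset X)) (t := (univ : Finset κ))]
        exact Finset.sum_congr rfl fun k _ => Finset.sum_congr rfl fun x _ =>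
          Finset.sum_congr rfl fun y _ => by ring
    simp_rw [h1]
    have st := fun k => stein_gibbs (fun k x => a k x s) c f (fun x => a' k x s) k
      (fun x => hB k x s) (fun x => hB' k x s)
    rw [integral_finsetSum _ fun k _ => (st k).1]
    simp_rw [fun k => (st k).2]
    rw [← integral_finsetSum]
    · congr 1; ext ω
      rw [Finset.sum_comm]
      refine Finset.sum_congr rfl fun x _ => ?_
      rw [Finset.sum_comm]
      refine Finset.sum_congr rfl fun y _ => ?_
      rw [Finset.sum_comm]
      refine Finset.sum_congr rfl fun z _ => ?_
      rw [← Finset.mul_sum]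
      simp only [Finset.sum_add_distrib, Finset.sum_sub_distrib, Finset.mul_sum]
    · intro k _
      have bp : ∀ s ω x, |P s ω x| ≤ 1 := fun s ω x => by
        rw [abs_of_nonneg (boltz_nonneg _ x)]; exact boltz_le_one _ x
      refine integrable_finsetSum _ fun x _ => integrable_finsetSum _ fun y _ =>
        integrable_finsetSum _ fun z _ => Integrable.mul_const (Integrable.const_mul ?_ _) _
      refine Integrable.of_bound
        (((hm s x).mul (hm s y)).mul (hm s z)).aestronglyMeasurable 1
        (Filter.Eventually.of_forall fun ω => ?_)
      rw [Real.norm_eq_abs, abs_mul, abs_mul]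
      exact mul_le_one₀ (mul_le_one₀ (bp _ _ _) (abs_nonneg _) (bp _ _ _)) (abs_nonneg _)
        (bp _ _ _)
  · refine (norm_sum_le _ _).trans (Finset.sum_le_sum fun x _ => ?_)
    rw [norm_mul, Real.norm_eq_abs, Real.norm_eq_abs, abs_of_nonneg (boltz_nonneg _ x)]
    exact mul_le_of_le_one_right (abs_nonneg _) (boltz_le_one _ x)
  · have hE : ∀ x, |∑ k, ω k * a' k x s| ≤ ∑ k, |ω k| * B := fun x =>
      (Finset.abs_sum_le_sum_abs _ _).trans (Finset.sum_le_sum fun k _ => by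
        rw [abs_mul]; exact mul_le_mul_of_nonneg_left (hB' k x s) (abs_nonneg _))
    refine (norm_sum_le _ _).trans (Finset.sum_le_sum fun x _ => ?_)
    rw [norm_mul, norm_mul, Real.norm_eq_abs, Real.norm_eq_abs, Real.norm_eq_abs,
      abs_of_nonneg (boltz_nonneg _ x)]
    refine mul_le_mul_of_nonneg_left ?_ (abs_nonneg _)
    refine (mul_le_of_le_one_left (abs_nonneg _) (boltz_le_one _ x)).trans ?_
    refine (abs_sub _ _).trans ?_
    linarith [hE x, abs_sum_boltz_le (linEnergy (fun k x => a k x s) c ω) _ hE]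
  · exact integrable_finsetSum _ fun x _ => Integrable.const_mul (Integrable.const_mul
      (integrable_finsetSum _ fun k _ => (integrable_coord_stdGauss k).norm.mul_const B) _) _
  · refine HasDerivAt.fun_sum fun x _ => HasDerivAt.const_mul _ ?_
    refine hasDerivAt_boltz (E := fun s => linEnergy (fun k x => a k x s) c ω) (s := s)
      (E' := fun x => ∑ k, ω k * a' k x s) (fun x => ?_) x
    exact (HasDerivAt.fun_sum fun k _ => (ha k x s).const_mul (ω k)).add_const (c x)

end Derivative

section ReplicaAverage

variable {X κ ι ι₂ : Type} [Fintype X] [Nonempty X] [Fintype κ]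
  [Fintype ι] [DecidableEq ι] [Fintype ι₂] [DecidableEq ι₂]

/-- Averaged Gibbs expectation of a function of `ι`-indexed replicas for a linear Gaussian
energy. -/
def repAvg (a : κ → X → ℝ) (c : X → ℝ) (f : (ι → X) → ℝ) : ℝ :=
  ∫ ω, ∑ σs, f σs * ∏ l, boltz (linEnergy a c ω) (σs l) ∂(stdGauss κ)

/-- The averaged weight of a replica configuration. -/
def repWeight (a : κ → X → ℝ) (c : X → ℝ) (σs : ι → X) : ℝ :=
  ∫ ω, ∏ l, boltz (linEnergy a c ω) (σs l) ∂(stdGauss κ)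

omit [DecidableEq ι] in
lemma prod_boltz_nonneg (E : X → ℝ) (σs : ι → X) : 0 ≤ ∏ l, boltz E (σs l) :=
  Finset.prod_nonneg fun l _ => boltz_nonneg E (σs l)

omit [DecidableEq ι] in
lemma prod_boltz_le_one (E : X → ℝ) (σs : ι → X) : ∏ l, boltz E (σs l) ≤ 1 :=
  Finset.prod_le_one (fun l _ => boltz_nonneg E (σs l)) fun l _ => boltz_le_one E (σs l)

lemma sum_prod_boltz (E : X → ℝ) : ∑ σs : ι → X, ∏ l, boltz E (σs l) = 1 := by
  have := Finset.prod_univ_sum (fun _ : ι => (univ : Finset X)) (fun _ x => boltz E x)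
  rw [Fintype.piFinset_univ] at this
  rw [← this]
  simp [sum_boltz]

omit [Nonempty X] [DecidableEq ι] in
lemma measurable_prod_boltz (a : κ → X → ℝ) (c : X → ℝ) (σs : ι → X) :
    Measurable fun ω => ∏ l, boltz (linEnergy a c ω) (σs l) :=
  Finset.measurable_prod _ fun l _ => measurable_boltz_linEnergy a c (σs l)

omit [DecidableEq ι] in
lemma integrable_prod_boltz (a : κ → X → ℝ) (c : X → ℝ) (σs : ι → X) :
    Integrable (fun ω => ∏ l, boltz (linEnergy a c ω) (σs l)) (stdGauss κ) :=
  Integrable.of_bound (measurable_prod_boltz a c σs).aestronglyMeasurable 1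
    (Filter.Eventually.of_forall fun ω => by
      rw [Real.norm_eq_abs, abs_of_nonneg (prod_boltz_nonneg _ σs)]
      exact prod_boltz_le_one _ σs)

lemma repAvg_eq_sum (a : κ → X → ℝ) (c : X → ℝ) (f : (ι → X) → ℝ) :
    repAvg a c f = ∑ σs, f σs * repWeight a c σs := by
  unfold repAvg repWeight
  rw [integral_finsetSum _ fun σs _ => (integrable_prod_boltz a c σs).const_mul _]
  simp_rw [integral_const_mul]

omit [DecidableEq ι] in
lemma repWeight_nonneg (a : κ → X → ℝ) (c : X → ℝ) (σs : ι → X) : 0 ≤ repWeight a c σs :=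
  integral_nonneg fun _ => prod_boltz_nonneg _ σs

lemma sum_repWeight (a : κ → X → ℝ) (c : X → ℝ) : ∑ σs : ι → X, repWeight a c σs = 1 := by
  have := repAvg_eq_sum (ι := ι) a c (fun _ => 1)
  simp only [one_mul] at this
  rw [← this]
  simp [repAvg, sum_prod_boltz]

omit [Nonempty X] in
lemma repAvg_comp_equiv (a : κ → X → ℝ) (c : X → ℝ) (e : ι ≃ ι₂) (f : (ι → X) → ℝ) :
    repAvg a c (fun σs : ι₂ → X => f (σs ∘ e)) = repAvg a c f := by
  unfold repAvg
  congr 1; ext ω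
  refine Fintype.sum_equiv (e.symm.arrowCongr (Equiv.refl X)) _ _ fun σs => ?_
  congr 1
  · exact Fintype.prod_equiv e.symm _ _ fun l => by simp

lemma repAvg_comp_inl (a : κ → X → ℝ) (c : X → ℝ) (f : (ι → X) → ℝ) :
    repAvg a c (fun σs : ι ⊕ ι₂ → X => f (σs ∘ Sum.inl)) = repAvg a c f := by
  unfold repAvg
  congr 1; ext ω
  rw [Fintype.sum_equiv (Equiv.sumArrowEquivProdArrow ι ι₂ X) _
    (fun p => f p.1 * ((∏ l, boltz (linEnergy a c ω) (p.1 l)) *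
      ∏ l, boltz (linEnergy a c ω) (p.2 l))) fun σs => by
      rw [Fintype.prod_sum_type]; rfl]
  rw [Fintype.sum_prod_type]
  refine Finset.sum_congr rfl fun x _ => ?_
  simp_rw [← mul_assoc]
  rw [← Finset.mul_sum, sum_prod_boltz, mul_one]

lemma repAvg_comp_injective (a : κ → X → ℝ) (c : X → ℝ) {e : ι → ι₂} (he : Function.Injective e)
    (f : (ι → X) → ℝ) :
    repAvg a c (fun σs : ι₂ → X => f (fun l => σs (e l))) = repAvg a c f := by
  classical
  let E : ι ⊕ {x // x ∉ Set.range e} ≃ ι₂ :=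
    ((Equiv.ofInjective e he).sumCongr (Equiv.refl _)).trans (Equiv.sumCompl (· ∈ Set.range e))
  have h := repAvg_comp_equiv a c E
    (fun σs : ι ⊕ {x // x ∉ Set.range e} → X => f (σs ∘ Sum.inl))
  rw [repAvg_comp_inl] at h
  rw [← h]
  rfl

/-- The tripled index set carrying the replicas created by differentiation. -/
abbrev Trip (ι : Type) := ι ⊕ (ι ⊕ ι)

omit [Nonempty X] in
lemma prod_boltz_eq (a : κ → X → ℝ) (c : X → ℝ) (ω : κ → ℝ) (σs : ι → X) :
    ∏ l, boltz (linEnergy a c ω) (σs l) =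
      boltz (linEnergy (fun k (σs : ι → X) => ∑ l, a k (σs l)) (fun σs => ∑ l, c (σs l)) ω) σs := by
  have h : ∀ σs : ι → X, linEnergy (fun k (σs : ι → X) => ∑ l, a k (σs l))
      (fun σs => ∑ l, c (σs l)) ω σs = ∑ l, linEnergy a c ω (σs l) := by
    intro σs
    simp only [linEnergy, Finset.sum_add_distrib, Finset.mul_sum]
    rw [Finset.sum_comm]
  simp only [boltz, h, Finset.prod_div_distrib, Real.exp_sum]
  congr 1
  have := Finset.prod_univ_sum (fun _ : ι => (univ : Finset X))
    (fun _ x => Real.exp (linEnergy a c ω x))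
  rw [Fintype.piFinset_univ] at this
  exact this

omit [Nonempty X] in
lemma sum_trip (F : (Trip ι → X) → ℝ) :
    ∑ σs, F σs = ∑ x : ι → X, ∑ y : ι → X, ∑ z : ι → X, F (Sum.elim x (Sum.elim y z)) := by
  rw [Fintype.sum_equiv (Equiv.sumArrowEquivProdArrow ι (ι ⊕ ι) X) _
    (fun p => F (Sum.elim p.1 p.2)) fun σs => by
      congr 1; ext u; rcases u with u | u <;> rfl]
  rw [Fintype.sum_prod_type]
  refine Finset.sum_congr rfl fun x _ => ?_
  rw [Fintype.sum_equiv (Equiv.sumArrowEquivProdArrow ι ι X) _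
    (fun p => F (Sum.elim x (Sum.elim p.1 p.2))) fun σs => by
      congr 2; ext u; rcases u with u | u <;> rfl]
  rw [Fintype.sum_prod_type]

theorem hasDerivAt_repAvg [DecidableEq κ] (a a' : κ → X → ℝ → ℝ) (c : X → ℝ) (f : (ι → X) → ℝ)
    {B : ℝ} (ha : ∀ k x s, HasDerivAt (a k x) (a' k x s) s)
    (hB : ∀ k x s, |a k x s| ≤ B) (hB' : ∀ k x s, |a' k x s| ≤ B) (s : ℝ) (C : X → X → ℝ)
    (hC : ∀ x y, ∑ k, a' k x s * a k y s = C x y) :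
    HasDerivAt (fun s => repAvg (fun k x => a k x s) c f)
      (repAvg (fun k x => a k x s) c (fun σs : Trip ι → X => f (fun l => σs (Sum.inl l)) *
        (∑ l, ∑ m, C (σs (.inl l)) (σs (.inl m)) -
          ∑ l, ∑ m, C (σs (.inr (.inl l))) (σs (.inr (.inl m))) +
          2 * ∑ l, ∑ m, C (σs (.inr (.inl l))) (σs (.inr (.inr m))) -
          ∑ l, ∑ m, C (σs (.inl l)) (σs (.inr (.inl m))) -
          ∑ l, ∑ m, C (σs (.inr (.inl l))) (σs (.inl m))))) s := by
  have bd : ∀ b : κ → X → ℝ → ℝ, (∀ k x s, |b k x s| ≤ B) → ∀ k (σs : ι → X) s,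
      |∑ l, b k (σs l) s| ≤ ∑ _l : ι, B := fun b hb k σs s =>
    (Finset.abs_sum_le_sum_abs _ _).trans (Finset.sum_le_sum fun l _ => hb _ _ _)
  have key := hasDerivAt_integral_gibbs (X := ι → X) (fun k σs s => ∑ l, a k (σs l) s)
    (fun k σs s => ∑ l, a' k (σs l) s) (fun σs => ∑ l, c (σs l)) f
    (fun k σs s => HasDerivAt.fun_sum fun l _ => ha k (σs l) s) (bd a hB) (bd a' hB') s
  have cov : ∀ x y : ι → X, ∑ k, (∑ l, a' k (x l) s) * ∑ m, a k (y m) s =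
      ∑ l, ∑ m, C (x l) (y m) := by
    intro x y
    simp_rw [Finset.sum_mul_sum]
    rw [Finset.sum_comm]
    refine Finset.sum_congr rfl fun l _ => ?_
    rw [Finset.sum_comm]
    exact Finset.sum_congr rfl fun m _ => hC _ _
  unfold repAvg
  simp_rw [prod_boltz_eq (ι := ι)]
  refine key.congr_deriv ?_
  congr 1; ext ω
  rw [sum_trip]
  refine Finset.sum_congr rfl fun x _ => Finset.sum_congr rfl fun y _ =>
    Finset.sum_congr rfl fun z _ => ?_
  simp only [cov, Fintype.prod_sum_type, Sum.elim_inl, Sum.elim_inr]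
  rw [prod_boltz_eq (fun k x => a k x s), prod_boltz_eq (fun k x => a k x s),
    prod_boltz_eq (fun k x => a k x s)]
  ring

end ReplicaAverage

lemma spin_mul_self (b : Bool) : spin b * spin b = 1 := by cases b <;> simp [spin]

lemma abs_spin (b : Bool) : |spin b| = 1 := by cases b <;> simp [spin]

section Cavity

variable {N : ℕ}

/-- Coefficients of the cavity path at site `i`: the couplings with site `i` are multiplied by
`sin θ`, and an independent Gaussian field of strength `β √q cos θ` acts on site `i`. -/
def cavCoef (N : ℕ) (β q : ℝ) (i : Fin N) (k : Option (Fin N × Fin N)) (σ : Cfg N) (θ : ℝ) : ℝ :=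
  k.elim (β * √q * spin (σ i) * Real.cos θ) fun p =>
    if p.1 < p.2 then β / √N * (spin (σ p.1) * spin (σ p.2)) *
      (if p.1 = i ∨ p.2 = i then Real.sin θ else 1) else 0

/-- The derivative of `cavCoef` along the path. -/
def cavCoefDeriv (N : ℕ) (β q : ℝ) (i : Fin N) (k : Option (Fin N × Fin N)) (σ : Cfg N) (θ : ℝ) :
    ℝ :=
  k.elim (-(β * √q * spin (σ i) * Real.sin θ)) fun p =>
    if p.1 < p.2 then β / √N * (spin (σ p.1) * spin (σ p.2)) *
      (if p.1 = i ∨ p.2 = i then Real.cos θ else 0) else 0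

/-- The centred overlap without site `i`. -/
def cavR (N : ℕ) (q : ℝ) (i : Fin N) (σ τ : Cfg N) : ℝ :=
  (∑ j ∈ univ.erase i, spin (σ j) * spin (τ j)) / N - q

lemma hasDerivAt_cavCoef (β q : ℝ) (i : Fin N) (k) (σ : Cfg N) (θ : ℝ) :
    HasDerivAt (cavCoef N β q i k σ) (cavCoefDeriv N β q i k σ θ) θ := by
  rcases k with _ | p
  · simp only [cavCoefDeriv, Option.elim]
    exact ((Real.hasDerivAt_cos θ).const_mul _).congr_deriv (by ring)
  · have e : cavCoef N β q i (some p) σ = fun θ =>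
      if p.1 < p.2 then β / √N * (spin (σ p.1) * spin (σ p.2)) *
        (if p.1 = i ∨ p.2 = i then Real.sin θ else 1) else 0 := rfl
    rw [e]
    simp only [cavCoefDeriv, Option.elim]
    split_ifs
    · exact (Real.hasDerivAt_sin θ).const_mul _
    · exact (hasDerivAt_const _ _).congr_deriv (by simp)
    · exact hasDerivAt_const _ _

lemma abs_cavCoef_le (β q : ℝ) (i : Fin N) (k) (σ : Cfg N) (θ : ℝ) :
    |cavCoef N β q i k σ θ| ≤ |β * √q| + |β / √N| := by
  rcases k with _ | p
  · simp only [cavCoef, Option.elim]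
    rw [abs_mul, abs_mul _ (spin _), abs_spin, mul_one]
    nlinarith [abs_nonneg (β * √q), abs_nonneg (β / √N), Real.abs_cos_le_one θ]
  · simp only [cavCoef, Option.elim]
    split_ifs
    · rw [abs_mul, abs_mul, abs_mul, abs_spin, abs_spin]
      nlinarith [abs_nonneg (β * √q), abs_nonneg (β / √N), Real.abs_sin_le_one θ]
    · rw [abs_mul, abs_mul, abs_mul, abs_spin, abs_spin, abs_one]
      nlinarith [abs_nonneg (β * √q), abs_nonneg (β / √N)]
    · rw [abs_zero]; positivity

lemma abs_cavCoefDeriv_le (β q : ℝ) (i : Fin N) (k) (σ : Cfg N) (θ : ℝ) :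
    |cavCoefDeriv N β q i k σ θ| ≤ |β * √q| + |β / √N| := by
  rcases k with _ | p
  · simp only [cavCoefDeriv, Option.elim]
    rw [abs_neg, abs_mul, abs_mul _ (spin _), abs_spin, mul_one]
    nlinarith [abs_nonneg (β * √q), abs_nonneg (β / √N), Real.abs_sin_le_one θ]
  · simp only [cavCoefDeriv, Option.elim]
    split_ifs
    · rw [abs_mul, abs_mul, abs_mul, abs_spin, abs_spin]
      nlinarith [abs_nonneg (β * √q), abs_nonneg (β / √N), Real.abs_cos_le_one θ]
    · rw [mul_zero, abs_zero]; positivity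
    · rw [abs_zero]; positivity

lemma sum_pairs_through (i : Fin N) (F : Fin N → Fin N → ℝ) (hF : ∀ a b, F a b = F b a) :
    ∑ p : Fin N × Fin N, (if p.1 < p.2 then (if p.1 = i ∨ p.2 = i then F p.1 p.2 else 0) else 0) =
      ∑ j ∈ univ.erase i, F i j := by
  rw [Fintype.sum_prod_type]
  have h : ∀ a b : Fin N, (if a < b then (if a = i ∨ b = i then F a b else 0) else 0) =
      (if a = i then (if i < b then F i b else 0) else 0) +
      (if b = i then (if a < i then F i a else 0) else 0) := by
    intro a b
    by_cases ha : a = i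
    · subst ha
      by_cases hb : b = a
      · subst hb; simp
      · simp [hb]
    · by_cases hb : b = i
      · subst hb; simp [ha, hF a b]
      · simp [ha, hb]
  simp only [h, Finset.sum_add_distrib]
  rw [Finset.sum_comm]
  simp only [Finset.sum_ite_eq', Finset.mem_univ, if_true]
  rw [← Finset.sum_add_distrib, ← Finset.add_sum_erase _ _ (Finset.mem_univ i)]
  simp only [lt_irrefl, if_false, add_zero, zero_add]
  refine Finset.sum_congr rfl fun j hj => ?_
  rcases lt_or_gt_of_ne (Finset.ne_of_mem_erase hj) with h | h
  · simp [h, h.not_gt]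
  · simp [h, h.not_gt]

lemma sum_cavCoef (β : ℝ) {q : ℝ} (hq : 0 ≤ q) (i : Fin N) (σ τ : Cfg N) (θ : ℝ) :
    ∑ k, cavCoefDeriv N β q i k σ θ * cavCoef N β q i k τ θ =
      Real.sin θ * Real.cos θ * β ^ 2 * (spin (σ i) * spin (τ i) * cavR N q i σ τ) := by
  have hN : (0 : ℝ) < N := by exact_mod_cast i.pos
  have hs : √(N : ℝ) * √N = N := Real.mul_self_sqrt hN.le
  have hs' : √(N : ℝ) ≠ 0 := (Real.sqrt_pos.2 hN).ne'
  have hqs : √q * √q = q := Real.mul_self_sqrt hq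
  rw [Fintype.sum_option]
  have h1 : ∀ p : Fin N × Fin N, cavCoefDeriv N β q i (some p) σ θ * cavCoef N β q i (some p) τ θ =
      (if p.1 < p.2 then (if p.1 = i ∨ p.2 = i then Real.sin θ * Real.cos θ * β ^ 2 / N *
        (spin (σ p.1) * spin (σ p.2) * (spin (τ p.1) * spin (τ p.2))) else 0) else 0) := by
    intro p
    simp only [cavCoef, cavCoefDeriv, Option.elim]
    split_ifs
    · have e : β ^ 2 / (N : ℝ) = β / √N * (β / √N) := by
        rw [div_mul_div_comm, hs]; ring
      rw [mul_div_assoc, e]; ring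
    · ring
    · ring
  simp_rw [h1]
  rw [sum_pairs_through i (fun a b => Real.sin θ * Real.cos θ * β ^ 2 / N *
        (spin (σ a) * spin (σ b) * (spin (τ a) * spin (τ b)))) fun a b => by ring]
  simp only [cavCoef, cavCoefDeriv, Option.elim, cavR]
  have h2 : ∑ j ∈ univ.erase i, Real.sin θ * Real.cos θ * β ^ 2 / N *
        (spin (σ i) * spin (σ j) * (spin (τ i) * spin (τ j))) =
      Real.sin θ * Real.cos θ * β ^ 2 * (spin (σ i) * spin (τ i) *
        ((∑ j ∈ univ.erase i, spin (σ j) * spin (τ j)) / N)) := by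
    rw [Finset.sum_div, Finset.mul_sum, Finset.mul_sum]
    exact Finset.sum_congr rfl fun j _ => by ring
  rw [h2]
  linear_combination (-(β ^ 2 * spin (σ i) * spin (τ i) * Real.sin θ * Real.cos θ)) * hqs

lemma cavR_self (q : ℝ) (i : Fin N) (σ : Cfg N) : cavR N q i σ σ = (N - 1) / N - q := by
  have : 1 ≤ N := i.pos
  simp [cavR, spin_mul_self, Finset.card_erase_of_mem, Nat.cast_sub this]

lemma cavR_comm (q : ℝ) (i : Fin N) (σ τ : Cfg N) : cavR N q i σ τ = cavR N q i τ σ := by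
  simp [cavR, mul_comm]

lemma abs_cavR_le {q : ℝ} (hq : 0 ≤ q) (hq1 : q ≤ 1) (i : Fin N) (σ τ : Cfg N) :
    |cavR N q i σ τ| ≤ 2 := by
  have hN : (0 : ℝ) < N := by exact_mod_cast i.pos
  have : |(∑ j ∈ univ.erase i, spin (σ j) * spin (τ j)) / N| ≤ 1 := by
    rw [abs_div, Nat.abs_cast, div_le_one hN]
    refine (Finset.abs_sum_le_sum_abs _ _).trans ?_
    simp only [abs_mul, abs_spin, mul_one, Finset.sum_const, nsmul_eq_mul]
    exact_mod_cast (Finset.card_le_univ _).trans (by simp)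
  unfold cavR
  rw [abs_le] at this ⊢
  constructor <;> linarith [this.1, this.2]

/-- The coefficients with which the pairs of replicas enter the cavity derivative. -/
def pairCoef {ι : Type} [DecidableEq ι] : Trip ι → Trip ι → ℝ
  | .inl l, .inl m => if l = m then 0 else 1
  | .inr (.inl l), .inr (.inl m) => if l = m then 0 else -1
  | .inr (.inl _), .inr (.inr _) => 2
  | .inl _, .inr (.inl _) => -2
  | _, _ => 0

lemma pairCoef_self {ι : Type} [DecidableEq ι] (u : Trip ι) : pairCoef u u = 0 := by
  rcases u with u | u | u <;> simp [pairCoef]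

lemma abs_pairCoef_le {ι : Type} [DecidableEq ι] (u v : Trip ι) : |pairCoef u v| ≤ 2 := by
  rcases u with u | u | u <;> rcases v with v | v | v <;> simp only [pairCoef] <;>
    (try split_ifs) <;> norm_num

/-- Averages along the cavity path. -/
def cavNu (N : ℕ) (β h q : ℝ) (i : Fin N) (θ : ℝ) {ι : Type} [Fintype ι] [DecidableEq ι]
    (f : (ι → Cfg N) → ℝ) : ℝ :=
  repAvg (fun k σ => cavCoef N β q i k σ θ) (fun σ => h * ∑ j, spin (σ j)) f

variable {ι : Type} [Fintype ι] [DecidableEq ι]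

/-- The insertion produced by one cavity derivative. -/
def cavIns (N : ℕ) (q : ℝ) (i : Fin N) (σs : Trip ι → Cfg N) : ℝ :=
  ∑ u, ∑ v, pairCoef u v * (spin (σs u i) * spin (σs v i) * cavR N q i (σs u) (σs v))

theorem hasDerivAt_cavNu (β h : ℝ) {q : ℝ} (hq : 0 ≤ q) (i : Fin N) (f : (ι → Cfg N) → ℝ)
    (θ : ℝ) :
    HasDerivAt (fun θ => cavNu N β h q i θ f)
      (Real.sin θ * Real.cos θ * (β ^ 2 * cavNu N β h q i θ (fun σs : Trip ι → Cfg N =>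
        f (fun l => σs (Sum.inl l)) * cavIns N q i σs))) θ := by
  have key := hasDerivAt_repAvg (cavCoef N β q i) (cavCoefDeriv N β q i)
    (fun σ => h * ∑ j, spin (σ j)) f (hasDerivAt_cavCoef β q i) (abs_cavCoef_le β q i)
    (abs_cavCoefDeriv_le β q i) θ _ (fun σ τ => sum_cavCoef β hq i σ τ θ)
  refine key.congr_deriv ?_
  unfold cavNu
  rw [repAvg_eq_sum, repAvg_eq_sum, Finset.mul_sum, Finset.mul_sum]
  refine Finset.sum_congr rfl fun σs _ => ?_
  have hins : cavIns N q i σs =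
      ∑ l, ∑ m, spin (σs (.inl l) i) * spin (σs (.inl m) i) *
          cavR N q i (σs (.inl l)) (σs (.inl m)) -
      ∑ l, ∑ m, spin (σs (.inr (.inl l)) i) * spin (σs (.inr (.inl m)) i) *
          cavR N q i (σs (.inr (.inl l))) (σs (.inr (.inl m))) +
      2 * ∑ l, ∑ m, spin (σs (.inr (.inl l)) i) * spin (σs (.inr (.inr m)) i) *
          cavR N q i (σs (.inr (.inl l))) (σs (.inr (.inr m))) -
      2 * ∑ l, ∑ m, spin (σs (.inl l) i) * spin (σs (.inr (.inl m)) i) *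
          cavR N q i (σs (.inl l)) (σs (.inr (.inl m))) := by
    have diag : ∀ (φ : ι → Cfg N), ∑ l, ∑ m, (if l = m then (0:ℝ) else 1) *
        (spin (φ l i) * spin (φ m i) * cavR N q i (φ l) (φ m)) =
        ∑ l, ∑ m, spin (φ l i) * spin (φ m i) * cavR N q i (φ l) (φ m) -
          ∑ _l : ι, ((N - 1) / N - q) := by
      intro φ
      rw [← Finset.sum_sub_distrib]
      refine Finset.sum_congr rfl fun l _ => ?_
      rw [← Finset.add_sum_erase _ _ (Finset.mem_univ l),
        ← Finset.add_sum_erase univ (fun m => spin (φ l i) * spin (φ m i) *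
          cavR N q i (φ l) (φ m)) (Finset.mem_univ l), spin_mul_self, cavR_self]
      simp only [if_true, zero_mul, zero_add, one_mul, add_sub_cancel_left]
      refine Finset.sum_congr rfl fun m hm => ?_
      rw [if_neg (Finset.ne_of_mem_erase hm).symm, one_mul]
    have d1 := diag (fun l => σs (.inl l))
    have d2 := diag (fun l => σs (.inr (.inl l)))
    have neg : ∀ l m : ι, (if l = m then (0:ℝ) else -1) = -(if l = m then (0:ℝ) else 1) := by
      intro l m; split_ifs <;> simp
    simp only [cavIns, Fintype.sum_sum_type, pairCoef, neg, zero_mul, Finset.sum_const_zero,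
      add_zero, zero_add, Finset.sum_add_distrib, neg_mul, Finset.sum_neg_distrib]
    rw [d1, d2]
    simp only [Finset.mul_sum]
    ring
  have hsym : ∑ l, ∑ m, spin (σs (.inr (.inl l)) i) * spin (σs (.inl m) i) *
      cavR N q i (σs (.inr (.inl l))) (σs (.inl m)) =
      ∑ l, ∑ m, spin (σs (.inl l) i) * spin (σs (.inr (.inl m)) i) *
          cavR N q i (σs (.inl l)) (σs (.inr (.inl m))) := by
    rw [Finset.sum_comm]
    refine Finset.sum_congr rfl fun l _ => Finset.sum_congr rfl fun m _ => ?_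
    rw [cavR_comm]; ring
  rw [hins]
  simp only [← Finset.mul_sum]
  rw [hsym]
  ring

end Cavity

section Disorder

lemma measurePreserving_optionElim (κ : Type) [Fintype κ] :
    MeasurePreserving (fun p : ℝ × (κ → ℝ) => fun o : Option κ => o.elim p.1 p.2)
      ((gaussianReal 0 1).prod (stdGauss κ)) (stdGauss (Option κ)) := by
  have hm : Measurable (fun p : ℝ × (κ → ℝ) => fun o : Option κ => o.elim p.1 p.2) := by
    refine measurable_pi_lambda _ fun o => ?_
    rcases o with _ | k
    · exact measurable_fst
    · exact (measurable_pi_apply k).comp measurable_snd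
  refine ⟨hm, (Measure.pi_eq fun s hs => ?_).symm⟩
  rw [Measure.map_apply hm (MeasurableSet.univ_pi hs)]
  have : (fun p : ℝ × (κ → ℝ) => fun o : Option κ => o.elim p.1 p.2) ⁻¹' Set.univ.pi s =
      s none ×ˢ Set.univ.pi (fun k => s (some k)) := by
    ext ⟨x, y⟩
    simp only [Set.mem_preimage, Set.mem_pi, Set.mem_univ, true_imp_iff, Set.mem_prod]
    exact ⟨fun h => ⟨h none, fun k => h (some k)⟩, fun h o => by
      rcases o with _ | k
      · exact h.1
      · exact h.2 k⟩
  rw [this, Measure.prod_prod, Measure.pi_pi, Fintype.prod_option]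

lemma integral_option_mul {κ : Type} [Fintype κ] {A : ℝ → ℝ} {B : (κ → ℝ) → ℝ}
    (hA : Measurable A) (hB : Measurable B) :
    ∫ ω, A (ω none) * B (fun k => ω (some k)) ∂(stdGauss (Option κ)) =
      (∫ z, A z ∂(gaussianReal 0 1)) * ∫ x, B x ∂(stdGauss κ) := by
  have mp := measurePreserving_optionElim κ
  rw [← mp.map_eq, integral_map mp.measurable.aemeasurable]
  · exact integral_prod_mul A B
  · exact (Measurable.mul (by fun_prop) (by fun_prop)).aestronglyMeasurable

lemma integral_gaussN_eq (N : ℕ) {F : (Fin N → Fin N → ℝ) → ℝ} (hF : Measurable F) :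
    ∫ g, F g ∂(gaussN N) =
      ∫ ω, F (fun a b => ω (some (a, b))) ∂(stdGauss (Option (Fin N × Fin N))) := by
  have h := integral_option_mul (κ := Fin N × Fin N) (A := fun _ => 1)
    (B := fun x => F (fun a b => x (a, b))) measurable_const (by fun_prop)
  simp only [one_mul, integral_const, probReal_univ, smul_eq_mul, mul_one] at h
  rw [h]
  have hc := Measure.infinitePi_map_curry (X := ℝ)
    (fun (_ : Fin N) (_ : Fin N) => (gaussianReal 0 1 : Measure ℝ))
  simp only [Measure.infinitePi_eq_pi] at hc
  rw [gaussN, ← hc, integral_map (MeasurableEquiv.measurable _).aemeasurable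
    hF.aestronglyMeasurable]
  rfl

end Disorder

section Functional

variable {N : ℕ} {ι ι₂ : Type} [Fintype ι] [DecidableEq ι] [Fintype ι₂] [DecidableEq ι₂]

lemma gibbs_eq_sum_boltz (β h : ℝ) (g : Fin N → Fin N → ℝ) (f : (ι → Cfg N) → ℝ) :
    gibbs N β h g f = ∑ σs, f σs * ∏ l, boltz (negH N β h g) (σs l) := by
  unfold gibbs
  rw [Finset.sum_div]
  refine Finset.sum_congr rfl fun σs _ => ?_
  simp only [boltz]
  rw [Finset.prod_div_distrib, Finset.prod_const, Finset.card_univ, mul_div_assoc]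

lemma linEnergy_cavCoef_end (β h q : ℝ) (i : Fin N) (ω : Option (Fin N × Fin N) → ℝ) :
    linEnergy (fun k σ => cavCoef N β q i k σ (Real.pi / 2)) (fun σ => h * ∑ j, spin (σ j)) ω =
      negH N β h (fun a b => ω (some (a, b))) := by
  ext σ
  simp only [linEnergy, negH, Fintype.sum_option, cavCoef, Option.elim, Real.cos_pi_div_two,
    Real.sin_pi_div_two, ite_self, mul_zero, zero_add, Fintype.sum_prod_type, Finset.mul_sum]
  congr 1
  refine Finset.sum_congr rfl fun a _ => Finset.sum_congr rfl fun b _ => ?_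
  split_ifs <;> ring

lemma nu_eq_cavNu (β h q : ℝ) (i : Fin N) (f : (ι → Cfg N) → ℝ) :
    nu N β h f = cavNu N β h q i (Real.pi / 2) f := by
  unfold nu cavNu repAvg
  rw [integral_gaussN_eq]
  · simp_rw [gibbs_eq_sum_boltz, linEnergy_cavCoef_end]
  · simp_rw [gibbs_eq_sum_boltz]
    have : ∀ σ : Cfg N, Measurable fun g : Fin N → Fin N → ℝ => negH N β h g σ := by
      intro σ
      unfold negH
      refine Measurable.add_const (Measurable.const_mul (Finset.measurable_sum _ fun a _ =>
        Finset.measurable_sum _ fun b _ => ?_) _) _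
      split_ifs
      · fun_prop
      · exact measurable_const
    unfold boltz
    fun_prop

variable (β h q : ℝ) (i : Fin N) (θ : ℝ)

/-- The weight of a replica configuration along the cavity path. -/
def cavWeight (N : ℕ) (β h q : ℝ) (i : Fin N) (θ : ℝ) (σs : ι → Cfg N) : ℝ :=
  repWeight (fun k σ => cavCoef N β q i k σ θ) (fun σ => h * ∑ j, spin (σ j)) σs

lemma cavNu_eq_sum (f : (ι → Cfg N) → ℝ) :
    cavNu N β h q i θ f = ∑ σs, f σs * cavWeight N β h q i θ σs := repAvg_eq_sum _ _ _

lemma cavNu_const (c : ℝ) : cavNu N β h q i θ (fun _ : ι → Cfg N => c) = c := by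
  rw [cavNu_eq_sum, ← Finset.mul_sum]
  exact (congrArg (c * ·) (sum_repWeight _ _)).trans (mul_one c)

variable {β h q i θ} in
lemma cavNu_mono {f g : (ι → Cfg N) → ℝ} (hfg : ∀ σs, f σs ≤ g σs) :
    cavNu N β h q i θ f ≤ cavNu N β h q i θ g := by
  rw [cavNu_eq_sum, cavNu_eq_sum]
  exact Finset.sum_le_sum fun σs _ => mul_le_mul_of_nonneg_right (hfg σs) (repWeight_nonneg _ _ _)

lemma cavNu_add (f g : (ι → Cfg N) → ℝ) :
    cavNu N β h q i θ (fun σs => f σs + g σs) = cavNu N β h q i θ f + cavNu N β h q i θ g := by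
  simp only [cavNu_eq_sum, add_mul, Finset.sum_add_distrib]

lemma cavNu_sub (f g : (ι → Cfg N) → ℝ) :
    cavNu N β h q i θ (fun σs => f σs - g σs) = cavNu N β h q i θ f - cavNu N β h q i θ g := by
  simp only [cavNu_eq_sum, sub_mul, Finset.sum_sub_distrib]

lemma cavNu_const_mul (c : ℝ) (f : (ι → Cfg N) → ℝ) :
    cavNu N β h q i θ (fun σs => c * f σs) = c * cavNu N β h q i θ f := by
  simp only [cavNu_eq_sum, mul_assoc, Finset.mul_sum]

lemma cavNu_sum {J : Type} (s : Finset J) (f : J → (ι → Cfg N) → ℝ) :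
    cavNu N β h q i θ (fun σs => ∑ j ∈ s, f j σs) = ∑ j ∈ s, cavNu N β h q i θ (f j) := by
  simp only [cavNu_eq_sum, Finset.sum_mul]
  exact Finset.sum_comm

variable {β h q i θ} in
lemma cavNu_nonneg {f : (ι → Cfg N) → ℝ} (hf : ∀ σs, 0 ≤ f σs) : 0 ≤ cavNu N β h q i θ f := by
  have := cavNu_mono (β := β) (h := h) (q := q) (i := i) (θ := θ) hf
  rwa [cavNu_const] at this

variable {β h q i θ} in
lemma abs_cavNu_le {f g : (ι → Cfg N) → ℝ} (hfg : ∀ σs, |f σs| ≤ g σs) :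
    |cavNu N β h q i θ f| ≤ cavNu N β h q i θ g := by
  rw [abs_le]
  constructor
  · have := cavNu_mono (β := β) (h := h) (q := q) (i := i) (θ := θ)
      (f := fun σs => (-1) * g σs) (g := f) fun σs => by linarith [(abs_le.1 (hfg σs)).1]
    rw [cavNu_const_mul] at this
    linarith
  · exact cavNu_mono fun σs => (le_abs_self _).trans (hfg σs)

lemma cavNu_comp_injective {e : ι → ι₂} (he : Function.Injective e) (f : (ι → Cfg N) → ℝ) :
    cavNu N β h q i θ (fun σs : ι₂ → Cfg N => f (fun l => σs (e l))) = cavNu N β h q i θ f :=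
  repAvg_comp_injective _ _ he f

variable {β h} in
lemma nu_mono {f g : (ι → Cfg (N + 1)) → ℝ} (hfg : ∀ σs, f σs ≤ g σs) :
    nu (N + 1) β h f ≤ nu (N + 1) β h g := by
  rw [nu_eq_cavNu β h 0 0, nu_eq_cavNu β h 0 0]
  exact cavNu_mono hfg

variable {β h} in
lemma abs_nu_le {f g : (ι → Cfg (N + 1)) → ℝ} (hfg : ∀ σs, |f σs| ≤ g σs) :
    |nu (N + 1) β h f| ≤ nu (N + 1) β h g := by
  rw [nu_eq_cavNu β h 0 0, nu_eq_cavNu β h 0 0]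
  exact abs_cavNu_le hfg

variable {β h} in
lemma nu_nonneg {f : (ι → Cfg (N + 1)) → ℝ} (hf : ∀ σs, 0 ≤ f σs) : 0 ≤ nu (N + 1) β h f := by
  rw [nu_eq_cavNu β h 0 0]
  exact cavNu_nonneg hf

lemma nu_const (c : ℝ) : nu (N + 1) β h (fun _ : ι → Cfg (N + 1) => c) = c := by
  rw [nu_eq_cavNu β h 0 0, cavNu_const]

lemma nu_add (f g : (ι → Cfg (N + 1)) → ℝ) :
    nu (N + 1) β h (fun σs => f σs + g σs) = nu (N + 1) β h f + nu (N + 1) β h g := by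
  simp only [nu_eq_cavNu β h 0 0, cavNu_add]

lemma nu_sub (f g : (ι → Cfg (N + 1)) → ℝ) :
    nu (N + 1) β h (fun σs => f σs - g σs) = nu (N + 1) β h f - nu (N + 1) β h g := by
  simp only [nu_eq_cavNu β h 0 0, cavNu_sub]

lemma nu_const_mul (c : ℝ) (f : (ι → Cfg (N + 1)) → ℝ) :
    nu (N + 1) β h (fun σs => c * f σs) = c * nu (N + 1) β h f := by
  simp only [nu_eq_cavNu β h 0 0, cavNu_const_mul]

lemma nu_sum {J : Type} (s : Finset J) (f : J → (ι → Cfg (N + 1)) → ℝ) :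
    nu (N + 1) β h (fun σs => ∑ j ∈ s, f j σs) = ∑ j ∈ s, nu (N + 1) β h (f j) := by
  simp only [nu_eq_cavNu β h 0 0, cavNu_sum]

lemma nu_comp_injective {e : ι → ι₂} (he : Function.Injective e) (f : (ι → Cfg (N + 1)) → ℝ) :
    nu (N + 1) β h (fun σs : ι₂ → Cfg (N + 1) => f (fun l => σs (e l))) = nu (N + 1) β h f := by
  simp only [nu_eq_cavNu β h 0 0, cavNu_comp_injective β h 0 0 _ he]

end Functional

section Comparison

variable {N : ℕ} {ι : Type} [Fintype ι] [DecidableEq ι]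

/-- The sum of the absolute centred overlaps of all pairs of distinct replicas. -/
def cavAbs (N : ℕ) (q : ℝ) (i : Fin N) (σs : ι → Cfg N) : ℝ :=
  ∑ u, ∑ v, if u = v then 0 else |cavR N q i (σs u) (σs v)|

lemma cavAbs_nonneg (q : ℝ) (i : Fin N) (σs : ι → Cfg N) : 0 ≤ cavAbs N q i σs :=
  Finset.sum_nonneg fun u _ => Finset.sum_nonneg fun v _ => by split_ifs <;> positivity

lemma abs_cavIns_le (q : ℝ) (i : Fin N) (σs : Trip ι → Cfg N) :
    |cavIns N q i σs| ≤ 2 * cavAbs N q i σs := by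
  unfold cavIns cavAbs
  rw [Finset.mul_sum]
  refine (Finset.abs_sum_le_sum_abs _ _).trans (Finset.sum_le_sum fun u _ => ?_)
  rw [Finset.mul_sum]
  refine (Finset.abs_sum_le_sum_abs _ _).trans (Finset.sum_le_sum fun v _ => ?_)
  rw [abs_mul, abs_mul, abs_mul, abs_spin, abs_spin]
  split_ifs with h
  · subst h; rw [pairCoef_self]; simp
  · simpa using mul_le_mul_of_nonneg_right (abs_pairCoef_le u v) (abs_nonneg _)

lemma cavAbs_comp_inl_le (q : ℝ) (i : Fin N) (σs : Trip ι → Cfg N) :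
    cavAbs N q i (fun l => σs (Sum.inl l)) ≤ cavAbs N q i σs := by
  unfold cavAbs
  rw [Fintype.sum_sum_type]
  refine le_add_of_le_of_nonneg (Finset.sum_le_sum fun u _ => ?_)
    (Finset.sum_nonneg fun u _ => Finset.sum_nonneg fun v _ => by split_ifs <;> positivity)
  rw [Fintype.sum_sum_type]
  refine le_add_of_le_of_nonneg (Finset.sum_le_sum fun v _ => ?_)
    (Finset.sum_nonneg fun v _ => by split_ifs <;> positivity)
  simp

lemma cavAbs_le {q : ℝ} (hq : 0 ≤ q) (hq1 : q ≤ 1) (i : Fin N) (σs : ι → Cfg N) :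
    cavAbs N q i σs ≤ 2 * (Fintype.card ι : ℝ) ^ 2 := by
  calc cavAbs N q i σs ≤ ∑ _u : ι, ∑ _v : ι, (2 : ℝ) := by
        refine Finset.sum_le_sum fun u _ => Finset.sum_le_sum fun v _ => ?_
        split_ifs
        · norm_num
        · exact abs_cavR_le hq hq1 i _ _
    _ = _ := by simp; ring

lemma abs_sin_mul_cos_le (θ : ℝ) : |Real.sin θ * Real.cos θ| ≤ 1 := by
  rw [abs_mul]
  exact mul_le_one₀ (Real.abs_sin_le_one θ) (abs_nonneg _) (Real.abs_cos_le_one θ)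

/-- The constant comparing the cavity path with its end point. -/
def cavExp (n : ℕ) : ℝ := Real.exp (72 * (n : ℝ) ^ 2)

lemma cavExp_pos (n : ℕ) : 0 < cavExp n := Real.exp_pos _

variable {β h q : ℝ} {i : Fin N}

lemma cavNu_le_nu (hβ0 : 0 ≤ β) (hβ1 : β ≤ 1) (hq : 0 ≤ q) (hq1 : q ≤ 1) {f : (ι → Cfg N) → ℝ}
    (hf : ∀ σs, 0 ≤ f σs) {θ : ℝ} (h0 : 0 ≤ θ) (h1 : θ ≤ Real.pi / 2) :
    cavNu N β h q i θ f ≤ cavExp (Fintype.card ι) * nu N β h f := by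
  set L : ℝ := 36 * (Fintype.card ι : ℝ) ^ 2 with hL
  have hL0 : 0 ≤ L := by positivity
  rw [nu_eq_cavNu β h q i]
  have hd := fun θ => (hasDerivAt_cavNu β h hq i f θ).fun_mul
    (((hasDerivAt_id θ).const_mul L).exp)
  have hmono : Monotone fun θ => cavNu N β h q i θ f * Real.exp (L * id θ) := by
    refine monotone_of_deriv_nonneg (fun θ => (hd θ).differentiableAt) fun θ => ?_
    rw [(hd θ).deriv]
    have hb : |cavNu N β h q i θ (fun σs : Trip ι → Cfg N =>
        f (fun l => σs (Sum.inl l)) * cavIns N q i σs)| ≤ L * cavNu N β h q i θ f := by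
      rw [← cavNu_comp_injective β h q i θ (Sum.inl_injective (α := ι) (β := ι ⊕ ι)) f,
        ← cavNu_const_mul]
      refine abs_cavNu_le fun σs => ?_
      rw [abs_mul, abs_of_nonneg (hf _), mul_comm]
      refine mul_le_mul_of_nonneg_right ?_ (hf _)
      have := (abs_cavIns_le q i σs).trans
        (mul_le_mul_of_nonneg_left (cavAbs_le hq hq1 i σs) zero_le_two)
      refine this.trans (le_of_eq ?_)
      simp only [Fintype.card_sum, Nat.cast_add, hL]
      ring
    set D := cavNu N β h q i θ (fun σs : Trip ι → Cfg N =>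
        f (fun l => σs (Sum.inl l)) * cavIns N q i σs)
    have hb2 : |Real.sin θ * Real.cos θ * (β ^ 2 * D)| ≤ L * cavNu N β h q i θ f := by
      rw [abs_mul (Real.sin θ * Real.cos θ), abs_mul (β ^ 2), abs_of_nonneg (sq_nonneg β)]
      have := abs_sin_mul_cos_le θ
      have hβ2 : β ^ 2 ≤ 1 := by nlinarith
      calc _ ≤ 1 * (1 * |D|) := mul_le_mul this (mul_le_mul_of_nonneg_right hβ2 (abs_nonneg _))
            (by positivity) zero_le_one
        _ ≤ _ := by simpa using hb
    have := (abs_le.1 hb2).1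
    have he := Real.exp_pos (L * id θ)
    have e : Real.sin θ * Real.cos θ * (β ^ 2 * D) * Real.exp (L * id θ) +
        cavNu N β h q i θ f * (Real.exp (L * id θ) * (L * 1)) =
        (Real.sin θ * Real.cos θ * (β ^ 2 * D) + L * cavNu N β h q i θ f) *
          Real.exp (L * id θ) := by ring
    rw [e]
    exact mul_nonneg (by linarith) he.le
  have hm := hmono h1
  simp only [id] at hm
  have hf1 : 0 ≤ cavNu N β h q i θ f := cavNu_nonneg hf
  have hf2 : 0 ≤ cavNu N β h q i (Real.pi / 2) f := cavNu_nonneg hf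
  calc cavNu N β h q i θ f ≤ cavNu N β h q i θ f * Real.exp (L * θ) :=
        le_mul_of_one_le_right hf1 (Real.one_le_exp (by positivity))
    _ ≤ cavNu N β h q i (Real.pi / 2) f * Real.exp (L * (Real.pi / 2)) := hm
    _ ≤ cavNu N β h q i (Real.pi / 2) f * cavExp (Fintype.card ι) := by
        refine mul_le_mul_of_nonneg_left (Real.exp_le_exp.2 ?_) hf2
        nlinarith [Real.pi_le_four]
    _ = _ := mul_comm _ _

lemma abs_sub_le_of_deriv {F F' : ℝ → ℝ} {D : ℝ} (hF : ∀ θ, HasDerivAt F (F' θ) θ)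
    (hD : ∀ θ, 0 ≤ θ → θ ≤ Real.pi / 2 → |F' θ| ≤ D) {θ : ℝ} (h0 : 0 ≤ θ)
    (h1 : θ ≤ Real.pi / 2) : |F θ - F 0| ≤ 2 * D := by
  have hD0 : 0 ≤ D := (abs_nonneg _).trans (hD θ h0 h1)
  have := (convex_Icc (0 : ℝ) (Real.pi / 2)).norm_image_sub_le_of_norm_hasDerivWithin_le
    (f := F) (f' := F') (C := D) (fun x _ => (hF x).hasDerivWithinAt)
    (fun x hx => hD x hx.1 hx.2) ⟨le_rfl, by positivity⟩ ⟨h0, h1⟩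
  rw [Real.norm_eq_abs, Real.norm_eq_abs, sub_zero, abs_of_nonneg h0] at this
  nlinarith [Real.pi_le_four]

lemma abs_cavNu_sub_zero_le (hβ0 : 0 ≤ β) (hβ1 : β ≤ 1) (hq : 0 ≤ q) (hq1 : q ≤ 1)
    (f : (ι → Cfg N) → ℝ) {θ : ℝ} (h0 : 0 ≤ θ) (h1 : θ ≤ Real.pi / 2) :
    |cavNu N β h q i θ f - cavNu N β h q i 0 f| ≤
      4 * cavExp (Fintype.card (Trip ι)) * β ^ 2 *
        nu N β h (fun σs : Trip ι → Cfg N => |f (fun l => σs (Sum.inl l))| * cavAbs N q i σs) := by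
  have := abs_sub_le_of_deriv (hasDerivAt_cavNu β h hq i f)
    (D := 2 * cavExp (Fintype.card (Trip ι)) * β ^ 2 *
        nu N β h (fun σs : Trip ι → Cfg N => |f (fun l => σs (Sum.inl l))| * cavAbs N q i σs))
    (fun θ h0 h1 => ?_) h0 h1
  · refine this.trans (le_of_eq (by ring))
  rw [abs_mul (Real.sin θ * Real.cos θ), abs_mul (β ^ 2), abs_of_nonneg (sq_nonneg β)]
  have hb := cavNu_le_nu (h := h) (i := i) hβ0 hβ1 hq hq1
    (f := fun σs : Trip ι → Cfg N => |f (fun l => σs (Sum.inl l))| * cavAbs N q i σs)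
    (fun σs => mul_nonneg (abs_nonneg _) (cavAbs_nonneg q i σs)) h0 h1
  have hb2 : |cavNu N β h q i θ (fun σs : Trip ι → Cfg N =>
      f (fun l => σs (Sum.inl l)) * cavIns N q i σs)| ≤ 2 * cavNu N β h q i θ
      (fun σs : Trip ι → Cfg N => |f (fun l => σs (Sum.inl l))| * cavAbs N q i σs) := by
    rw [← cavNu_const_mul]
    refine abs_cavNu_le fun σs => ?_
    rw [abs_mul]
    calc _ ≤ |f (fun l => σs (Sum.inl l))| * (2 * cavAbs N q i σs) :=
          mul_le_mul_of_nonneg_left (abs_cavIns_le q i σs) (abs_nonneg _)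
      _ = _ := by ring
  calc _ ≤ 1 * (β ^ 2 * (2 * (cavExp (Fintype.card (Trip ι)) * _))) :=
        mul_le_mul (abs_sin_mul_cos_le θ) (mul_le_mul_of_nonneg_left
          (hb2.trans (mul_le_mul_of_nonneg_left hb zero_le_two)) (sq_nonneg β))
          (by positivity) zero_le_one
    _ = _ := by ring

/-- First order cavity expansion. -/
theorem abs_nu_sub_cavNu_zero_le (hβ0 : 0 ≤ β) (hβ1 : β ≤ 1) (hq : 0 ≤ q) (hq1 : q ≤ 1)
    (i : Fin N) (f : (ι → Cfg N) → ℝ) :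
    |nu N β h f - cavNu N β h q i 0 f| ≤
      4 * cavExp (Fintype.card (Trip ι)) * β ^ 2 *
        nu N β h (fun σs : Trip ι → Cfg N => |f (fun l => σs (Sum.inl l))| * cavAbs N q i σs) := by
  rw [nu_eq_cavNu β h q i f]
  exact abs_cavNu_sub_zero_le hβ0 hβ1 hq hq1 f (by positivity) le_rfl

/-- Second order cavity expansion. -/
theorem abs_nu_sub_cavNu_zero_sub_le (hβ0 : 0 ≤ β) (hβ1 : β ≤ 1) (hq : 0 ≤ q) (hq1 : q ≤ 1)
    (i : Fin N) (f : (ι → Cfg N) → ℝ) :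
    |nu N β h f - cavNu N β h q i 0 f - β ^ 2 / 2 * cavNu N β h q i 0
        (fun σs : Trip ι → Cfg N => f (fun l => σs (Sum.inl l)) * cavIns N q i σs)| ≤
      16 * cavExp (Fintype.card (Trip (Trip ι))) *
        nu N β h (fun σs : Trip (Trip ι) → Cfg N =>
          |f (fun l => σs (Sum.inl (Sum.inl l)))| * cavAbs N q i σs ^ 2) := by
  rw [nu_eq_cavNu β h q i f]
  set ψ : ℝ → ℝ := fun θ => β ^ 2 * cavNu N β h q i θ
        (fun σs : Trip ι → Cfg N => f (fun l => σs (Sum.inl l)) * cavIns N q i σs) with hψ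
  set R := nu N β h (fun σs : Trip (Trip ι) → Cfg N =>
          |f (fun l => σs (Sum.inl (Sum.inl l)))| * cavAbs N q i σs ^ 2) with hR
  have hR0 : 0 ≤ R := by
    rw [hR, nu_eq_cavNu β h q i]
    exact cavNu_nonneg fun σs => by positivity
  have hβ2 : β ^ 2 ≤ 1 := by nlinarith
  have hK := cavExp_pos (Fintype.card (Trip (Trip ι)))
  have h1 : ∀ θ, 0 ≤ θ → θ ≤ Real.pi / 2 →
      |ψ θ - ψ 0| ≤ 8 * cavExp (Fintype.card (Trip (Trip ι))) * R := by
    intro θ h0 h1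
    have h2 := abs_cavNu_sub_zero_le (h := h) (i := i) hβ0 hβ1 hq hq1
      (fun σs : Trip ι → Cfg N => f (fun l => σs (Sum.inl l)) * cavIns N q i σs) h0 h1
    have h3 : nu N β h (fun σs : Trip (Trip ι) → Cfg N =>
        |f (fun l => σs (Sum.inl (Sum.inl l))) * cavIns N q i (fun l => σs (Sum.inl l))| *
          cavAbs N q i σs) ≤ 2 * R := by
      rw [hR, nu_eq_cavNu β h q i, nu_eq_cavNu β h q i, ← cavNu_const_mul]
      refine cavNu_mono fun σs => ?_
      have e1 := abs_cavIns_le q i (fun l => σs (Sum.inl l))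
      have e2 := cavAbs_comp_inl_le q i σs
      have e3 := cavAbs_nonneg q i σs
      rw [abs_mul]
      calc _ ≤ |f (fun l => σs (Sum.inl (Sum.inl l)))| * (2 * cavAbs N q i σs) *
            cavAbs N q i σs := by
            refine mul_le_mul_of_nonneg_right (mul_le_mul_of_nonneg_left ?_ (abs_nonneg _)) e3
            linarith
        _ = _ := by ring
    simp only [hψ]
    rw [← mul_sub, abs_mul, abs_of_nonneg (sq_nonneg β)]
    calc _ ≤ 1 * (4 * cavExp (Fintype.card (Trip (Trip ι))) * 1 * (2 * R)) := by
          refine mul_le_mul hβ2 (h2.trans ?_) (abs_nonneg _) zero_le_one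
          refine mul_le_mul ?_ h3 ?_ (by positivity)
          · exact mul_le_mul_of_nonneg_left hβ2 (by positivity)
          · rw [nu_eq_cavNu β h q i]
            exact cavNu_nonneg fun σs => mul_nonneg (abs_nonneg _) (cavAbs_nonneg q i σs)
      _ = _ := by ring
  have h2 := abs_sub_le_of_deriv
    (F := fun θ => cavNu N β h q i θ f - Real.sin θ ^ 2 / 2 * ψ 0)
    (F' := fun θ => Real.sin θ * Real.cos θ * (ψ θ - ψ 0))
    (D := 8 * cavExp (Fintype.card (Trip (Trip ι))) * R)
    (fun θ => ((hasDerivAt_cavNu β h hq i f θ).fun_sub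
      ((((Real.hasDerivAt_sin θ).fun_pow 2).div_const 2).mul_const (ψ 0))).congr_deriv ?_)
    (fun θ h0 hp => ?_) (θ := Real.pi / 2) (by positivity) le_rfl
  · simp only [Real.sin_pi_div_two, Real.sin_zero] at h2
    refine le_trans (le_of_eq ?_) (h2.trans (le_of_eq (by ring)))
    congr 1
    simp only [hψ]; ring
  · simp only [hψ]; push_cast; ring
  · rw [abs_mul]
    calc _ ≤ 1 * |ψ θ - ψ 0| := mul_le_mul_of_nonneg_right (abs_sin_mul_cos_le θ) (abs_nonneg _)
      _ ≤ _ := by rw [one_mul]; exact h1 θ h0 hp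

end Comparison

section OneSite

/-- The mean of a single spin in the field `u`. -/
def spinMean (u : ℝ) : ℝ := ∑ b : Bool, spin b * boltz (fun b => u * spin b) b

/-- The moments of the mean of a single spin in a Gaussian field. -/
def siteMoment (β h q : ℝ) (k : ℕ) : ℝ := ∫ z, spinMean (h + β * √q * z) ^ k ∂(gaussianReal 0 1)

lemma continuous_spinMean : Continuous spinMean := by
  unfold spinMean boltz
  refine continuous_finsetSum _ fun b _ => Continuous.mul continuous_const ?_
  refine Continuous.div (by fun_prop) (by fun_prop) fun u => ?_
  exact (sum_exp_pos (fun b => u * spin b)).ne'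

lemma abs_spinMean_le (u : ℝ) : |spinMean u| ≤ 1 := by
  unfold spinMean
  simp_rw [mul_comm (spin _)]
  exact abs_sum_boltz_le _ _ fun b => (abs_spin b).le

lemma abs_siteMoment_le (β h q : ℝ) (k : ℕ) : |siteMoment β h q k| ≤ 1 := by
  have := norm_integral_le_of_norm_le_const (μ := (gaussianReal 0 1 : Measure ℝ))
    (f := fun z => spinMean (h + β * √q * z) ^ k) (C := 1)
    (Filter.Eventually.of_forall fun z => by
      rw [Real.norm_eq_abs, abs_pow]; exact pow_le_one₀ (abs_nonneg _) (abs_spinMean_le _))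
  simpa [siteMoment] using this

lemma exists_siteMoment_two_eq (β h : ℝ) : ∃ q, 0 ≤ q ∧ q ≤ 1 ∧ siteMoment β h q 2 = q := by
  have hc : Continuous fun q => siteMoment β h q 2 := by
    refine continuous_of_dominated (bound := fun _ => 1) (fun q => ?_) (fun q => ?_)
      (integrable_const _) (Filter.Eventually.of_forall fun z => ?_)
    · exact ((continuous_spinMean.comp (by fun_prop)).pow 2).aestronglyMeasurable
    · exact Filter.Eventually.of_forall fun z => by
        rw [Real.norm_eq_abs, abs_pow]; exact pow_le_one₀ (abs_nonneg _) (abs_spinMean_le _)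
    · exact (continuous_spinMean.comp (by fun_prop)).pow 2
  have hz : (0 : ℝ) ∈ Set.Icc (siteMoment β h 1 2 - 1) (siteMoment β h 0 2 - 0) := by
    constructor
    · linarith [(abs_le.1 (abs_siteMoment_le β h 1 2)).2]
    · rw [sub_zero]
      exact integral_nonneg fun z => sq_nonneg _
  obtain ⟨q, ⟨h0, h1⟩, hq⟩ := intermediate_value_Icc' (zero_le_one' ℝ)
    (f := fun q => siteMoment β h q 2 - q) (by fun_prop) hz
  exact ⟨q, h0, h1, sub_eq_zero.1 hq⟩

end OneSite

section Factorization

variable {N : ℕ}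

lemma sum_split {X : Type} [AddCommMonoid X] (i : Fin N) (F : Cfg N → X) :
    ∑ σ, F σ = ∑ b : Bool, ∑ ρ : {j // j ≠ i} → Bool,
      F ((Equiv.funSplitAt i Bool).symm (b, ρ)) := by
  rw [Fintype.sum_equiv (Equiv.funSplitAt i Bool) F
    (fun p => F ((Equiv.funSplitAt i Bool).symm p)) fun σ => by rw [Equiv.symm_apply_apply],
    Fintype.sum_prod_type]

lemma split_self (i : Fin N) (b : Bool) (ρ : {j // j ≠ i} → Bool) :
    (Equiv.funSplitAt i Bool).symm (b, ρ) i = b := by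
  simp [Equiv.funSplitAt, Equiv.piSplitAt]

lemma split_of_ne (i : Fin N) (b : Bool) (ρ : {j // j ≠ i} → Bool) {j : Fin N} (hj : j ≠ i) :
    (Equiv.funSplitAt i Bool).symm (b, ρ) j = ρ ⟨j, hj⟩ := by
  simp [Equiv.funSplitAt, Equiv.piSplitAt, hj]

lemma boltz_split (i : Fin N) (u : ℝ) (E V : Cfg N → ℝ) (hE : ∀ σ, E σ = u * spin (σ i) + V σ)
    (hV : ∀ b b' ρ, V ((Equiv.funSplitAt i Bool).symm (b, ρ)) =
      V ((Equiv.funSplitAt i Bool).symm (b', ρ))) (b : Bool) (ρ : {j // j ≠ i} → Bool) :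
    boltz E ((Equiv.funSplitAt i Bool).symm (b, ρ)) = boltz (fun b => u * spin b) b *
      boltz (fun ρ => V ((Equiv.funSplitAt i Bool).symm (true, ρ))) ρ := by
  unfold boltz
  rw [sum_split i]
  simp_rw [hE, split_self, fun b ρ => hV b true ρ, Real.exp_add]
  rw [div_mul_div_comm, Finset.sum_mul_sum]

variable {ι : Type} [Fintype ι] [DecidableEq ι]

lemma sum_split_replicas {X : Type} [AddCommMonoid X] (i : Fin N) (F : (ι → Cfg N) → X) :
    ∑ σs, F σs = ∑ bs : ι → Bool, ∑ ρs : ι → {j // j ≠ i} → Bool,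
      F (fun l => (Equiv.funSplitAt i Bool).symm (bs l, ρs l)) := by
  rw [Fintype.sum_equiv (((Equiv.refl ι).arrowCongr (Equiv.funSplitAt i Bool)).trans
    (Equiv.arrowProdEquivProdArrow ι (fun _ => Bool) (fun _ => {j // j ≠ i} → Bool))) F
    (fun p => F (fun l => (Equiv.funSplitAt i Bool).symm (p.1 l, p.2 l))) fun σs => ?_,
    Fintype.sum_prod_type]
  congr 1; ext l : 1
  exact ((Equiv.funSplitAt i Bool).symm_apply_apply (σs l)).symm

/-- The disorder average of a function of decoupled spins at the cavity site. -/
def siteAvg (β h q : ℝ) (e : (ι → Bool) → ℝ) : ℝ :=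
  ∫ z, ∑ bs, e bs * ∏ l, boltz (fun b => (h + β * √q * z) * spin b) (bs l) ∂(gaussianReal 0 1)

/-- A function of replicas that does not depend on the spins at site `i`. -/
def SiteFree (i : Fin N) (F : (ι → Cfg N) → ℝ) : Prop :=
  ∀ σs τs : ι → Cfg N, (∀ l j, j ≠ i → σs l j = τs l j) → F σs = F τs

lemma measurable_boltz_site (β h q : ℝ) (b : Bool) :
    Measurable fun z : ℝ => boltz (fun b => (h + β * √q * z) * spin b) b := by
  unfold boltz; fun_prop

theorem cavNu_zero_eq (β h q : ℝ) (i : Fin N) : ∃ G : ((ι → Cfg N) → ℝ) → ℝ,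
    ∀ (e : (ι → Bool) → ℝ) (F : (ι → Cfg N) → ℝ), SiteFree i F →
      cavNu N β h q i 0 (fun σs => e (fun l => σs l i) * F σs) = siteAvg β h q e * G F := by
  set V : (Fin N × Fin N → ℝ) → Cfg N → ℝ := fun x σ =>
    ∑ p, x p * (if p.1 < p.2 then (if p.1 = i ∨ p.2 = i then 0 else
      β / √N * (spin (σ p.1) * spin (σ p.2))) else 0) +
      h * ∑ j ∈ univ.erase i, spin (σ j) with hVdef
  have hV : ∀ x b b' ρ, V x ((Equiv.funSplitAt i Bool).symm (b, ρ)) =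
      V x ((Equiv.funSplitAt i Bool).symm (b', ρ)) := by
    intro x b b' ρ
    simp only [hVdef]
    congr 1
    · refine Finset.sum_congr rfl fun p _ => ?_
      split_ifs with h1 h2
      · rfl
      · push Not at h2
        rw [split_of_ne i b ρ h2.1, split_of_ne i b ρ h2.2, split_of_ne i b' ρ h2.1,
          split_of_ne i b' ρ h2.2]
      · rfl
    · congr 1
      refine Finset.sum_congr rfl fun j hj => ?_
      rw [split_of_ne i b ρ (Finset.ne_of_mem_erase hj),
        split_of_ne i b' ρ (Finset.ne_of_mem_erase hj)]
  have hE : ∀ (ω : Option (Fin N × Fin N) → ℝ) (σ : Cfg N),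
      linEnergy (fun k σ => cavCoef N β q i k σ 0) (fun σ => h * ∑ j, spin (σ j)) ω σ =
        (h + β * √q * ω none) * spin (σ i) + V (fun p => ω (some p)) σ := by
    intro ω σ
    have h1 : ∀ p : Fin N × Fin N, ω (some p) * cavCoef N β q i (some p) σ 0 =
        ω (some p) * (if p.1 < p.2 then (if p.1 = i ∨ p.2 = i then 0 else
          β / √N * (spin (σ p.1) * spin (σ p.2))) else 0) := by
      intro p
      simp only [cavCoef, Option.elim, Real.sin_zero]
      split_ifs <;> simp
    simp only [linEnergy, Fintype.sum_option, h1, hVdef]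
    rw [← Finset.add_sum_erase univ (fun j => spin (σ j)) (Finset.mem_univ i)]
    simp only [cavCoef, Option.elim, Real.cos_zero]
    ring
  have hVm : ∀ σ, Measurable fun x => V x σ := by
    intro σ; simp only [hVdef]; fun_prop
  refine ⟨fun F => ∫ x, ∑ ρs : ι → {j // j ≠ i} → Bool,
    F (fun l => (Equiv.funSplitAt i Bool).symm (true, ρs l)) *
      ∏ l, boltz (fun ρ => V x ((Equiv.funSplitAt i Bool).symm (true, ρ))) (ρs l)
      ∂(stdGauss (Fin N × Fin N)), fun e F hF => ?_⟩
  unfold siteAvg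
  rw [← integral_option_mul]
  · unfold cavNu repAvg
    congr 1; ext ω
    rw [sum_split_replicas i, Finset.sum_mul_sum]
    refine Finset.sum_congr rfl fun bs _ => Finset.sum_congr rfl fun ρs _ => ?_
    simp_rw [boltz_split i _ _ (V (fun p => ω (some p))) (hE ω) (hV _), split_self]
    rw [Finset.prod_mul_distrib, hF _ (fun l => (Equiv.funSplitAt i Bool).symm (true, ρs l))
      fun l j hj => by rw [split_of_ne _ _ _ hj, split_of_ne _ _ _ hj]]
    ring
  · have := measurable_boltz_site β h q
    fun_prop
  · unfold boltz; fun_prop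

lemma siteAvg_const (β h q : ℝ) (c : ℝ) : siteAvg β h q (fun _ : ι → Bool => c) = c := by
  unfold siteAvg
  simp [← Finset.mul_sum, sum_prod_boltz]

lemma cavNu_zero_site (β h q : ℝ) (i : Fin N) (e : (ι → Bool) → ℝ) :
    cavNu N β h q i 0 (fun σs => e (fun l => σs l i)) = siteAvg β h q e := by
  obtain ⟨G, hG⟩ := cavNu_zero_eq (ι := ι) β h q i
  have h1 := hG (fun _ => 1) (fun _ => 1) fun _ _ _ => rfl
  have h2 := hG e (fun _ => 1) fun _ _ _ => rfl
  simp only [one_mul, mul_one, cavNu_const, siteAvg_const] at h1 h2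
  rw [h2, ← h1, mul_one]

/-- At the start of the cavity path the spins at site `i` decouple from the others. -/
theorem cavNu_zero_mul (β h q : ℝ) (i : Fin N) (e : (ι → Bool) → ℝ) {F : (ι → Cfg N) → ℝ}
    (hF : SiteFree i F) :
    cavNu N β h q i 0 (fun σs => e (fun l => σs l i) * F σs) =
      siteAvg β h q e * cavNu N β h q i 0 F := by
  obtain ⟨G, hG⟩ := cavNu_zero_eq (ι := ι) β h q i
  have h1 := hG (fun _ => 1) F hF
  simp only [one_mul, siteAvg_const] at h1
  rw [hG e F hF, h1]

lemma siteAvg_prod (β h q : ℝ) (s : Finset ι) :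
    siteAvg β h q (fun bs : ι → Bool => ∏ l ∈ s, spin (bs l)) = siteMoment β h q #s := by
  unfold siteAvg siteMoment
  congr 1; ext z
  have := Finset.prod_univ_sum (fun _ : ι => (univ : Finset Bool)) (fun l b =>
    (if l ∈ s then spin b else 1) * boltz (fun b => (h + β * √q * z) * spin b) b)
  rw [Fintype.piFinset_univ] at this
  calc _ = ∑ bs : ι → Bool, ∏ l, ((if l ∈ s then spin (bs l) else 1) *
        boltz (fun b => (h + β * √q * z) * spin b) (bs l)) := by
        refine Finset.sum_congr rfl fun bs _ => ?_
        rw [Finset.prod_mul_distrib, Finset.prod_ite_mem, Finset.univ_inter]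
    _ = ∏ l : ι, (if l ∈ s then spinMean (h + β * √q * z) else 1) := by
        rw [← this]
        refine Finset.prod_congr rfl fun l _ => ?_
        split_ifs
        · rfl
        · simp only [one_mul]; exact sum_boltz _
    _ = _ := by rw [Finset.prod_ite_mem, Finset.univ_inter, Finset.prod_const]

end Factorization

/-- The bound on the inverse temperature. -/
def betaZero : ℝ := (1152 * cavExp 6)⁻¹

lemma one_le_cavExp (n : ℕ) : 1 ≤ cavExp n := Real.one_le_exp (by positivity)

lemma betaZero_pos : 0 < betaZero := inv_pos.2 (mul_pos (by norm_num) (cavExp_pos 6))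

/-- The standing assumptions: high temperature, and `q` solves the fixed point equation. -/
structure HighTemp (β h q : ℝ) : Prop where
  pos : 0 < β
  lt : β < betaZero
  q_nonneg : 0 ≤ q
  q_le : q ≤ 1
  fixed : siteMoment β h q 2 = q

namespace HighTemp

variable {β h q : ℝ}

lemma mul_cavExp_lt (H : HighTemp β h q) : β * (1152 * cavExp 6) < 1 := by
  have h := H.lt
  rwa [betaZero, lt_inv_comm₀ H.pos (by have := cavExp_pos 6; positivity),
    ← one_div, lt_div_iff₀ H.pos, mul_comm] at h

lemma small (H : HighTemp β h q) : β < 1 / 1152 := by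
  have h1 := H.mul_cavExp_lt
  have h2 := one_le_cavExp 6
  have h3 := H.pos
  nlinarith

lemma le_one (H : HighTemp β h q) : β ≤ 1 := by linarith [H.small]

end HighTemp

lemma abs_pow_succ_sub_le (m : ℕ) {a b δ : ℝ} (h : |a - b| ≤ δ) :
    |a ^ (m + 1) - b ^ (m + 1)| ≤ (m + 1) * 2 ^ m * δ * (|a| ^ m + δ ^ m) := by
  have hδ : 0 ≤ δ := (abs_nonneg _).trans h
  have h1 := abs_pow_sub_pow_le a b (m + 1)
  have hmax : max |a| |b| ≤ |a| + δ := by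
    refine max_le (by linarith) ?_
    have := abs_sub_abs_le_abs_sub b a
    rw [abs_sub_comm] at this
    linarith
  have h2 : (max |a| |b|) ^ m ≤ 2 ^ m * (|a| ^ m + δ ^ m) := by
    have hx : (max |a| |b|) ≤ 2 * max |a| δ := hmax.trans (by
      linarith [le_max_left |a| δ, le_max_right |a| δ])
    refine (pow_le_pow_left₀ (by positivity) hx m).trans ?_
    rw [mul_pow]
    refine mul_le_mul_of_nonneg_left ?_ (by positivity)
    rcases le_total |a| δ with h | h
    · rw [max_eq_right h]; linarith [pow_nonneg (abs_nonneg a) m]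
    · rw [max_eq_left h]; linarith [pow_nonneg hδ m]
  simp only [Nat.add_sub_cancel] at h1
  push_cast at h1
  calc _ ≤ |a - b| * (m + 1) * max |a| |b| ^ m := h1
    _ ≤ δ * (m + 1) * (2 ^ m * (|a| ^ m + δ ^ m)) := by gcongr
    _ = _ := by ring

section OverlapMoments

variable {N : ℕ}

lemma overlap_eq (q : ℝ) (i : Fin N) (σ τ : Cfg N) :
    overlap N σ τ - q = cavR N q i σ τ + spin (σ i) * spin (τ i) / N := by
  unfold overlap cavR
  rw [← Finset.add_sum_erase _ _ (Finset.mem_univ i), add_div]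
  ring

lemma abs_overlap_sub_cavR_le (q : ℝ) (i : Fin N) (σ τ : Cfg N) :
    |overlap N σ τ - q - cavR N q i σ τ| ≤ (N : ℝ)⁻¹ := by
  rw [overlap_eq q i]
  simp [abs_div, abs_spin]

lemma abs_overlap_sub_le [NeZero N] {q : ℝ} (hq : 0 ≤ q) (hq1 : q ≤ 1) (σ τ : Cfg N) :
    |overlap N σ τ - q| ≤ 3 := by
  have h1 := abs_overlap_sub_cavR_le q 0 σ τ
  have h2 := abs_cavR_le hq hq1 (0 : Fin N) σ τ
  have h3 : (N : ℝ)⁻¹ ≤ 1 := Nat.cast_inv_le_one N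
  have := abs_sub_abs_le_abs_sub (overlap N σ τ - q) (cavR N q 0 σ τ)
  linarith

lemma siteFree_comp_cavR {ι : Type} (q : ℝ) (i : Fin N) (u v : ι) (φ : ℝ → ℝ) :
    SiteFree i (fun σs : ι → Cfg N => φ (cavR N q i (σs u) (σs v))) := by
  intro σs τs h
  have : cavR N q i (σs u) (σs v) = cavR N q i (τs u) (τs v) := by
    unfold cavR
    congr 2
    exact Finset.sum_congr rfl fun j hj => by
      rw [h u j (Finset.ne_of_mem_erase hj), h v j (Finset.ne_of_mem_erase hj)]
  simp only [this]

lemma pow_succ_mul_le (m : ℕ) {a b : ℝ} (ha : 0 ≤ a) (hb : 0 ≤ b) :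
    a ^ m * b ≤ a ^ (m + 1) + b ^ (m + 1) := by
  rcases le_total a b with h | h
  · have := mul_le_mul_of_nonneg_right (pow_le_pow_left₀ ha h m) hb
    rw [← pow_succ] at this
    linarith [pow_nonneg ha (m + 1)]
  · have := mul_le_mul_of_nonneg_left h (pow_nonneg ha m)
    rw [← pow_succ] at this
    linarith [pow_nonneg hb (m + 1)]

variable {M : ℕ} {β h q : ℝ}

lemma nu_pair {ι : Type} [Fintype ι] [DecidableEq ι] (F : Cfg (M + 1) → Cfg (M + 1) → ℝ) {u v : ι}
    (huv : u ≠ v) : nu (M + 1) β h (fun σs : ι → Cfg (M + 1) => F (σs u) (σs v)) =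
      nu (M + 1) β h (fun σs : Fin 2 → Cfg (M + 1) => F (σs 0) (σs 1)) := by
  have := nu_comp_injective β h (e := ![u, v]) (fun a b hab => by
    fin_cases a <;> fin_cases b <;> simp_all [huv.symm])
    (fun σs : Fin 2 → Cfg (M + 1) => F (σs 0) (σs 1))
  simpa using this

/-- One step of the cavity estimate for overlap moments. -/
lemma abs_nu_site_overlap_le (H : HighTemp β h q) (i : Fin (M + 1)) (m : ℕ) :
    |nu (M + 1) β h (fun σs : Fin 2 → Cfg (M + 1) =>
      (spin (σs 0 i) * spin (σs 1 i) - q) * cavR (M + 1) q i (σs 0) (σs 1) ^ m)| ≤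
    576 * cavExp 6 * β ^ 2 * nu (M + 1) β h (fun σs : Fin 2 → Cfg (M + 1) =>
      |cavR (M + 1) q i (σs 0) (σs 1)| ^ (m + 1)) := by
  have h1 := abs_nu_sub_cavNu_zero_le (h := h) H.pos.le H.le_one H.q_nonneg H.q_le i
    (fun σs : Fin 2 → Cfg (M + 1) =>
      (spin (σs 0 i) * spin (σs 1 i) - q) * cavR (M + 1) q i (σs 0) (σs 1) ^ m)
  have h2 := cavNu_zero_mul β h q i (fun bs : Fin 2 → Bool => spin (bs 0) * spin (bs 1) - q)
    (siteFree_comp_cavR q i (0 : Fin 2) 1 (fun x => x ^ m))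
  have h3 : siteAvg β h q (fun bs : Fin 2 → Bool => spin (bs 0) * spin (bs 1) - q) = 0 := by
    rw [← cavNu_zero_site (N := M + 1) β h q i]
    have e := cavNu_zero_site (N := M + 1) β h q i
      (fun bs : Fin 2 → Bool => ∏ l ∈ univ, spin (bs l))
    rw [siteAvg_prod] at e
    simp only [Fin.prod_univ_two, Finset.card_univ, Fintype.card_fin, H.fixed] at e
    rw [cavNu_sub, e, cavNu_const, sub_self]
  rw [h3, zero_mul] at h2
  rw [h2, sub_zero] at h1
  refine h1.trans ?_
  set X := nu (M + 1) β h (fun σs : Fin 2 → Cfg (M + 1) =>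
      |cavR (M + 1) q i (σs 0) (σs 1)| ^ (m + 1)) with hX
  have hcard : Fintype.card (Trip (Fin 2)) = 6 := rfl
  have h4 : nu (M + 1) β h (fun σs : Trip (Fin 2) → Cfg (M + 1) =>
      |(spin (σs (.inl 0) i) * spin (σs (.inl 1) i) - q) *
        cavR (M + 1) q i (σs (.inl 0)) (σs (.inl 1)) ^ m| * cavAbs (M + 1) q i σs) ≤ 144 * X := by
    have h5 : nu (M + 1) β h (fun σs : Trip (Fin 2) → Cfg (M + 1) =>
        2 * ∑ u, ∑ v, if u = v then 0 else
          (|cavR (M + 1) q i (σs (.inl 0)) (σs (.inl 1))| ^ (m + 1) +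
            |cavR (M + 1) q i (σs u) (σs v)| ^ (m + 1))) ≤ 144 * X := by
      rw [nu_const_mul]
      simp only [nu_sum]
      have : ∀ u v : Trip (Fin 2), nu (M + 1) β h (fun σs : Trip (Fin 2) → Cfg (M + 1) =>
          if u = v then 0 else (|cavR (M + 1) q i (σs (.inl 0)) (σs (.inl 1))| ^ (m + 1) +
            |cavR (M + 1) q i (σs u) (σs v)| ^ (m + 1))) ≤ 2 * X := by
        intro u v
        split_ifs with huv
        · rw [nu_const]
          exact mul_nonneg zero_le_two (nu_nonneg fun σs => by positivity)
        · rw [nu_add, nu_pair (fun σ τ => |cavR (M + 1) q i σ τ| ^ (m + 1)) huv,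
            nu_pair (fun σ τ => |cavR (M + 1) q i σ τ| ^ (m + 1))
              (u := (Sum.inl 0 : Trip (Fin 2))) (v := .inl 1) (by simp)]
          linarith
      calc _ ≤ 2 * ∑ _u : Trip (Fin 2), ∑ _v : Trip (Fin 2), 2 * X := by
            gcongr with u _ v _
            exact this u v
        _ = _ := by
            simp only [Finset.sum_const, Finset.card_univ, hcard, nsmul_eq_mul]
            ring
    refine (nu_mono fun σs => ?_).trans h5
    rw [abs_mul, abs_pow]
    set c := |cavR (M + 1) q i (σs (.inl 0)) (σs (.inl 1))|
    have hs : |spin (σs (.inl 0) i) * spin (σs (.inl 1) i) - q| ≤ 2 := by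
      refine (abs_sub _ _).trans ?_
      rw [abs_mul, abs_spin, abs_spin, abs_of_nonneg H.q_nonneg]
      linarith [H.q_le]
    calc _ ≤ 2 * c ^ m * cavAbs (M + 1) q i σs :=
          mul_le_mul_of_nonneg_right (mul_le_mul_of_nonneg_right hs (by positivity))
            (cavAbs_nonneg q i σs)
      _ = 2 * ∑ u, ∑ v, if u = v then 0 else c ^ m * |cavR (M + 1) q i (σs u) (σs v)| := by
          simp only [cavAbs, mul_assoc, Finset.mul_sum, mul_ite, mul_zero]
      _ ≤ _ := by
          gcongr with u _ v _
          split_ifs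
          · rfl
          · exact pow_succ_mul_le m (abs_nonneg _) (abs_nonneg _)
  rw [hcard]
  calc _ ≤ 4 * cavExp 6 * β ^ 2 * (144 * X) :=
        mul_le_mul_of_nonneg_left h4 (by have := cavExp_pos 6; positivity)
    _ = _ := by ring

/-- Moments of the centred overlap. -/
theorem exists_overlap_moment (k : ℕ) : ∃ K : ℝ, 0 ≤ K ∧ ∀ β h q, HighTemp β h q → ∀ M : ℕ,
    nu (M + 1) β h (fun σs : Fin 2 → Cfg (M + 1) =>
      (overlap (M + 1) (σs 0) (σs 1) - q) ^ (2 * k)) ≤ K * ((M + 1 : ℕ) : ℝ)⁻¹ ^ k := by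
  induction k with
  | zero => exact ⟨1, zero_le_one, fun β h q _ M => by simp [nu_const]⟩
  | succ k ih =>
    obtain ⟨K, hK, ih⟩ := ih
    set C1 : ℝ := ((2 * k : ℕ) + 1) * 2 ^ (2 * k) with hC1
    set C2 : ℝ := ((2 * k + 1 : ℕ) + 1) * 2 ^ (2 * k + 1) * 3 with hC2
    refine ⟨2 * (2 * C1 + C2) * (K + 1), by positivity, fun β h q H M => ?_⟩
    set δ : ℝ := ((M + 1 : ℕ) : ℝ)⁻¹ with hδ
    have hN : (0 : ℝ) < ((M + 1 : ℕ) : ℝ) := by positivity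
    have hδ0 : 0 < δ := inv_pos.2 hN
    have hδ1 : δ ≤ 1 := Nat.cast_inv_le_one _
    set A := nu (M + 1) β h (fun σs : Fin 2 → Cfg (M + 1) =>
      (overlap (M + 1) (σs 0) (σs 1) - q) ^ (2 * k)) with hA
    set A' := nu (M + 1) β h (fun σs : Fin 2 → Cfg (M + 1) =>
      (overlap (M + 1) (σs 0) (σs 1) - q) ^ (2 * (k + 1))) with hA'
    have hAK : A ≤ K * δ ^ k := ih β h q H M
    have hA0 : 0 ≤ A := nu_nonneg fun σs => by rw [pow_mul]; positivity
    have hA'0 : 0 ≤ A' := nu_nonneg fun σs => by rw [pow_mul]; positivity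
    have hδk : δ ^ (2 * k) ≤ δ ^ k := pow_le_pow_of_le_one hδ0.le hδ1 (by omega)
    have hδk2 : δ ^ (2 * k + 1) ≤ δ ^ k := pow_le_pow_of_le_one hδ0.le hδ1 (by omega)
    have hE0 : 0 ≤ A + δ ^ k := by positivity
    have e1 : ∀ i, |nu (M + 1) β h (fun σs : Fin 2 → Cfg (M + 1) =>
        (spin (σs 0 i) * spin (σs 1 i) - q) *
          (overlap (M + 1) (σs 0) (σs 1) - q) ^ (2 * k + 1)) -
        nu (M + 1) β h (fun σs : Fin 2 → Cfg (M + 1) =>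
        (spin (σs 0 i) * spin (σs 1 i) - q) * cavR (M + 1) q i (σs 0) (σs 1) ^ (2 * k + 1))| ≤
        2 * C1 * δ * (A + δ ^ k) := by
      intro i
      rw [← nu_sub]
      refine (abs_nu_le (g := fun σs => 2 * C1 * δ *
        ((overlap (M + 1) (σs 0) (σs 1) - q) ^ (2 * k) + δ ^ (2 * k))) fun σs => ?_).trans ?_
      · rw [← mul_sub, abs_mul]
        have hs : |spin (σs 0 i) * spin (σs 1 i) - q| ≤ 2 := by
          refine (abs_sub _ _).trans ?_
          rw [abs_mul, abs_spin, abs_spin, abs_of_nonneg H.q_nonneg]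
          linarith [H.q_le]
        have := abs_pow_succ_sub_le (2 * k) (abs_overlap_sub_cavR_le q i (σs 0) (σs 1))
        rw [(even_two_mul k).pow_abs] at this
        calc _ ≤ 2 * (C1 * δ * ((overlap (M + 1) (σs 0) (σs 1) - q) ^ (2 * k) + δ ^ (2 * k))) :=
              mul_le_mul hs this (abs_nonneg _) zero_le_two
          _ = _ := by ring
      · rw [nu_const_mul, nu_add, nu_const]
        gcongr
    have e2 : ∀ i, nu (M + 1) β h (fun σs : Fin 2 → Cfg (M + 1) =>
        |cavR (M + 1) q i (σs 0) (σs 1)| ^ (2 * k + 1 + 1)) ≤ A' + C2 * δ * (A + δ ^ k) := by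
      intro i
      refine (nu_mono (g := fun σs => (overlap (M + 1) (σs 0) (σs 1) - q) ^ (2 * (k + 1)) +
        C2 * δ * ((overlap (M + 1) (σs 0) (σs 1) - q) ^ (2 * k) + δ ^ (2 * k + 1)))
        fun σs => ?_).trans ?_
      · have := abs_pow_succ_sub_le (2 * k + 1) (abs_overlap_sub_cavR_le q i (σs 0) (σs 1))
        have h3 := abs_overlap_sub_le H.q_nonneg H.q_le (σs 0) (σs 1)
        set r := overlap (M + 1) (σs 0) (σs 1) - q
        have hev : Even (2 * k + 1 + 1) := ⟨k + 1, by ring⟩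
        rw [hev.pow_abs, show 2 * (k + 1) = 2 * k + 1 + 1 by ring]
        have h4 : |r| ^ (2 * k + 1) + δ ^ (2 * k + 1) ≤ 3 * (r ^ (2 * k) + δ ^ (2 * k + 1)) := by
          rw [pow_succ, (even_two_mul k).pow_abs]
          have : 0 ≤ r ^ (2 * k) := (even_two_mul k).pow_nonneg r
          nlinarith [pow_pos hδ0 (2 * k + 1)]
        have h5 := (abs_le.1 this).1
        have h6 : (((2 * k + 1 : ℕ) : ℝ) + 1) * 2 ^ (2 * k + 1) * δ *
            (|r| ^ (2 * k + 1) + δ ^ (2 * k + 1)) ≤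
            C2 * δ * (r ^ (2 * k) + δ ^ (2 * k + 1)) := by
          calc _ ≤ (((2 * k + 1 : ℕ) : ℝ) + 1) * 2 ^ (2 * k + 1) * δ *
              (3 * (r ^ (2 * k) + δ ^ (2 * k + 1))) :=
                mul_le_mul_of_nonneg_left h4 (by positivity)
            _ = _ := by rw [hC2]; ring
        linarith
      · rw [nu_add, nu_const_mul, nu_add, nu_const]
        gcongr
    have e3 : A' ≤ 2 * C1 * δ * (A + δ ^ k) +
        576 * cavExp 6 * β ^ 2 * (A' + C2 * δ * (A + δ ^ k)) := by
      have hsum : A' = δ * ∑ i, nu (M + 1) β h (fun σs : Fin 2 → Cfg (M + 1) =>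
          (spin (σs 0 i) * spin (σs 1 i) - q) *
          (overlap (M + 1) (σs 0) (σs 1) - q) ^ (2 * k + 1)) := by
        rw [← nu_sum, ← nu_const_mul, hA']
        congr 1; ext σs
        rw [← Finset.sum_mul, show 2 * (k + 1) = 2 * k + 1 + 1 by ring, pow_succ', ← mul_assoc]
        congr 1
        rw [Finset.sum_sub_distrib, Finset.sum_const, Finset.card_univ, Fintype.card_fin,
          nsmul_eq_mul, mul_sub, overlap, hδ]
        field_simp
      have hc := cavExp_pos 6
      calc A' = _ := hsum
        _ ≤ δ * ∑ _i : Fin (M + 1), (2 * C1 * δ * (A + δ ^ k) +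
          576 * cavExp 6 * β ^ 2 * (A' + C2 * δ * (A + δ ^ k))) := by
            gcongr with i _
            have h1 := abs_nu_site_overlap_le H i (2 * k + 1)
            have h2 := mul_le_mul_of_nonneg_left (e2 i)
              (show 0 ≤ 576 * cavExp 6 * β ^ 2 by positivity)
            linarith [(abs_le.1 (e1 i)).2, (abs_le.1 h1).2]
        _ = _ := by
            rw [Finset.sum_const, Finset.card_univ, Fintype.card_fin, nsmul_eq_mul, ← mul_assoc,
              hδ, inv_mul_cancel₀ hN.ne', one_mul]
    have e4 : 576 * cavExp 6 * β ^ 2 ≤ 1 / 2 := by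
      have h1 := H.mul_cavExp_lt
      have h2 := H.le_one
      have h3 := H.pos
      nlinarith [cavExp_pos 6, mul_pos h3 (cavExp_pos 6)]
    have hD : 0 ≤ A' + C2 * δ * (A + δ ^ k) := by positivity
    have e5 := mul_le_mul_of_nonneg_right e4 hD
    have e6 : A' ≤ 2 * (2 * C1 + C2) * δ * (A + δ ^ k) := by
      have : 0 ≤ C2 * δ * (A + δ ^ k) := by positivity
      nlinarith
    calc A' ≤ 2 * (2 * C1 + C2) * δ * (A + δ ^ k) := e6
      _ ≤ 2 * (2 * C1 + C2) * δ * (K * δ ^ k + δ ^ k) := by gcongr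
      _ = _ := by ring

lemma add_pow_le_two_pow (a b : ℝ) (m : ℕ) : |a + b| ^ m ≤ 2 ^ m * (|a| ^ m + |b| ^ m) := by
  have h1 : |a + b| ≤ 2 * max |a| |b| := (abs_add_le a b).trans (by
    linarith [le_max_left |a| |b|, le_max_right |a| |b|])
  refine (pow_le_pow_left₀ (abs_nonneg _) h1 m).trans ?_
  rw [mul_pow]
  refine mul_le_mul_of_nonneg_left ?_ (by positivity)
  rcases le_total |a| |b| with h | h
  · rw [max_eq_right h]; linarith [pow_nonneg (abs_nonneg a) m]
  · rw [max_eq_left h]; linarith [pow_nonneg (abs_nonneg b) m]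

lemma exists_cavR_moment (k : ℕ) : ∃ K : ℝ, 0 ≤ K ∧ ∀ β h q, HighTemp β h q →
    ∀ (M : ℕ) (i : Fin (M + 1)), nu (M + 1) β h (fun σs : Fin 2 → Cfg (M + 1) =>
      |cavR (M + 1) q i (σs 0) (σs 1)| ^ (2 * k)) ≤ K * ((M + 1 : ℕ) : ℝ)⁻¹ ^ k := by
  obtain ⟨K, hK, H0⟩ := exists_overlap_moment k
  refine ⟨2 ^ (2 * k) * (K + 1), by positivity, fun β h q H M i => ?_⟩
  set δ : ℝ := ((M + 1 : ℕ) : ℝ)⁻¹ with hδ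
  have hδ0 : 0 < δ := inv_pos.2 (by positivity)
  have hδ1 : δ ≤ 1 := Nat.cast_inv_le_one _
  refine (nu_mono (g := fun σs => 2 ^ (2 * k) *
    ((overlap (M + 1) (σs 0) (σs 1) - q) ^ (2 * k) + δ ^ (2 * k))) fun σs => ?_).trans ?_
  · have h1 := add_pow_le_two_pow (overlap (M + 1) (σs 0) (σs 1) - q)
      (-(overlap (M + 1) (σs 0) (σs 1) - q - cavR (M + 1) q i (σs 0) (σs 1))) (2 * k)
    rw [abs_neg, (even_two_mul k).pow_abs (overlap (M + 1) (σs 0) (σs 1) - q)] at h1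
    have h2 := pow_le_pow_left₀ (abs_nonneg _)
      (abs_overlap_sub_cavR_le q i (σs 0) (σs 1)) (2 * k)
    rw [show overlap (M + 1) (σs 0) (σs 1) - q +
      -(overlap (M + 1) (σs 0) (σs 1) - q - cavR (M + 1) q i (σs 0) (σs 1)) =
      cavR (M + 1) q i (σs 0) (σs 1) by ring] at h1
    exact h1.trans (by gcongr)
  · rw [nu_const_mul, nu_add, nu_const]
    have := H0 β h q H M
    have h2 : δ ^ (2 * k) ≤ δ ^ k := pow_le_pow_of_le_one hδ0.le hδ1 (by omega)
    calc _ ≤ 2 ^ (2 * k) * (K * δ ^ k + δ ^ k) := by gcongr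
      _ = _ := by ring

/-- Moments of the absolute cavity overlaps. -/
lemma exists_cavAbs_moment (n k : ℕ) : ∃ K : ℝ, 0 ≤ K ∧ ∀ β h q, HighTemp β h q →
    ∀ (ι : Type) [Fintype ι] [DecidableEq ι], Fintype.card ι = n → ∀ (M : ℕ) (i : Fin (M + 1)),
    nu (M + 1) β h (fun σs : ι → Cfg (M + 1) => cavAbs (M + 1) q i σs ^ (2 * (k + 1))) ≤
      K * ((M + 1 : ℕ) : ℝ)⁻¹ ^ (k + 1) := by
  obtain ⟨K, hK, H0⟩ := exists_cavR_moment (k + 1)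
  refine ⟨((n : ℝ) ^ 2) ^ (2 * k + 1) * ((n : ℝ) ^ 2 * K), by positivity,
    fun β h q H ι _ _ hn M i => ?_⟩
  refine (nu_mono (g := fun σs => ((n : ℝ) ^ 2) ^ (2 * k + 1) * ∑ p : ι × ι,
    if p.1 = p.2 then 0 else |cavR (M + 1) q i (σs p.1) (σs p.2)| ^ (2 * (k + 1)))
    fun σs => ?_).trans ?_
  · have h1 := pow_sum_div_card_le_sum_pow (s := (univ : Finset (ι × ι))) (f := fun p =>
      if p.1 = p.2 then 0 else |cavR (M + 1) q i (σs p.1) (σs p.2)|)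
      (fun p _ => by split_ifs <;> positivity) (2 * k + 1)
    have h2 : cavAbs (M + 1) q i σs = ∑ p : ι × ι,
        if p.1 = p.2 then 0 else |cavR (M + 1) q i (σs p.1) (σs p.2)| := by
      rw [Fintype.sum_prod_type]; rfl
    rw [← h2, Finset.card_univ, Fintype.card_prod, hn] at h1
    rcases Nat.eq_zero_or_pos n with h0 | h0
    · subst h0
      have : IsEmpty ι := Fintype.card_eq_zero_iff.1 hn
      simp [cavAbs]
    rw [div_le_iff₀ (by positivity), mul_comm (∑ _, _)] at h1
    push_cast at h1
    rw [← sq] at h1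
    refine h1.trans_eq ?_
    congr 1
    refine Finset.sum_congr rfl fun p _ => ?_
    split_ifs
    · simp
    · ring
  · rw [nu_const_mul, nu_sum, mul_assoc]
    refine mul_le_mul_of_nonneg_left ?_ (by positivity)
    calc _ ≤ ∑ _p : ι × ι, K * ((M + 1 : ℕ) : ℝ)⁻¹ ^ (k + 1) := by
          refine Finset.sum_le_sum fun p _ => ?_
          split_ifs with hp
          · rw [nu_const]; positivity
          · rw [nu_pair (fun σ τ => |cavR (M + 1) q i σ τ| ^ (2 * (k + 1))) hp]
            exact H0 β h q H M i
      _ = _ := by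
          rw [Finset.sum_const, Finset.card_univ, Fintype.card_prod, hn, nsmul_eq_mul]
          push_cast; ring

end OverlapMoments

section LinearStatistics

variable {N : ℕ}

/-- The difference of a linear statistic between two replicas. -/
def diffSum (t : Fin N → ℝ) (σ τ : Cfg N) : ℝ := ∑ j, t j * (spin (σ j) - spin (τ j))

/-- `diffSum` without the contribution of one site. -/
def diffSumErase (i : Fin N) (t : Fin N → ℝ) (σ τ : Cfg N) : ℝ :=
  ∑ j ∈ univ.erase i, t j * (spin (σ j) - spin (τ j))

lemma diffSum_eq (i : Fin N) (t : Fin N → ℝ) (σ τ : Cfg N) :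
    diffSum t σ τ = diffSumErase i t σ τ + t i * (spin (σ i) - spin (τ i)) := by
  unfold diffSum diffSumErase
  rw [← Finset.add_sum_erase _ _ (Finset.mem_univ i), add_comm]

lemma abs_spin_sub_le (a b : Bool) : |spin a - spin b| ≤ 2 :=
  (abs_sub _ _).trans (by rw [abs_spin, abs_spin]; norm_num)

lemma abs_diffSum_sub_le (i : Fin N) (t : Fin N → ℝ) (σ τ : Cfg N) :
    |diffSum t σ τ - diffSumErase i t σ τ| ≤ 2 * |t i| := by
  rw [diffSum_eq i, add_sub_cancel_left, abs_mul, mul_comm]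
  exact mul_le_mul_of_nonneg_right (abs_spin_sub_le _ _) (abs_nonneg _)

lemma diffSumErase_congr {i : Fin N} {t : Fin N → ℝ} {σ τ σ' τ' : Cfg N}
    (h : ∀ j, j ≠ i → σ j = σ' j) (h' : ∀ j, j ≠ i → τ j = τ' j) :
    diffSumErase i t σ τ = diffSumErase i t σ' τ' :=
  Finset.sum_congr rfl fun j hj => by
    rw [h j (Finset.ne_of_mem_erase hj), h' j (Finset.ne_of_mem_erase hj)]

lemma pow_mul_le_scaled (m : ℕ) {a b η : ℝ} (ha : 0 ≤ a) (hb : 0 ≤ b) (hη : 0 < η) :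
    a ^ m * b ≤ η * a ^ (m + 1) + η⁻¹ ^ m * b ^ (m + 1) := by
  rcases le_total b (η * a) with h | h
  · have := mul_le_mul_of_nonneg_left h (pow_nonneg ha m)
    have h2 : 0 ≤ η⁻¹ ^ m * b ^ (m + 1) := by positivity
    rw [pow_succ]
    linarith
  · have h1 : a ≤ η⁻¹ * b := by
      rw [inv_mul_eq_div, le_div_iff₀ hη]; linarith
    have := mul_le_mul_of_nonneg_right (pow_le_pow_left₀ ha h1 m) hb
    rw [mul_pow, mul_assoc, ← pow_succ] at this
    have h2 : 0 ≤ η * a ^ (m + 1) := by positivity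
    linarith

end LinearStatistics

/-- The model at high temperature, together with a unit vector. -/
structure Env where
  /-- inverse temperature -/
  β : ℝ
  /-- external field -/
  h : ℝ
  /-- fixed point -/
  q : ℝ
  high : HighTemp β h q
  /-- number of sites minus one -/
  M : ℕ
  /-- unit vector -/
  t : Fin (M + 1) → ℝ
  sum_sq : ∑ i, t i ^ 2 = 1

namespace Env

/-- The scale `N ^ (-1/2)`. -/
def d (X : Env) : ℝ := (√((X.M + 1 : ℕ) : ℝ))⁻¹

lemma d_pos (X : Env) : 0 < X.d := inv_pos.2 (Real.sqrt_pos.2 (by positivity))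

lemma d_sq (X : Env) : X.d ^ 2 = ((X.M + 1 : ℕ) : ℝ)⁻¹ := by
  rw [d, inv_pow, Real.sq_sqrt (by positivity)]

lemma card_mul_d_sq (X : Env) : ((X.M + 1 : ℕ) : ℝ) * X.d ^ 2 = 1 := by
  rw [d_sq, mul_inv_cancel₀ (by positivity)]

lemma sum_abs_mul_d_le (X : Env) : (∑ i, |X.t i|) * X.d ≤ 1 := by
  have h1 := sq_sum_le_card_mul_sum_sq (s := univ) (f := fun i => |X.t i|)
  simp only [sq_abs, X.sum_sq, Finset.card_univ, Fintype.card_fin, mul_one] at h1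
  have h2 : ((∑ i, |X.t i|) * X.d) ^ 2 ≤ 1 := by
    rw [mul_pow, ← X.card_mul_d_sq]
    exact mul_le_mul_of_nonneg_right h1 (sq_nonneg _)
  exact (abs_le_one_iff_mul_self_le_one.2 (by rw [← sq]; exact h2)).trans' (le_abs_self _)

lemma abs_t_le_one (X : Env) (i) : |X.t i| ≤ 1 := by
  rw [← sq_le_one_iff_abs_le_one, ← X.sum_sq]
  exact Finset.single_le_sum (f := fun i => X.t i ^ 2) (fun _ _ => sq_nonneg _) (Finset.mem_univ i)

end Env

/-- Moments of the difference of the linear statistic. -/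
theorem exists_diffSum_moment (k : ℕ) : ∃ K : ℝ, 0 ≤ K ∧ ∀ X : Env,
    nu (X.M + 1) X.β X.h (fun σs : Fin 2 → Cfg (X.M + 1) =>
      diffSum X.t (σs 0) (σs 1) ^ (2 * k)) ≤ K := by
  induction k with
  | zero => exact ⟨1, zero_le_one, fun X => by simp [nu_const]⟩
  | succ k ih =>
    obtain ⟨K, hK, ih⟩ := ih
    obtain ⟨L, hL, hL'⟩ := exists_cavAbs_moment 6 k
    set C1 : ℝ := ((2 * k : ℕ) + 1) * 2 ^ (2 * k) with hC1
    set P : ℝ := 2 ^ (2 * k + 1) with hP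
    have hP0 : 0 < P := by positivity
    set G : ℝ := 8 * cavExp 6 with hG
    have hG0 : 0 < G := mul_pos (by norm_num) (cavExp_pos 6)
    set η : ℝ := (2 * G * P)⁻¹ with hη
    have hη0 : 0 < η := by positivity
    set C3 : ℝ := G * (P * (η⁻¹ ^ (2 * k + 1) * L + P * (1 + L))) with hC3
    refine ⟨2 * (4 * C1 * (K + 2 ^ (2 * k)) + C3), by positivity, fun X => ?_⟩
    set A := nu (X.M + 1) X.β X.h (fun σs : Fin 2 → Cfg (X.M + 1) =>
      diffSum X.t (σs 0) (σs 1) ^ (2 * k)) with hA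
    set A' := nu (X.M + 1) X.β X.h (fun σs : Fin 2 → Cfg (X.M + 1) =>
      diffSum X.t (σs 0) (σs 1) ^ (2 * (k + 1))) with hA'
    have hAK : A ≤ K := ih X
    have hA'0 : 0 ≤ A' := nu_nonneg fun σs => by rw [pow_mul]; positivity
    have e1 : ∀ i, |nu (X.M + 1) X.β X.h (fun σs : Fin 2 → Cfg (X.M + 1) =>
        (spin (σs 0 i) - spin (σs 1 i)) * diffSum X.t (σs 0) (σs 1) ^ (2 * k + 1)) -
        nu (X.M + 1) X.β X.h (fun σs : Fin 2 → Cfg (X.M + 1) =>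
        (spin (σs 0 i) - spin (σs 1 i)) * diffSumErase i X.t (σs 0) (σs 1) ^ (2 * k + 1))| ≤
        4 * C1 * (K + 2 ^ (2 * k)) * |X.t i| := by
      intro i
      rw [← nu_sub]
      refine (abs_nu_le (g := fun σs => 4 * C1 * |X.t i| *
        (diffSum X.t (σs 0) (σs 1) ^ (2 * k) + 2 ^ (2 * k))) fun σs => ?_).trans ?_
      · rw [← mul_sub, abs_mul]
        have := abs_pow_succ_sub_le (2 * k) (abs_diffSum_sub_le i X.t (σs 0) (σs 1))
        rw [(even_two_mul k).pow_abs] at this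
        have h2 : (2 * |X.t i|) ^ (2 * k) ≤ 2 ^ (2 * k) :=
          pow_le_pow_left₀ (by positivity) (by linarith [X.abs_t_le_one i]) _
        have h3 : 0 ≤ diffSum X.t (σs 0) (σs 1) ^ (2 * k) := (even_two_mul k).pow_nonneg _
        calc _ ≤ 2 * (C1 * (2 * |X.t i|) * (diffSum X.t (σs 0) (σs 1) ^ (2 * k) +
              (2 * |X.t i|) ^ (2 * k))) :=
              mul_le_mul (abs_spin_sub_le _ _) this (abs_nonneg _) zero_le_two
          _ ≤ 2 * (C1 * (2 * |X.t i|) * (diffSum X.t (σs 0) (σs 1) ^ (2 * k) +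
              2 ^ (2 * k))) := by gcongr
          _ = _ := by ring
      · rw [nu_const_mul, nu_add, nu_const]
        calc _ ≤ 4 * C1 * |X.t i| * (K + 2 ^ (2 * k)) := by gcongr
          _ = _ := by ring
    have e2 : ∀ i, |nu (X.M + 1) X.β X.h (fun σs : Fin 2 → Cfg (X.M + 1) =>
        (spin (σs 0 i) - spin (σs 1 i)) * diffSumErase i X.t (σs 0) (σs 1) ^ (2 * k + 1))| ≤
        X.d * (A' / 2 + C3) := by
      intro i
      have h1 := abs_nu_sub_cavNu_zero_le (h := X.h) X.high.pos.le X.high.le_one X.high.q_nonneg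
        X.high.q_le i (fun σs : Fin 2 → Cfg (X.M + 1) =>
        (spin (σs 0 i) - spin (σs 1 i)) * diffSumErase i X.t (σs 0) (σs 1) ^ (2 * k + 1))
      have h2 := cavNu_zero_mul X.β X.h X.q i
        (fun bs : Fin 2 → Bool => spin (bs 0) - spin (bs 1))
        (F := fun σs => diffSumErase i X.t (σs 0) (σs 1) ^ (2 * k + 1))
        (fun σs τs h =>
          congrArg (fun x : ℝ => x ^ (2 * k + 1)) (diffSumErase_congr (h 0) (h 1)))
      have h3 : siteAvg X.β X.h X.q (fun bs : Fin 2 → Bool => spin (bs 0) - spin (bs 1)) = 0 := by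
        rw [← cavNu_zero_site (N := X.M + 1) X.β X.h X.q i, cavNu_sub]
        have e : ∀ u : Fin 2, cavNu (X.M + 1) X.β X.h X.q i 0
            (fun σs : Fin 2 → Cfg (X.M + 1) => spin (σs u i)) = siteMoment X.β X.h X.q 1 := by
          intro u
          have e' := cavNu_zero_site (N := X.M + 1) X.β X.h X.q i
            (fun bs : Fin 2 → Bool => ∏ l ∈ {u}, spin (bs l))
          rw [siteAvg_prod] at e'
          simpa using e'
        rw [e, e, sub_self]
      rw [h3, zero_mul] at h2
      rw [h2, sub_zero] at h1
      refine h1.trans ?_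
      rw [show Fintype.card (Trip (Fin 2)) = 6 from rfl]
      have hβ : X.β ^ 2 ≤ 1 := pow_le_one₀ X.high.pos.le X.high.le_one
      set s := √((X.M + 1 : ℕ) : ℝ) with hs
      have hs0 : 0 < s := Real.sqrt_pos.2 (by positivity)
      have hds : X.d * s = 1 := inv_mul_cancel₀ hs0.ne'
      have h4 : nu (X.M + 1) X.β X.h (fun σs : Trip (Fin 2) → Cfg (X.M + 1) =>
          |(spin (σs (.inl 0) i) - spin (σs (.inl 1) i)) *
            diffSumErase i X.t (σs (.inl 0)) (σs (.inl 1)) ^ (2 * k + 1)| *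
            cavAbs (X.M + 1) X.q i σs) ≤
          2 * X.d * (P * (η * A' + η⁻¹ ^ (2 * k + 1) * L + P * (1 + L))) := by
        refine (nu_mono (g := fun σs => 2 * X.d * (P * (
          η * diffSum X.t (σs (.inl 0)) (σs (.inl 1)) ^ (2 * (k + 1)) +
          η⁻¹ ^ (2 * k + 1) * (s ^ (2 * (k + 1)) * cavAbs (X.M + 1) X.q i σs ^ (2 * (k + 1))) +
          P * (1 + s ^ (2 * (k + 1)) * cavAbs (X.M + 1) X.q i σs ^ (2 * (k + 1))))))
          fun σs => ?_).trans ?_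
        · rw [abs_mul, abs_pow]
          set Y := cavAbs (X.M + 1) X.q i σs
          have hY : 0 ≤ Y := cavAbs_nonneg _ _ _
          set S := diffSum X.t (σs (.inl 0)) (σs (.inl 1))
          set S' := diffSumErase i X.t (σs (.inl 0)) (σs (.inl 1))
          have i1 : |S - S'| ≤ 2 := (abs_diffSum_sub_le i X.t _ _).trans (by
            linarith [X.abs_t_le_one i])
          have i2 : |S'| ^ (2 * k + 1) ≤ P * (|S| ^ (2 * k + 1) + P) := by
            have := add_pow_le_two_pow S (-(S - S')) (2 * k + 1)
            rw [show S + -(S - S') = S' by ring, abs_neg] at this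
            exact this.trans (mul_le_mul_of_nonneg_left (add_le_add le_rfl
              (pow_le_pow_left₀ (abs_nonneg _) i1 _)) hP0.le)
          have i3 := pow_mul_le_scaled (2 * k + 1) (abs_nonneg S) (mul_nonneg hs0.le hY) hη0
          have i4 := pow_succ_mul_le (2 * k + 1) zero_le_one (mul_nonneg hs0.le hY)
          simp only [one_pow, one_mul] at i4
          rw [show 2 * k + 1 + 1 = 2 * (k + 1) by ring, mul_pow] at i3 i4
          rw [(even_two_mul (k + 1)).pow_abs] at i3
          calc _ ≤ 2 * (P * (|S| ^ (2 * k + 1) + P)) * Y :=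
                mul_le_mul_of_nonneg_right (mul_le_mul (abs_spin_sub_le _ _) i2 (by positivity)
                  zero_le_two) hY
            _ = 2 * X.d * (P * (|S| ^ (2 * k + 1) * (s * Y) + P * (s * Y))) := by
                linear_combination (-(2 * P * (|S| ^ (2 * k + 1) + P)) * Y) * hds
            _ ≤ _ := by
                have := X.d_pos
                gcongr
        · have hL2 := hL' X.β X.h X.q X.high (Trip (Fin 2)) rfl X.M i
          have hs2 : s ^ (2 * (k + 1)) * ((X.M + 1 : ℕ) : ℝ)⁻¹ ^ (k + 1) = 1 := by
            rw [pow_mul, Real.sq_sqrt (by positivity), ← mul_pow, mul_inv_cancel₀ (by positivity),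
              one_pow]
          have hL3 : s ^ (2 * (k + 1)) * nu (X.M + 1) X.β X.h
              (fun σs : Trip (Fin 2) → Cfg (X.M + 1) =>
                cavAbs (X.M + 1) X.q i σs ^ (2 * (k + 1))) ≤ L := by
            calc _ ≤ s ^ (2 * (k + 1)) * (L * ((X.M + 1 : ℕ) : ℝ)⁻¹ ^ (k + 1)) := by gcongr
              _ = L := by linear_combination L * hs2
          have hA2 : nu (X.M + 1) X.β X.h (fun σs : Trip (Fin 2) → Cfg (X.M + 1) =>
              diffSum X.t (σs (.inl 0)) (σs (.inl 1)) ^ (2 * (k + 1))) = A' :=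
            nu_pair (fun σ τ => diffSum X.t σ τ ^ (2 * (k + 1))) (by simp)
          simp only [nu_const_mul, nu_add, nu_const, hA2]
          have := X.d_pos
          gcongr
      have hc := cavExp_pos 6
      have hd := X.d_pos
      calc _ ≤ 4 * cavExp 6 * 1 *
            (2 * X.d * (P * (η * A' + η⁻¹ ^ (2 * k + 1) * L + P * (1 + L)))) := by
            refine mul_le_mul (by gcongr) h4 (nu_nonneg fun σs => ?_) (by positivity)
            exact mul_nonneg (abs_nonneg _) (cavAbs_nonneg _ _ _)
        _ = X.d * (G * P * η * A' + C3) := by rw [hC3, hG]; ring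
        _ = _ := by
            have : G * P * η = 1 / 2 := by rw [hη]; field_simp
            rw [this]; ring
    have hsum : A' = ∑ i, X.t i * nu (X.M + 1) X.β X.h (fun σs : Fin 2 → Cfg (X.M + 1) =>
        (spin (σs 0 i) - spin (σs 1 i)) * diffSum X.t (σs 0) (σs 1) ^ (2 * k + 1)) := by
      simp only [← nu_const_mul]
      rw [← nu_sum, hA']
      congr 1; ext σs
      rw [show 2 * (k + 1) = 2 * k + 1 + 1 by ring, pow_succ']
      nth_rw 1 [diffSum]
      rw [Finset.sum_mul]
      simp only [mul_assoc]
    have e3 : A' ≤ 4 * C1 * (K + 2 ^ (2 * k)) + (A' / 2 + C3) := by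
      have hD : 0 ≤ A' / 2 + C3 := by positivity
      calc A' = _ := hsum
        _ ≤ ∑ i, |X.t i| * (4 * C1 * (K + 2 ^ (2 * k)) * |X.t i| + X.d * (A' / 2 + C3)) := by
            refine Finset.sum_le_sum fun i _ => (le_abs_self _).trans ?_
            rw [abs_mul]
            refine mul_le_mul_of_nonneg_left ?_ (abs_nonneg _)
            have := abs_sub_abs_le_abs_sub (nu (X.M + 1) X.β X.h
              (fun σs : Fin 2 → Cfg (X.M + 1) =>
              (spin (σs 0 i) - spin (σs 1 i)) * diffSum X.t (σs 0) (σs 1) ^ (2 * k + 1)))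
              (nu (X.M + 1) X.β X.h (fun σs : Fin 2 → Cfg (X.M + 1) =>
              (spin (σs 0 i) - spin (σs 1 i)) * diffSumErase i X.t (σs 0) (σs 1) ^ (2 * k + 1)))
            linarith [e1 i, e2 i]
        _ = 4 * C1 * (K + 2 ^ (2 * k)) * ∑ i, X.t i ^ 2 +
            ((∑ i, |X.t i|) * X.d) * (A' / 2 + C3) := by
            simp only [← sq_abs (X.t _), Finset.mul_sum, Finset.sum_mul]
            rw [← Finset.sum_add_distrib]
            exact Finset.sum_congr rfl fun i _ => by ring
        _ ≤ 4 * C1 * (K + 2 ^ (2 * k)) * 1 + 1 * (A' / 2 + C3) := by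
            rw [X.sum_sq]
            gcongr
            exact X.sum_abs_mul_d_le
        _ = _ := by ring
    linarith

section PolynomialBounds

open MvPolynomial

variable {n : ℕ}

/-- A weight dominating polynomials. -/
def polyWeight (x : Fin n → ℝ) : ℝ := 1 + ∑ l, x l ^ 2

lemma one_le_polyWeight (x : Fin n → ℝ) : 1 ≤ polyWeight x :=
  le_add_of_nonneg_right (Finset.sum_nonneg fun _ _ => sq_nonneg _)

lemma abs_le_polyWeight (x : Fin n → ℝ) (l : Fin n) : |x l| ≤ polyWeight x := by
  have h1 : x l ^ 2 ≤ ∑ l, x l ^ 2 :=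
    Finset.single_le_sum (f := fun l => x l ^ 2) (fun _ _ => sq_nonneg _) (Finset.mem_univ l)
  unfold polyWeight
  nlinarith [sq_abs (x l), sq_nonneg (|x l| - 1), abs_nonneg (x l)]

/-- Growth, Lipschitz and Taylor bounds for a polynomial. -/
lemma exists_poly_bound (P : MvPolynomial (Fin n) ℝ) : ∃ (C : ℝ) (K : ℕ), 0 ≤ C ∧
    ∀ (x y : Fin n → ℝ) (s : ℝ), 0 ≤ s → s ≤ 2 → (∀ l, |x l - y l| ≤ s) →
      |eval x P| ≤ C * polyWeight x ^ K ∧ |eval y P| ≤ C * polyWeight x ^ K ∧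
      |eval x P - eval y P| ≤ C * s * polyWeight x ^ K ∧
      |eval x P - eval y P - ∑ l, (x l - y l) * eval y (pderiv l P)| ≤
        C * s ^ 2 * polyWeight x ^ K := by
  induction P using MvPolynomial.induction_on with
  | C a =>
    refine ⟨|a|, 0, abs_nonneg _, fun x y s h0 h2 h => ?_⟩
    simp only [eval_C, pow_zero, mul_one, le_refl, sub_self, abs_zero, pderiv_C, map_zero,
      mul_zero, Finset.sum_const_zero, true_and]
    constructor <;> positivity
  | add P Q hP hQ =>
    obtain ⟨C1, K1, hC1, hP⟩ := hP
    obtain ⟨C2, K2, hC2, hQ⟩ := hQ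
    refine ⟨C1 + C2, K1 + K2, by positivity, fun x y s h0 h2 h => ?_⟩
    obtain ⟨p1, p2, p3, p4⟩ := hP x y s h0 h2 h
    obtain ⟨q1, q2, q3, q4⟩ := hQ x y s h0 h2 h
    have hw := one_le_polyWeight x
    have w1 : polyWeight x ^ K1 ≤ polyWeight x ^ (K1 + K2) := pow_le_pow_right₀ hw (by omega)
    have w2 : polyWeight x ^ K2 ≤ polyWeight x ^ (K1 + K2) := pow_le_pow_right₀ hw (by omega)
    have key : ∀ a b c1 c2 : ℝ, 0 ≤ c1 → 0 ≤ c2 → |a| ≤ c1 * polyWeight x ^ K1 →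
        |b| ≤ c2 * polyWeight x ^ K2 → |a + b| ≤ (c1 + c2) * polyWeight x ^ (K1 + K2) := by
      intro a b c1 c2 h1 h2 ha hb
      have := mul_le_mul_of_nonneg_left w1 h1
      have := mul_le_mul_of_nonneg_left w2 h2
      linarith [abs_add_le a b]
    simp only [map_add]
    refine ⟨key _ _ _ _ hC1 hC2 p1 q1, key _ _ _ _ hC1 hC2 p2 q2, ?_, ?_⟩
    · have := key _ _ _ _ (by positivity) (by positivity) p3 q3
      rw [add_mul C1 C2 s]
      convert this using 2; ring
    · have := key _ _ _ _ (by positivity) (by positivity) p4 q4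
      rw [add_mul C1 C2 (s ^ 2)]
      convert this using 2
      simp only [mul_add, Finset.sum_add_distrib]; ring
  | mul_X P i hP =>
    obtain ⟨C1, K1, hC1, hP⟩ := hP
    refine ⟨4 * C1, K1 + 1, by positivity, fun x y s h0 h2 h => ?_⟩
    obtain ⟨p1, p2, p3, p4⟩ := hP x y s h0 h2 h
    have hw := one_le_polyWeight x
    have hx := abs_le_polyWeight x i
    have hy : |y i| ≤ 3 * polyWeight x := by
      have := abs_sub_abs_le_abs_sub (y i) (x i)
      rw [abs_sub_comm] at this
      linarith [h i]
    set w := polyWeight x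
    have hw0 : 0 ≤ w ^ K1 := by positivity
    have hwK : w ^ K1 ≤ w ^ (K1 + 1) := pow_le_pow_right₀ hw (by omega)
    have key : ∀ c z, 0 ≤ c → |z| ≤ c * w ^ K1 → |z * y i| ≤ 3 * c * w ^ (K1 + 1) := by
      intro c z hc hz
      rw [abs_mul]
      calc _ ≤ (c * w ^ K1) * (3 * w) := mul_le_mul hz hy (abs_nonneg _) (by positivity)
        _ = _ := by ring
    have key2 : ∀ c z, 0 ≤ c → |z| ≤ c * w ^ K1 → |z * (x i - y i)| ≤ c * s * w ^ (K1 + 1) := by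
      intro c z hc hz
      rw [abs_mul]
      calc _ ≤ (c * w ^ K1) * s := mul_le_mul hz (h i) (abs_nonneg _) (by positivity)
        _ = c * s * w ^ K1 := by ring
        _ ≤ _ := by gcongr
    simp only [map_mul, eval_X]
    refine ⟨?_, ?_, ?_, ?_⟩
    · rw [abs_mul]
      calc _ ≤ (C1 * w ^ K1) * w := mul_le_mul p1 hx (abs_nonneg _) (by positivity)
        _ = C1 * w ^ (K1 + 1) := by ring
        _ ≤ _ := by
          refine mul_le_mul_of_nonneg_right (by linarith) (by positivity)
    · refine (key _ _ hC1 p2).trans (mul_le_mul_of_nonneg_right (by linarith) (by positivity))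
    · have e : eval x P * x i - eval y P * y i =
          (eval x P - eval y P) * y i + eval x P * (x i - y i) := by ring
      rw [e]
      have a1 := key _ _ (by positivity) p3
      have a2 := key2 _ _ hC1 p1
      refine (abs_add_le _ _).trans ((add_le_add a1 a2).trans_eq (by ring))
    · have e : eval x P * x i - eval y P * y i -
          ∑ l, (x l - y l) * eval y (pderiv l (P * X i)) =
          (eval x P - eval y P - ∑ l, (x l - y l) * eval y (pderiv l P)) * y i +
            (eval x P - eval y P) * (x i - y i) := by
        have : ∀ l, eval y (pderiv l (P * X i)) =
            eval y (pderiv l P) * y i + eval y P * (if l = i then 1 else 0) := by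
          intro l
          rw [Derivation.leibniz, pderiv_X]
          by_cases hl : l = i
          · subst hl; simp; ring
          · simp [hl, Ne.symm hl]; ring
        simp only [this, mul_add, Finset.sum_add_distrib, mul_ite, mul_one, mul_zero,
          Finset.sum_ite_eq', Finset.mem_univ, if_true, ← mul_assoc, ← Finset.sum_mul]
        ring
      rw [e]
      have a1 := key _ _ (by positivity) p4
      have a2 := key2 _ _ (by positivity) p3
      refine (abs_add_le _ _).trans ((add_le_add a1 a2).trans_eq (by ring))

end PolynomialBounds

/-- An environment together with a distinguished site. -/
structure SiteEnv extends Env where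
  /-- the distinguished site -/
  site : Fin (M + 1)

section Domination

open Asymptotics

variable {n : ℕ} {κ : Type} [Fintype κ] [DecidableEq κ]

/-- The differences of the linear statistic along pairs of replicas. -/
def Env.S (X : Env) (e : Fin n × Fin 2 → κ) (σs : κ → Cfg (X.M + 1)) (l : Fin n) : ℝ :=
  diffSum X.t (σs (e (l, 0))) (σs (e (l, 1)))

/-- `Env.S` without the contribution of the distinguished site. -/
def SiteEnv.S' (X : SiteEnv) (e : Fin n × Fin 2 → κ) (σs : κ → Cfg (X.M + 1)) (l : Fin n) : ℝ :=
  diffSumErase X.site X.t (σs (e (l, 0))) (σs (e (l, 1)))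

lemma exists_polyWeight_moment {e : Fin n × Fin 2 → κ} (he : Function.Injective e) (K : ℕ) :
    ∃ C : ℝ, 0 ≤ C ∧ ∀ X : Env, nu (X.M + 1) X.β X.h (fun σs : κ → Cfg (X.M + 1) =>
      polyWeight (X.S e σs) ^ K) ≤ C := by
  obtain ⟨L, hL, hL'⟩ := exists_diffSum_moment (K + 1)
  refine ⟨((n : ℝ) + 1) ^ K * (1 + n * L), by positivity, fun X => ?_⟩
  refine (nu_mono (g := fun σs => ((n : ℝ) + 1) ^ K * (1 + ∑ l, X.S e σs l ^ (2 * (K + 1))))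
    fun σs => ?_).trans ?_
  · have h1 := pow_sum_div_card_le_sum_pow (s := (univ : Finset (Option (Fin n))))
      (f := fun o => o.elim 1 fun l => X.S e σs l ^ 2)
      (fun o _ => by cases o <;> simp [sq_nonneg]) K
    simp only [Fintype.sum_option, Option.elim, Finset.card_univ, Fintype.card_option,
      Fintype.card_fin, one_pow, ← pow_mul] at h1
    rw [div_le_iff₀ (by positivity), mul_comm (1 + _) _] at h1
    push_cast at h1
    refine le_trans ?_ h1
    exact pow_le_pow_right₀ (one_le_polyWeight (X.S e σs)) (by omega)
  · rw [nu_const_mul, nu_add, nu_const, nu_sum]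
    refine mul_le_mul_of_nonneg_left (add_le_add le_rfl ?_) (by positivity)
    calc _ ≤ ∑ _l : Fin n, L := by
          refine Finset.sum_le_sum fun l _ => ?_
          refine (nu_pair (fun σ τ => diffSum X.t σ τ ^ (2 * (K + 1)))
            (u := e (l, 0)) (v := e (l, 1)) fun h => ?_).trans_le (hL' X)
          simpa using he h
      _ = _ := by simp

lemma exists_polyWeight_cavAbs_moment {e : Fin n × Fin 2 → κ} (he : Function.Injective e)
    (K j : ℕ) : ∃ C : ℝ, 0 ≤ C ∧ ∀ X : SiteEnv,
    nu (X.M + 1) X.β X.h (fun σs : κ → Cfg (X.M + 1) =>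
      polyWeight (X.S e σs) ^ K * cavAbs (X.M + 1) X.q X.site σs ^ j) ≤ C * X.d ^ j := by
  obtain ⟨L, hL, hL'⟩ := exists_polyWeight_moment he (2 * K)
  have hc : ∃ G : ℝ, 0 ≤ G ∧ ∀ X : SiteEnv, nu (X.M + 1) X.β X.h
      (fun σs : κ → Cfg (X.M + 1) => cavAbs (X.M + 1) X.q X.site σs ^ (2 * j)) ≤
        G * X.d ^ (2 * j) := by
    cases j with
    | zero => exact ⟨1, zero_le_one, fun X => by simp [nu_const]⟩
    | succ k =>
      obtain ⟨G, hG, hG'⟩ := exists_cavAbs_moment (Fintype.card κ) k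
      refine ⟨G, hG, fun X => ?_⟩
      rw [pow_mul X.d, X.d_sq]
      exact hG' X.β X.h X.q X.high κ rfl X.M X.site
  obtain ⟨G, hG, hG'⟩ := hc
  refine ⟨L + G, by positivity, fun X => ?_⟩
  have hd := pow_pos X.d_pos j
  refine (nu_mono (g := fun σs => X.d ^ j * polyWeight (X.S e σs) ^ (2 * K) +
    (X.d ^ j)⁻¹ * cavAbs (X.M + 1) X.q X.site σs ^ (2 * j)) fun σs => ?_).trans ?_
  · set a := polyWeight (X.S e σs) ^ K with ha
    set b := cavAbs (X.M + 1) X.q X.site σs ^ j with hb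
    rw [mul_comm 2, pow_mul, ← ha, mul_comm 2, pow_mul, ← hb]
    have ha0 : 0 ≤ a := pow_nonneg (zero_le_one.trans (one_le_polyWeight _)) _
    have hb0 : 0 ≤ b := pow_nonneg (cavAbs_nonneg _ _ _) _
    have := pow_mul_le_scaled 1 ha0 hb0 hd
    simpa using this
  · rw [nu_add, nu_const_mul, nu_const_mul]
    calc _ ≤ X.d ^ j * L + (X.d ^ j)⁻¹ * (G * X.d ^ (2 * j)) := by
          gcongr
          · exact hL' X.toEnv
          · exact hG' X
      _ = _ := by
          rw [two_mul, pow_add]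
          field_simp

/-- Domination of a replica function by `b` times a polynomial in the linear statistics
times the `j`-th power of the cavity overlaps. -/
def Dominated (e : Fin n × Fin 2 → κ) (j : ℕ) (f : ∀ X : SiteEnv, (κ → Cfg (X.M + 1)) → ℝ)
    (b : SiteEnv → ℝ) : Prop :=
  ∃ (C : ℝ) (K : ℕ), 0 ≤ C ∧ ∀ X σs, |f X σs| ≤
    C * |b X| * (polyWeight (X.S e σs) ^ K * cavAbs (X.M + 1) X.q X.site σs ^ j)

namespace Dominated

variable {e : Fin n × Fin 2 → κ} {j : ℕ} {f : ∀ X : SiteEnv, (κ → Cfg (X.M + 1)) → ℝ}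
  {b : SiteEnv → ℝ}

lemma isBigO_nu (he : Function.Injective e) (hf : Dominated e j f b) :
    (fun X : SiteEnv => nu (X.M + 1) X.β X.h (f X)) =O[⊤] fun X => b X * X.d ^ j := by
  obtain ⟨C, K, hC, hf⟩ := hf
  obtain ⟨L, hL, hL'⟩ := exists_polyWeight_cavAbs_moment he K j
  refine isBigO_top.2 ⟨C * L, fun X => ?_⟩
  have h1 := abs_nu_le (β := X.β) (h := X.h) (hf X)
  rw [nu_const_mul] at h1
  rw [Real.norm_eq_abs, Real.norm_eq_abs, abs_mul, abs_of_pos (pow_pos X.d_pos j)]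
  calc _ ≤ C * |b X| * (L * X.d ^ j) := h1.trans (by gcongr; exact hL' X)
    _ = _ := by ring

lemma inl_mul_cavAbs (hf : Dominated e j f b) (m : ℕ) :
    Dominated (κ := Trip κ) (fun p => .inl (e p)) (j + m)
      (fun X σs => |f X fun l => σs (.inl l)| * cavAbs (X.M + 1) X.q X.site σs ^ m) b := by
  obtain ⟨C, K, hC, hf⟩ := hf
  refine ⟨C, K, hC, fun X σs => ?_⟩
  have h0 := cavAbs_nonneg X.q X.site σs
  have h1 := cavAbs_nonneg X.q X.site (fun l => σs (.inl l))
  have h3 := zero_le_one.trans (one_le_polyWeight (X.S e fun l => σs (.inl l)))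
  rw [abs_mul, abs_abs, abs_of_nonneg (pow_nonneg h0 m), pow_add, ← mul_assoc, ← mul_assoc]
  refine mul_le_mul_of_nonneg_right ((hf X _).trans ?_) (pow_nonneg h0 m)
  rw [mul_assoc (C * |b X|)]
  have h2 := pow_le_pow_left₀ h1 (cavAbs_comp_inl_le X.q X.site σs) j
  refine mul_le_mul_of_nonneg_left (mul_le_mul le_rfl h2 (pow_nonneg h1 j) (pow_nonneg h3 K))
    (by positivity)

lemma inl (hf : Dominated e j f b) :
    Dominated (κ := Trip κ) (fun p => .inl (e p)) j (fun X σs => f X fun l => σs (.inl l)) b := by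
  obtain ⟨C, K, hC, h⟩ := hf.inl_mul_cavAbs 0
  exact ⟨C, K, hC, fun X σs => by simpa using h X σs⟩

lemma isBigO_cavity (he : Function.Injective e) (hf : Dominated e j f b) :
    (fun X : SiteEnv => nu (X.M + 1) X.β X.h (f X) - cavNu (X.M + 1) X.β X.h X.q X.site 0 (f X))
      =O[⊤] fun X => b X * X.d ^ (j + 1) := by
  have h1 := (hf.inl_mul_cavAbs 1).isBigO_nu (Sum.inl_injective.comp he)
  refine IsBigO.trans (isBigO_top.2 ⟨4 * cavExp (Fintype.card (Trip κ)), fun X => ?_⟩) h1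
  have h2 := abs_nu_sub_cavNu_zero_le (h := X.h) X.high.pos.le X.high.le_one X.high.q_nonneg
        X.high.q_le X.site (f X)
  simp only [pow_one, Real.norm_eq_abs]
  refine h2.trans ?_
  have hβ : X.β ^ 2 ≤ 1 := pow_le_one₀ X.high.pos.le X.high.le_one
  have hc := cavExp_pos (Fintype.card (Trip κ))
  calc _ ≤ 4 * cavExp (Fintype.card (Trip κ)) * 1 * _ := by
        refine mul_le_mul (by gcongr) (le_abs_self _) (nu_nonneg fun σs => ?_) (by positivity)
        exact mul_nonneg (abs_nonneg _) (cavAbs_nonneg _ _ _)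
    _ = _ := by rw [mul_one]

lemma isBigO_cavity_two (he : Function.Injective e) (hf : Dominated e j f b) :
    (fun X : SiteEnv => nu (X.M + 1) X.β X.h (f X) -
      cavNu (X.M + 1) X.β X.h X.q X.site 0 (f X) - X.β ^ 2 / 2 *
      cavNu (X.M + 1) X.β X.h X.q X.site 0 (fun σs : Trip κ → _ =>
        f X (fun l => σs (.inl l)) * cavIns (X.M + 1) X.q X.site σs))
      =O[⊤] fun X => b X * X.d ^ (j + 2) := by
  have h1 := (hf.inl.inl_mul_cavAbs 2).isBigO_nu
    (Sum.inl_injective.comp (Sum.inl_injective.comp he))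
  refine IsBigO.trans (isBigO_top.2 ⟨16 * cavExp (Fintype.card (Trip (Trip κ))), fun X => ?_⟩) h1
  have h2 := abs_nu_sub_cavNu_zero_sub_le (h := X.h) X.high.pos.le X.high.le_one X.high.q_nonneg
        X.high.q_le X.site (f X)
  simp only [Real.norm_eq_abs]
  refine h2.trans ?_
  have hc := cavExp_pos (Fintype.card (Trip (Trip κ)))
  exact mul_le_mul_of_nonneg_left (le_abs_self _) (by positivity)

end Dominated

end Domination

section SiteAverages

variable {ι : Type} [Fintype ι] [DecidableEq ι] (β h q : ℝ)

lemma siteAvg_eq_cavNu (e : (ι → Bool) → ℝ) : siteAvg β h q e =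
    cavNu 1 β h q 0 0 (fun σs : ι → Cfg 1 => e (fun l => σs l 0)) :=
  (cavNu_zero_site β h q 0 e).symm

lemma siteAvg_sub (e e' : (ι → Bool) → ℝ) :
    siteAvg β h q (fun bs => e bs - e' bs) = siteAvg β h q e - siteAvg β h q e' := by
  simp only [siteAvg_eq_cavNu, cavNu_sub]

lemma siteAvg_const_mul (c : ℝ) (e : (ι → Bool) → ℝ) :
    siteAvg β h q (fun bs => c * e bs) = c * siteAvg β h q e := by
  simp only [siteAvg_eq_cavNu, cavNu_const_mul]

lemma abs_siteAvg_le {e : (ι → Bool) → ℝ} {B : ℝ} (he : ∀ bs, |e bs| ≤ B) :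
    |siteAvg β h q e| ≤ B := by
  rw [siteAvg_eq_cavNu]
  refine (abs_cavNu_le (g := fun _ => B) fun σs => he _).trans_eq (cavNu_const _ _ _ _ _ _)

/-- Averages of functions antisymmetric under a permutation of the replicas vanish. -/
lemma siteAvg_eq_zero_of_antisymm (π : ι ≃ ι) {e : (ι → Bool) → ℝ}
    (he : ∀ bs, e (fun l => bs (π l)) = -e bs) : siteAvg β h q e = 0 := by
  have h1 := cavNu_comp_injective (N := 1) β h q 0 0 π.injective
    (fun σs : ι → Cfg 1 => e (fun l => σs l 0))
  have h2 : ∀ σs : ι → Cfg 1, e (fun l => σs (π l) 0) = (-1) * e (fun l => σs l 0) := fun σs => by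
    rw [he fun l => σs l 0]; ring
  simp only [h2, cavNu_const_mul] at h1
  rw [siteAvg_eq_cavNu]
  linarith

end SiteAverages

section SiteExpansion

open Asymptotics MvPolynomial

variable {n : ℕ} {κ : Type} [Fintype κ] [DecidableEq κ] {e : Fin n × Fin 2 → κ}

lemma exists_abs_le_of_finite {A : Type} [Finite A] (E : A → ℝ) : ∃ B, 0 ≤ B ∧ ∀ a, |E a| ≤ B := by
  cases nonempty_fintype A
  exact ⟨∑ a, |E a|, Finset.sum_nonneg fun _ _ => abs_nonneg _, fun a =>
    Finset.single_le_sum (f := fun a => |E a|) (fun _ _ => abs_nonneg _) (Finset.mem_univ a)⟩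

namespace Dominated

variable {j : ℕ} {f g : ∀ X : SiteEnv, (κ → Cfg (X.M + 1)) → ℝ} {b b' : SiteEnv → ℝ}

lemma mul_of_le (hf : Dominated e j f b) {B : ℝ} (hg : ∀ X σs, |g X σs| ≤ B * |b' X|) :
    Dominated e j (fun X σs => g X σs * f X σs) (fun X => b X * b' X) := by
  obtain ⟨C, K, hC, hf⟩ := hf
  refine ⟨C * |B|, K, by positivity, fun X σs => ?_⟩
  rw [abs_mul, abs_mul]
  have h1 : |g X σs| ≤ |B| * |b' X| :=
    (hg X σs).trans (mul_le_mul_of_nonneg_right (le_abs_self _) (abs_nonneg _))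
  calc _ ≤ (|B| * |b' X|) * _ := mul_le_mul h1 (hf X σs) (abs_nonneg _) (by positivity)
    _ = _ := by ring

lemma mul_bounded (hf : Dominated e j f b) {B : ℝ} (hg : ∀ X σs, |g X σs| ≤ B) :
    Dominated e j (fun X σs => g X σs * f X σs) b := by
  simpa using hf.mul_of_le (b' := fun _ => 1) (B := B) (by simpa using hg)

lemma mul_cavR (hf : Dominated e 0 f b) {u v : κ} (huv : u ≠ v) :
    Dominated e 1 (fun X σs => f X σs * cavR (X.M + 1) X.q X.site (σs u) (σs v)) b := by
  obtain ⟨C, K, hC, hf⟩ := hf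
  refine ⟨C, K, hC, fun X σs => ?_⟩
  have h1 : |cavR (X.M + 1) X.q X.site (σs u) (σs v)| ≤ cavAbs (X.M + 1) X.q X.site σs := by
    unfold cavAbs
    have h2 := Finset.single_le_sum (f := fun v => if u = v then 0 else
      |cavR (X.M + 1) X.q X.site (σs u) (σs v)|)
      (fun v _ => by split_ifs <;> positivity) (Finset.mem_univ v)
    have h3 := Finset.single_le_sum (f := fun u => ∑ v, if u = v then 0 else
      |cavR (X.M + 1) X.q X.site (σs u) (σs v)|)
      (fun u _ => Finset.sum_nonneg fun v _ => by split_ifs <;> positivity) (Finset.mem_univ u)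
    simp only [huv, if_false] at h2
    exact h2.trans h3
  have h2 := hf X σs
  rw [pow_zero, mul_one] at h2
  rw [abs_mul, pow_one, ← mul_assoc]
  exact mul_le_mul h2 h1 (abs_nonneg _) ((abs_nonneg _).trans h2)

end Dominated

omit [Fintype κ] [DecidableEq κ] in
lemma SiteEnv.S_sub_S' (X : SiteEnv) (e : Fin n × Fin 2 → κ) (σs : κ → Cfg (X.M + 1))
    (l : Fin n) : X.S e σs l - X.S' e σs l =
      X.t X.site * (spin (σs (e (l, 0)) X.site) - spin (σs (e (l, 1)) X.site)) := by
  unfold Env.S SiteEnv.S'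
  rw [diffSum_eq X.site, add_sub_cancel_left]

lemma dominated_eval (e : Fin n × Fin 2 → κ) (P : MvPolynomial (Fin n) ℝ) :
    Dominated e 0 (fun X σs => eval (X.S e σs) P) (fun _ => 1) ∧
    Dominated e 0 (fun X σs => eval (X.S' e σs) P) (fun _ => 1) ∧
    Dominated e 0 (fun X σs => eval (X.S e σs) P - eval (X.S' e σs) P) (fun X => X.t X.site) ∧
    Dominated e 0 (fun X σs => eval (X.S e σs) P - eval (X.S' e σs) P -
      ∑ l, (X.S e σs l - X.S' e σs l) * eval (X.S' e σs) (pderiv l P))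
      (fun X => X.t X.site ^ 2) := by
  obtain ⟨C, K, hC, hP⟩ := exists_poly_bound P
  have key := fun (X : SiteEnv) (σs : κ → Cfg (X.M + 1)) =>
    hP (X.S e σs) (X.S' e σs) (2 * |X.t X.site|) (by positivity)
      (by linarith [X.abs_t_le_one X.site]) fun l => abs_diffSum_sub_le X.site X.t _ _
  refine ⟨⟨C, K, hC, fun X σs => ?_⟩, ⟨C, K, hC, fun X σs => ?_⟩,
    ⟨2 * C, K, by positivity, fun X σs => ?_⟩, ⟨4 * C, K, by positivity, fun X σs => ?_⟩⟩
  · simpa using (key X σs).1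
  · simpa using (key X σs).2.1
  · refine (key X σs).2.2.1.trans_eq ?_
    ring
  · refine (key X σs).2.2.2.trans_eq ?_
    rw [abs_pow]
    ring

omit [Fintype κ] [DecidableEq κ] in
lemma siteFree_eval_S' (X : SiteEnv) (e : Fin n × Fin 2 → κ) (P : MvPolynomial (Fin n) ℝ) :
    SiteFree X.site (fun σs : κ → Cfg (X.M + 1) => eval (X.S' e σs) P) := by
  intro σs τs h
  have : X.S' e σs = X.S' e τs := by
    ext l
    exact diffSumErase_congr (h _) (h _)
  simp only [this]

/-- The error scale of the expansion at one site. -/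
def SiteEnv.err (X : SiteEnv) : ℝ := X.d ^ 2 + X.t X.site ^ 2

lemma SiteEnv.err_nonneg (X : SiteEnv) : 0 ≤ X.err := add_nonneg (sq_nonneg _) (sq_nonneg _)

lemma isBigO_err {b : SiteEnv → ℝ} (hb : ∀ X, |b X| ≤ X.err) : b =O[⊤] SiteEnv.err :=
  isBigO_top.2 ⟨1, fun X => by
    rw [one_mul, Real.norm_eq_abs, Real.norm_eq_abs, abs_of_nonneg X.err_nonneg]
    exact hb X⟩

lemma isBigO_d_sq : (fun X : SiteEnv => X.d ^ 2) =O[⊤] SiteEnv.err := isBigO_err fun X => by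
  rw [abs_of_nonneg (sq_nonneg _)]
  exact le_add_of_nonneg_right (sq_nonneg _)

lemma isBigO_t_sq : (fun X : SiteEnv => X.t X.site ^ 2) =O[⊤] SiteEnv.err := isBigO_err fun X => by
  rw [abs_of_nonneg (sq_nonneg _)]
  exact le_add_of_nonneg_left (sq_nonneg _)

lemma isBigO_t_mul_d : (fun X : SiteEnv => X.t X.site * X.d) =O[⊤] SiteEnv.err :=
  isBigO_err fun X => by
    unfold SiteEnv.err
    rw [abs_le]
    constructor <;> nlinarith [sq_nonneg (X.t X.site - X.d), sq_nonneg (X.t X.site + X.d)]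

lemma isBigO_one_of_le {b : SiteEnv → ℝ} (B : ℝ) (hb : ∀ X, |b X| ≤ B) :
    b =O[⊤] fun _ => (1 : ℝ) :=
  isBigO_top.2 ⟨B, fun X => by simpa using hb X⟩

/-- Replacing the cavity average of an overlap insertion by the full average. -/
lemma isBigO_overlap_insertion (he : Function.Injective e) (P : MvPolynomial (Fin n) ℝ) {u v : κ}
    (huv : u ≠ v) :
    (fun X : SiteEnv => cavNu (X.M + 1) X.β X.h X.q X.site 0 (fun σs : κ → Cfg (X.M + 1) =>
        eval (X.S' e σs) P * cavR (X.M + 1) X.q X.site (σs u) (σs v)) -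
      nu (X.M + 1) X.β X.h (fun σs : κ → Cfg (X.M + 1) =>
        eval (X.S e σs) P * (overlap (X.M + 1) (σs u) (σs v) - X.q))) =O[⊤] SiteEnv.err := by
  obtain ⟨h1, h2, h3, -⟩ := dominated_eval e P
  have a1 := (h2.mul_cavR huv).isBigO_cavity he
  have a2 := (h3.mul_cavR huv).isBigO_nu he
  have a3 := (h1.mul_of_le (g := fun X σs => overlap (X.M + 1) (σs u) (σs v) - X.q -
    cavR (X.M + 1) X.q X.site (σs u) (σs v)) (b' := fun X => X.d ^ 2) (B := 1) (fun X σs => by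
      rw [one_mul, abs_of_nonneg (sq_nonneg X.d), X.d_sq]
      exact abs_overlap_sub_cavR_le _ _ _ _)).isBigO_nu he
  simp only [one_mul, pow_zero, mul_one, pow_one] at a1 a2 a3
  refine (((a1.trans isBigO_d_sq).neg_left.sub (a2.trans isBigO_t_mul_d)).sub
    (a3.trans isBigO_d_sq)).congr_left fun X => ?_
  simp only [sub_mul, mul_sub, nu_sub]
  simp only [mul_comm (overlap _ _ _), mul_comm (cavR _ _ _ _ _), mul_comm X.q]
  ring

/-- Replacing the average of a site-free polynomial by the full average. -/
lemma isBigO_site_insertion (he : Function.Injective e) (P : MvPolynomial (Fin n) ℝ)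
    (E : (κ → Bool) → ℝ) :
    (fun X : SiteEnv => X.t X.site * (nu (X.M + 1) X.β X.h (fun σs : κ → Cfg (X.M + 1) =>
        E (fun l => σs l X.site) * eval (X.S' e σs) P) -
      siteAvg X.β X.h X.q E * nu (X.M + 1) X.β X.h (fun σs : κ → Cfg (X.M + 1) =>
        eval (X.S e σs) P))) =O[⊤] SiteEnv.err := by
  obtain ⟨B, hB, hE⟩ := exists_abs_le_of_finite E
  obtain ⟨h1, h2, h3, -⟩ := dominated_eval e P
  have a1 := (h2.mul_bounded (g := fun X σs => E (fun l => σs l X.site)) (B := B)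
    fun X σs => hE _).isBigO_cavity he
  have a2 := h2.isBigO_cavity he
  have a3 := h3.isBigO_nu he
  have hs : (fun X : SiteEnv => siteAvg X.β X.h X.q E) =O[⊤] fun _ => (1 : ℝ) :=
    isBigO_one_of_le B fun X => abs_siteAvg_le _ _ _ hE
  have ht : (fun X : SiteEnv => X.t X.site) =O[⊤] fun X => X.t X.site := isBigO_refl _ _
  have b1 := ht.mul a1
  have b2 := (hs.mul (ht.mul a2))
  have b3 := (hs.mul (ht.mul a3))
  simp only [one_mul, pow_zero, mul_one, pow_one, zero_add, ← sq] at b1 b2 b3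
  refine (((b1.trans isBigO_t_mul_d).sub (b2.trans isBigO_t_mul_d)).sub
    (b3.trans isBigO_t_sq)).congr_left fun X => ?_
  rw [cavNu_zero_mul X.β X.h X.q X.site E (siteFree_eval_S' X e P), nu_sub]
  ring

/-- The expansion of an average at one site. -/
theorem isBigO_site_expansion (he : Function.Injective e) (P : MvPolynomial (Fin n) ℝ)
    (E : (κ → Bool) → ℝ) (hE0 : ∀ β h q, siteAvg β h q E = 0) :
    (fun X : SiteEnv => nu (X.M + 1) X.β X.h (fun σs : κ → Cfg (X.M + 1) =>
        E (fun l => σs l X.site) * eval (X.S e σs) P) -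
      X.β ^ 2 / 2 * (∑ u : Trip κ, ∑ v : Trip κ, pairCoef u v *
        (siteAvg X.β X.h X.q (fun bs : Trip κ → Bool =>
          E (fun l => bs (.inl l)) * (spin (bs u) * spin (bs v))) *
        nu (X.M + 1) X.β X.h (fun σs : Trip κ → Cfg (X.M + 1) =>
          eval (X.S (fun p => .inl (e p)) σs) P *
            (overlap (X.M + 1) (σs u) (σs v) - X.q)))) -
      X.t X.site * ∑ l, siteAvg X.β X.h X.q (fun bs : κ → Bool =>
          E bs * (spin (bs (e (l, 0))) - spin (bs (e (l, 1))))) *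
        nu (X.M + 1) X.β X.h (fun σs : κ → Cfg (X.M + 1) => eval (X.S e σs) (pderiv l P)))
      =O[⊤] SiteEnv.err := by
  obtain ⟨B, hB, hE⟩ := exists_abs_le_of_finite E
  obtain ⟨h1, h2, h3, h4⟩ := dominated_eval e P
  have a1 := (h4.mul_bounded (g := fun X σs => E (fun l => σs l X.site)) (B := B)
    fun X σs => hE _).isBigO_nu he
  have a2 := (h2.mul_bounded (g := fun X σs => E (fun l => σs l X.site)) (B := B)
    fun X σs => hE _).isBigO_cavity_two he
  have a3 := fun l => isBigO_site_insertion he (pderiv l P)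
    (fun bs => E bs * (spin (bs (e (l, 0))) - spin (bs (e (l, 1)))))
  have a3s := IsBigO.sum (s := univ) fun l _ => a3 l
  have a4 : ∀ u v : Trip κ, (fun X : SiteEnv => X.β ^ 2 / 2 * (pairCoef u v *
      (siteAvg X.β X.h X.q (fun bs : Trip κ → Bool =>
          E (fun l => bs (.inl l)) * (spin (bs u) * spin (bs v))) *
      (cavNu (X.M + 1) X.β X.h X.q X.site 0 (fun σs : Trip κ → Cfg (X.M + 1) =>
        eval (X.S' (fun p => .inl (e p)) σs) P * cavR (X.M + 1) X.q X.site (σs u) (σs v)) -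
      nu (X.M + 1) X.β X.h (fun σs : Trip κ → Cfg (X.M + 1) =>
        eval (X.S (fun p => .inl (e p)) σs) P *
          (overlap (X.M + 1) (σs u) (σs v) - X.q)))))) =O[⊤] SiteEnv.err := by
    intro u v
    by_cases huv : u = v
    · subst huv
      simp only [pairCoef_self, zero_mul, mul_zero]
      exact isBigO_zero _ _
    have b1 := isBigO_overlap_insertion (Sum.inl_injective.comp he) P huv
    have b2 : (fun X : SiteEnv => X.β ^ 2 / 2 * (pairCoef u v *
        siteAvg X.β X.h X.q (fun bs : Trip κ → Bool =>
          E (fun l => bs (.inl l)) * (spin (bs u) * spin (bs v))))) =O[⊤] fun _ => (1 : ℝ) := by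
      refine isBigO_one_of_le (1 * (2 * B)) fun X => ?_
      have hβ : |X.β ^ 2 / 2| ≤ 1 := by
        rw [abs_of_nonneg (by positivity)]
        linarith [pow_le_one₀ (n := 2) X.high.pos.le X.high.le_one]
      rw [abs_mul, abs_mul]
      have := abs_siteAvg_le X.β X.h X.q (e := fun bs : Trip κ → Bool =>
          E (fun l => bs (.inl l)) * (spin (bs u) * spin (bs v))) (B := B) fun bs => by
        rw [abs_mul, abs_mul, abs_spin, abs_spin, mul_one, mul_one]
        exact hE _
      exact mul_le_mul hβ (mul_le_mul (abs_pairCoef_le u v) this (abs_nonneg _) zero_le_two)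
        (by positivity) zero_le_one
    have b3 := b2.mul b1
    simp only [one_mul] at b3
    refine b3.congr_left fun X => ?_
    simp only [mul_assoc]
    rfl
  have a4s := IsBigO.sum (s := univ) fun u _ => IsBigO.sum (s := univ) fun v _ => a4 u v
  simp only [one_mul, pow_zero, mul_one, zero_add] at a1 a2
  refine ((((a1.trans isBigO_t_sq).add (a2.trans isBigO_d_sq)).add a4s).add a3s).congr_left
    fun X => ?_
  have c1 : cavNu (X.M + 1) X.β X.h X.q X.site 0 (fun σs : κ → Cfg (X.M + 1) =>
      E (fun l => σs l X.site) * eval (X.S' e σs) P) = 0 := by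
    rw [cavNu_zero_mul X.β X.h X.q X.site E (siteFree_eval_S' X e P), hE0, zero_mul]
  have c2 : cavNu (X.M + 1) X.β X.h X.q X.site 0 (fun σs : Trip κ → Cfg (X.M + 1) =>
        E (fun l => σs (.inl l) X.site) * eval (X.S' e fun l => σs (.inl l)) P *
          cavIns (X.M + 1) X.q X.site σs) =
      ∑ u : Trip κ, ∑ v : Trip κ, pairCoef u v *
        (siteAvg X.β X.h X.q (fun bs : Trip κ → Bool =>
          E (fun l => bs (.inl l)) * (spin (bs u) * spin (bs v))) *
        cavNu (X.M + 1) X.β X.h X.q X.site 0 (fun σs : Trip κ → Cfg (X.M + 1) =>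
        eval (X.S' (fun p => .inl (e p)) σs) P *
          cavR (X.M + 1) X.q X.site (σs u) (σs v))) := by
    simp only [cavIns, Finset.mul_sum, cavNu_sum]
    refine Finset.sum_congr rfl fun u _ => Finset.sum_congr rfl fun v _ => ?_
    rw [← cavNu_zero_mul X.β X.h X.q X.site, ← cavNu_const_mul]
    · congr 1; ext σs
      have : X.S' e (fun l => σs (.inl l)) = X.S' (fun p => .inl (e p)) σs := rfl
      rw [this]
      ring
    · intro σs τs h
      have i1 := siteFree_eval_S' X (fun p => (.inl (e p) : Trip κ)) P σs τs h
      have i2 := siteFree_comp_cavR X.q X.site u v (fun x => x) σs τs h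
      exact congrArg₂ (· * ·) i1 i2
  have c3 : nu (X.M + 1) X.β X.h (fun σs : κ → Cfg (X.M + 1) => E (fun l => σs l X.site) *
      (eval (X.S e σs) P - eval (X.S' e σs) P -
        ∑ l, (X.S e σs l - X.S' e σs l) * eval (X.S' e σs) (pderiv l P))) =
      nu (X.M + 1) X.β X.h (fun σs : κ → Cfg (X.M + 1) =>
        E (fun l => σs l X.site) * eval (X.S e σs) P) -
      nu (X.M + 1) X.β X.h (fun σs : κ → Cfg (X.M + 1) =>
        E (fun l => σs l X.site) * eval (X.S' e σs) P) -
      ∑ l, X.t X.site * nu (X.M + 1) X.β X.h (fun σs : κ → Cfg (X.M + 1) =>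
        E (fun l => σs l X.site) * (spin (σs (e (l, 0)) X.site) - spin (σs (e (l, 1)) X.site)) *
          eval (X.S' e σs) (pderiv l P)) := by
    simp only [← nu_const_mul]
    rw [← nu_sum, ← nu_sub, ← nu_sub]
    congr 1; ext σs
    simp only [X.S_sub_S', mul_sub, Finset.mul_sum]
    congr 1
    exact Finset.sum_congr rfl fun l _ => by ring
  rw [c1, c2, c3]
  simp only [Finset.sum_apply, mul_sub, Finset.sum_sub_distrib, sub_zero]
  simp only [← Finset.mul_sum]
  ring

end SiteExpansion

section PairSums

variable {κ : Type} [Fintype κ] [DecidableEq κ]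

/-- The difference of the indicators of two points. -/
def pairSign {J : Type} [DecidableEq J] (p p' u : J) : ℝ :=
  (if u = p then 1 else 0) - (if u = p' then 1 else 0)

lemma sum_pairSign_mul {J : Type} [Fintype J] [DecidableEq J] (p p' : J) (F : J → ℝ) :
    ∑ u, pairSign p p' u * F u = F p - F p' := by
  simp [pairSign, sub_mul, Finset.sum_sub_distrib]

lemma sum_sum_pairCoef (p p' : κ) {c : Trip κ → ℝ} (hc : c (.inl p) = 0) (hc' : c (.inl p') = 0)
    {ρ : Trip κ → Trip κ → ℝ} (hρ : ∀ u v, ρ u v = ρ v u) :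
    ∑ u, ∑ v, pairCoef u v * ((pairSign (.inl p) (.inl p') u * c v +
      pairSign (.inl p) (.inl p') v * c u) * ρ u v) =
    2 * (∑ m, c (.inl m) * (ρ (.inl p) (.inl m) - ρ (.inl p') (.inl m)) -
      ∑ m, c (.inr (.inl m)) * (ρ (.inl p) (.inr (.inl m)) - ρ (.inl p') (.inr (.inl m)))) := by
  have h1 : ∑ u, ∑ v, pairCoef u v * ((pairSign (.inl p) (.inl p') u * c v +
      pairSign (.inl p) (.inl p') v * c u) * ρ u v) =
      ∑ u, pairSign (.inl p) (.inl p') u * (∑ v, pairCoef u v * (c v * ρ u v)) +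
      ∑ v, pairSign (.inl p) (.inl p') v * (∑ u, pairCoef u v * (c u * ρ u v)) := by
    simp only [Finset.mul_sum]
    rw [Finset.sum_comm (f := fun v u => pairSign (.inl p) (.inl p') v *
      (pairCoef u v * (c u * ρ u v)))]
    simp only [← Finset.sum_add_distrib]
    exact Finset.sum_congr rfl fun u _ => Finset.sum_congr rfl fun v _ => by ring
  have h2 : ∀ (r : κ) (x : κ → ℝ), c (.inl r) = 0 →
      ∑ m, (if r = m then 0 else 1) * (c (.inl m) * x m) = ∑ m, c (.inl m) * x m := by
    intro r x hr
    refine Finset.sum_congr rfl fun m _ => ?_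
    split_ifs with h
    · rw [← h, hr, zero_mul, zero_mul]
    · rw [one_mul]
  have h3 : ∀ (r : κ) (x : κ → ℝ), c (.inl r) = 0 →
      ∑ m, (if m = r then 0 else 1) * (c (.inl m) * x m) = ∑ m, c (.inl m) * x m := by
    intro r x hr
    rw [← h2 r x hr]
    simp only [eq_comm]
  rw [h1, sum_pairSign_mul, sum_pairSign_mul]
  simp only [Fintype.sum_sum_type, pairCoef, zero_mul, Finset.sum_const_zero, add_zero,
    h2 p _ hc, h2 p' _ hc', h3 p _ hc, h3 p' _ hc', hρ _ (.inl p), hρ _ (.inl p'), mul_sub,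
    Finset.sum_sub_distrib, Finset.sum_neg_distrib, neg_mul]
  simp only [← Finset.mul_sum]
  ring

end PairSums

section PairAverages

variable {J : Type} [Fintype J] [DecidableEq J] (β h q : ℝ)

/-- Averages antisymmetric in `p, p'` and otherwise not involving them vanish. -/
lemma siteAvg_antisymm_mul {p p' : J} {e : (J → Bool) → ℝ}
    (he : ∀ bs, e (fun l => bs (Equiv.swap p p' l)) = e bs) :
    siteAvg β h q (fun bs => (spin (bs p) - spin (bs p')) * e bs) = 0 := by
  refine siteAvg_eq_zero_of_antisymm β h q (Equiv.swap p p') fun bs => ?_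
  simp only [he, Equiv.swap_apply_left, Equiv.swap_apply_right]
  ring

/-- The coefficients in the average of an antisymmetric function against pairs of spins. -/
def pairAvg (p p' : J) (e : (J → Bool) → ℝ) (v : J) : ℝ :=
  if v = p ∨ v = p' then 0 else
    siteAvg β h q fun bs => (1 - spin (bs p) * spin (bs p')) * (e bs * spin (bs v))

lemma siteAvg_antisymm_mul_pair {p p' : J} (hp : p ≠ p') {e : (J → Bool) → ℝ}
    (he : ∀ bs, e (fun l => bs (Equiv.swap p p' l)) = e bs) {u v : J} (huv : u ≠ v) :
    siteAvg β h q (fun bs => (spin (bs p) - spin (bs p')) * e bs * (spin (bs u) * spin (bs v))) =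
      pairSign p p' u * pairAvg β h q p p' e v + pairSign p p' v * pairAvg β h q p p' e u := by
  have key : ∀ v, v ≠ p → v ≠ p' → siteAvg β h q (fun bs =>
      (spin (bs p) - spin (bs p')) * e bs * (spin (bs p) * spin (bs v))) =
        siteAvg β h q fun bs => (1 - spin (bs p) * spin (bs p')) * (e bs * spin (bs v)) := by
    intro v _ _
    congr 1; ext bs
    linear_combination (e bs * spin (bs v)) * spin_mul_self (bs p)
  have key' : ∀ v, v ≠ p → v ≠ p' → siteAvg β h q (fun bs =>
      (spin (bs p) - spin (bs p')) * e bs * (spin (bs p') * spin (bs v))) =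
        -siteAvg β h q fun bs => (1 - spin (bs p) * spin (bs p')) * (e bs * spin (bs v)) := by
    intro v _ _
    rw [neg_eq_neg_one_mul, ← siteAvg_const_mul]
    congr 1; ext bs
    linear_combination -(e bs * spin (bs v)) * spin_mul_self (bs p')
  have zero : ∀ x : (J → Bool) → ℝ, (∀ bs, x (fun l => bs (Equiv.swap p p' l)) = x bs) →
      siteAvg β h q (fun bs => (spin (bs p) - spin (bs p')) * e bs * x bs) = 0 := by
    intro x hx
    simp only [mul_assoc]
    exact siteAvg_antisymm_mul β h q fun bs => by rw [he, hx]
  have comm : ∀ u v, siteAvg β h q (fun bs =>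
      (spin (bs p) - spin (bs p')) * e bs * (spin (bs u) * spin (bs v))) =
      siteAvg β h q (fun bs =>
        (spin (bs p) - spin (bs p')) * e bs * (spin (bs v) * spin (bs u))) := fun u v => by
    simp only [mul_comm (spin (_ : Bool)) (spin (_ : Bool))]
  by_cases hu : u = p ∨ u = p'
  · by_cases hv : v = p ∨ v = p'
    · rw [zero]
      · simp [pairAvg, hu, hv]
      · intro bs
        rcases hu with rfl | rfl <;> rcases hv with rfl | rfl <;> first
          | exact absurd rfl huv
          | simp [mul_comm]
    · push Not at hv
      rcases hu with rfl | rfl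
      · rw [key v hv.1 hv.2]
        simp [pairAvg, pairSign, hv.1, hv.2, hp]
      · rw [key' v hv.1 hv.2]
        simp [pairAvg, pairSign, hv.1, hv.2, hp.symm]
  · push Not at hu
    by_cases hv : v = p ∨ v = p'
    · rcases hv with rfl | rfl
      · rw [comm, key u hu.1 hu.2]
        simp [pairAvg, pairSign, hu.1, hu.2, hp]
      · rw [comm, key' u hu.1 hu.2]
        simp [pairAvg, pairSign, hu.1, hu.2, hp.symm]
    · push Not at hv
      rw [zero]
      · simp [pairSign, hu.1, hu.2, hv.1, hv.2]
      · intro bs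
        dsimp only
        rw [Equiv.swap_apply_of_ne_of_ne hu.1 hu.2, Equiv.swap_apply_of_ne_of_ne hv.1 hv.2]

lemma siteAvg_spin (a : J) :
    siteAvg β h q (fun bs : J → Bool => spin (bs a)) = siteMoment β h q 1 := by
  simpa using siteAvg_prod β h q {a}

lemma siteAvg_spin_mul {a b : J} (hab : a ≠ b) :
    siteAvg β h q (fun bs : J → Bool => spin (bs a) * spin (bs b)) = siteMoment β h q 2 := by
  simpa [Finset.prod_pair hab, Finset.card_pair hab] using siteAvg_prod β h q {a, b}

lemma siteAvg_one_sub_spin_mul {a b : J} (hab : a ≠ b) :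
    siteAvg β h q (fun bs : J → Bool => 1 - spin (bs a) * spin (bs b)) =
      1 - siteMoment β h q 2 := by
  rw [siteAvg_sub, siteAvg_const, siteAvg_spin_mul β h q hab]

lemma siteAvg_spin_mul_three {a b c : J} (hab : a ≠ b) (hac : a ≠ c) (hbc : b ≠ c) :
    siteAvg β h q (fun bs : J → Bool => spin (bs a) * (spin (bs b) * spin (bs c))) =
      siteMoment β h q 3 := by
  simpa [hab, hac, hbc] using siteAvg_prod β h q {a, b, c}

lemma siteAvg_spin_mul_four {a b c d : J} (hab : a ≠ b) (hac : a ≠ c) (had : a ≠ d)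
    (hbc : b ≠ c) (hbd : b ≠ d) (hcd : c ≠ d) :
    siteAvg β h q (fun bs : J → Bool =>
      spin (bs a) * (spin (bs b) * (spin (bs c) * spin (bs d)))) = siteMoment β h q 4 := by
  simpa [hab, hac, had, hbc, hbd, hcd] using siteAvg_prod β h q {a, b, c, d}

lemma pairAvg_one {p p' v : J} (hp : p ≠ p') (hv : v ≠ p) (hv' : v ≠ p') :
    pairAvg β h q p p' (fun _ => 1) v = siteMoment β h q 1 - siteMoment β h q 3 := by
  rw [pairAvg, if_neg (by tauto), ← siteAvg_spin β h q v,
    ← siteAvg_spin_mul_three β h q hp hv.symm hv'.symm, ← siteAvg_sub]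
  congr 1; ext bs
  ring

lemma pairAvg_spin_self {p p' v : J} (hp : p ≠ p') (hv : v ≠ p) (hv' : v ≠ p') :
    pairAvg β h q p p' (fun bs => spin (bs v)) v = 1 - siteMoment β h q 2 := by
  rw [pairAvg, if_neg (by tauto), ← siteAvg_one_sub_spin_mul β h q hp]
  congr 1; ext bs
  rw [spin_mul_self]
  ring

lemma pairAvg_spin {p p' m v : J} (hp : p ≠ p') (hm : m ≠ p) (hm' : m ≠ p') (hv : v ≠ p)
    (hv' : v ≠ p') (hvm : m ≠ v) : pairAvg β h q p p' (fun bs => spin (bs m)) v =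
      siteMoment β h q 2 - siteMoment β h q 4 := by
  rw [pairAvg, if_neg (by tauto), ← siteAvg_spin_mul β h q hvm,
    ← siteAvg_spin_mul_four β h q hp hm.symm hv.symm hm'.symm hv'.symm hvm, ← siteAvg_sub]
  congr 1; ext bs
  ring

/-- The average of a difference of spins against a difference of spins. -/
lemma siteAvg_sub_mul_sub {p p' : J} (hp : p ≠ p') :
    siteAvg β h q (fun bs => (spin (bs p) - spin (bs p')) * 1 * (spin (bs p) - spin (bs p'))) =
      2 * (1 - siteMoment β h q 2) := by
  rw [← siteAvg_one_sub_spin_mul β h q hp, ← siteAvg_const_mul]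
  congr 1; ext bs
  linear_combination spin_mul_self (bs p) + spin_mul_self (bs p')

lemma siteAvg_sub_mul_spin_mul_sub {p p' m : J} (hp : p ≠ p') (hm : m ≠ p) (hm' : m ≠ p') :
    siteAvg β h q (fun bs => (spin (bs p) - spin (bs p')) * spin (bs m) *
      (spin (bs p) - spin (bs p'))) = 2 * (siteMoment β h q 1 - siteMoment β h q 3) := by
  rw [← siteAvg_spin β h q m, ← siteAvg_spin_mul_three β h q hp hm.symm hm'.symm, ← siteAvg_sub,
    ← siteAvg_const_mul]
  congr 1; ext bs
  linear_combination spin (bs m) * (spin_mul_self (bs p) + spin_mul_self (bs p'))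

end PairAverages

section AntisymmetricExpansion

open Asymptotics MvPolynomial

variable {n : ℕ}

/-- The average of a polynomial against the difference of the overlaps of a pair of replicas with
another replica. -/
def Env.gap (X : Env) (l : Fin n) (P : MvPolynomial (Fin n) ℝ) (m : Option (Fin n × Fin 2)) : ℝ :=
  nu (X.M + 1) X.β X.h (fun σs : Option (Fin n × Fin 2) → Cfg (X.M + 1) =>
    eval (X.S some σs) P * (overlap (X.M + 1) (σs (some (l, 0))) (σs m) -
      overlap (X.M + 1) (σs (some (l, 1))) (σs m)))

lemma overlap_comm {N : ℕ} (σ τ : Cfg N) : overlap N σ τ = overlap N τ σ := by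
  simp only [overlap, mul_comm]

theorem isBigO_antisymm_expansion (l : Fin n) (P : MvPolynomial (Fin n) ℝ)
    {E : (Option (Fin n × Fin 2) → Bool) → ℝ}
    (hE : ∀ bs, E (fun m => bs (Equiv.swap (some (l, 0)) (some (l, 1)) m)) = E bs) :
    (fun X : SiteEnv => nu (X.M + 1) X.β X.h (fun σs : Option (Fin n × Fin 2) → Cfg (X.M + 1) =>
        (spin (σs (some (l, 0)) X.site) - spin (σs (some (l, 1)) X.site)) *
          E (fun m => σs m X.site) * eval (X.S some σs) P) -
      X.β ^ 2 * (∑ m, pairAvg X.β X.h X.q (.inl (some (l, 0))) (.inl (some (l, 1)))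
          (fun bs : Trip (Option (Fin n × Fin 2)) → Bool => E (fun m => bs (.inl m))) (.inl m) *
          X.gap l P m -
        ∑ m, pairAvg X.β X.h X.q (.inl (some (l, 0))) (.inl (some (l, 1)))
          (fun bs : Trip (Option (Fin n × Fin 2)) → Bool => E (fun m => bs (.inl m)))
            (.inr (.inl m)) * X.gap l P none) -
      X.t X.site * ∑ j, siteAvg X.β X.h X.q (fun bs : Option (Fin n × Fin 2) → Bool =>
          (spin (bs (some (l, 0))) - spin (bs (some (l, 1)))) * E bs *
            (spin (bs (some (j, 0))) - spin (bs (some (j, 1))))) *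
        nu (X.M + 1) X.β X.h (fun σs : Option (Fin n × Fin 2) → Cfg (X.M + 1) =>
          eval (X.S some σs) (pderiv j P))) =O[⊤] SiteEnv.err := by
  have hne : (some (l, 0) : Option (Fin n × Fin 2)) ≠ some (l, 1) := by simp
  refine (isBigO_site_expansion (Option.some_injective _) P
    (fun bs => (spin (bs (some (l, 0))) - spin (bs (some (l, 1)))) * E bs)
    fun β h q => siteAvg_antisymm_mul β h q hE).congr_left fun X => ?_
  set ρ : Trip (Option (Fin n × Fin 2)) → Trip (Option (Fin n × Fin 2)) → ℝ := fun u v =>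
    nu (X.M + 1) X.β X.h (fun σs : Trip (Option (Fin n × Fin 2)) → Cfg (X.M + 1) =>
      eval (X.S (fun p => .inl (some p)) σs) P * (overlap (X.M + 1) (σs u) (σs v) - X.q)) with hρ
  have hinl : Function.Injective (Sum.inl : _ → Trip (Option (Fin n × Fin 2))) := Sum.inl_injective
  have hE' : ∀ bs : Trip (Option (Fin n × Fin 2)) → Bool,
      E (fun m => bs (Equiv.swap (.inl (some (l, 0))) (.inl (some (l, 1))) (.inl m))) =
        E (fun m => bs (.inl m)) := fun bs => by
    simp only [hinl.swap_apply]
    exact hE fun m => bs (.inl m)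
  have hsum := sum_sum_pairCoef (some (l, 0)) (some (l, 1))
    (c := pairAvg X.β X.h X.q (.inl (some (l, 0))) (.inl (some (l, 1)))
      (fun bs : Trip (Option (Fin n × Fin 2)) → Bool => E (fun m => bs (.inl m))))
    (by simp [pairAvg]) (by simp [pairAvg]) (ρ := ρ)
    (fun u v => by simp only [hρ, overlap_comm (_ : Cfg (X.M + 1)) (_ : Cfg (X.M + 1))])
  have hgap : ∀ m, ρ (.inl (some (l, 0))) (.inl m) - ρ (.inl (some (l, 1))) (.inl m) =
      X.gap l P m := fun m => by
    rw [Env.gap, ← nu_comp_injective X.β X.h hinl, hρ, ← nu_sub]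
    congr 1; ext σs
    have : X.S (fun p => .inl (some p)) σs = X.S some fun m => σs (.inl m) := rfl
    rw [this]
    ring
  have hgap' : ∀ m, ρ (.inl (some (l, 0))) (.inr (.inl m)) -
      ρ (.inl (some (l, 1))) (.inr (.inl m)) = X.gap l P none := fun m => by
    have hi : Function.Injective (fun o : Option (Fin n × Fin 2) =>
        (o.elim (.inr (.inl m)) fun x => .inl (some x) : Trip (Option (Fin n × Fin 2)))) := by
      intro a b hab
      cases a <;> cases b <;> simp_all
    rw [Env.gap, ← nu_comp_injective X.β X.h hi, hρ, ← nu_sub]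
    congr 1; ext σs
    have : X.S (fun p => .inl (some p)) σs = X.S some fun o : Option (Fin n × Fin 2) =>
      σs (o.elim (.inr (.inl m)) fun x => .inl (some x)) := rfl
    rw [this]
    simp only [Option.elim]
    ring
  simp only [hgap, hgap'] at hsum
  have hpair : ∀ u v, pairCoef u v * (siteAvg X.β X.h X.q
      (fun bs : Trip (Option (Fin n × Fin 2)) → Bool =>
        (spin (bs (.inl (some (l, 0)))) - spin (bs (.inl (some (l, 1))))) *
          E (fun m => bs (.inl m)) * (spin (bs u) * spin (bs v))) * ρ u v) =
      pairCoef u v * ((pairSign (.inl (some (l, 0))) (.inl (some (l, 1))) u *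
        pairAvg X.β X.h X.q (.inl (some (l, 0))) (.inl (some (l, 1)))
          (fun bs : Trip (Option (Fin n × Fin 2)) → Bool => E (fun m => bs (.inl m))) v +
        pairSign (.inl (some (l, 0))) (.inl (some (l, 1))) v *
        pairAvg X.β X.h X.q (.inl (some (l, 0))) (.inl (some (l, 1)))
          (fun bs : Trip (Option (Fin n × Fin 2)) → Bool => E (fun m => bs (.inl m))) u) *
          ρ u v) := fun u v => by
    by_cases huv : u = v
    · rw [huv, pairCoef_self, zero_mul, zero_mul]
    · rw [siteAvg_antisymm_mul_pair X.β X.h X.q (hinl.ne hne) hE' huv]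
  simp only [← hpair] at hsum
  rw [hsum]
  ring

/-- The moments of the mean of a spin in the limiting field. -/
def Env.moment (X : Env) (k : ℕ) : ℝ := siteMoment X.β X.h X.q k

/-- The sum of the gaps appearing in the expansion at a site. -/
def Env.gapSum (X : Env) (l : Fin n) (P : MvPolynomial (Fin n) ℝ) : ℝ :=
  ∑ m with m ≠ some (l, 0) ∧ m ≠ some (l, 1), X.gap l P m - (2 * n + 1) * X.gap l P none

lemma swap_some_of_ne {j l : Fin n} (hj : j ≠ l) (a : Fin 2) :
    Equiv.swap (some (l, (0 : Fin 2))) (some (l, 1)) (some (j, a)) = some (j, a) :=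
  Equiv.swap_apply_of_ne_of_ne (by simp [hj]) (by simp [hj])

lemma sum_siteAvg_antisymm (β h q : ℝ) (l : Fin n) {E : (Option (Fin n × Fin 2) → Bool) → ℝ}
    (hE : ∀ bs, E (fun m => bs (Equiv.swap (some (l, 0)) (some (l, 1)) m)) = E bs)
    (x : Fin n → ℝ) :
    ∑ j, siteAvg β h q (fun bs : Option (Fin n × Fin 2) → Bool =>
      (spin (bs (some (l, 0))) - spin (bs (some (l, 1)))) * E bs *
        (spin (bs (some (j, 0))) - spin (bs (some (j, 1))))) * x j =
    siteAvg β h q (fun bs : Option (Fin n × Fin 2) → Bool =>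
      (spin (bs (some (l, 0))) - spin (bs (some (l, 1)))) * E bs *
        (spin (bs (some (l, 0))) - spin (bs (some (l, 1))))) * x l := by
  refine Finset.sum_eq_single l (fun j _ hj => ?_) (by simp)
  simp only [mul_assoc]
  rw [siteAvg_antisymm_mul, zero_mul]
  intro bs
  dsimp only
  rw [hE, swap_some_of_ne hj, swap_some_of_ne hj]

theorem isBigO_difference (l : Fin n) (P : MvPolynomial (Fin n) ℝ) :
    (fun X : SiteEnv => nu (X.M + 1) X.β X.h (fun σs : Option (Fin n × Fin 2) → Cfg (X.M + 1) =>
        (spin (σs (some (l, 0)) X.site) - spin (σs (some (l, 1)) X.site)) * eval (X.S some σs) P) -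
      X.β ^ 2 * ((X.moment 1 - X.moment 3) * X.gapSum l P) -
      X.t X.site * (2 * (1 - X.moment 2) *
        nu (X.M + 1) X.β X.h (fun σs : Option (Fin n × Fin 2) → Cfg (X.M + 1) =>
          eval (X.S some σs) (pderiv l P)))) =O[⊤] SiteEnv.err := by
  have hne : (some (l, 0) : Option (Fin n × Fin 2)) ≠ some (l, 1) := by simp
  refine (isBigO_antisymm_expansion l P (E := fun _ => 1) fun bs => rfl).congr_left fun X => ?_
  have h1 : ∀ m, pairAvg X.β X.h X.q (.inl (some (l, 0))) (.inl (some (l, 1)))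
      (fun _ : Trip (Option (Fin n × Fin 2)) → Bool => 1) (.inl m) * X.gap l P m =
      if m ≠ some (l, 0) ∧ m ≠ some (l, 1) then (X.moment 1 - X.moment 3) * X.gap l P m
        else 0 := fun m => by
    split_ifs with h
    · rw [pairAvg_one] <;> simp [h, Env.moment]
    · rw [pairAvg, if_pos, zero_mul]
      simp only [Sum.inl.injEq]
      tauto
  have h2 : ∀ m, pairAvg X.β X.h X.q (.inl (some (l, 0))) (.inl (some (l, 1)))
      (fun _ : Trip (Option (Fin n × Fin 2)) → Bool => 1) (.inr (.inl m)) =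
      X.moment 1 - X.moment 3 := fun m => by
    rw [pairAvg_one] <;> simp [Env.moment]
  rw [sum_siteAvg_antisymm _ _ _ l (E := fun _ => 1) fun bs => rfl,
    siteAvg_sub_mul_sub X.β X.h X.q hne]
  simp only [h1, h2, ← Finset.sum_filter, mul_one, Finset.sum_const, Finset.card_univ,
    Fintype.card_option, Fintype.card_prod, Fintype.card_fin, nsmul_eq_mul, Env.gapSum,
    ← Finset.mul_sum, Env.moment]
  push_cast
  ring

theorem isBigO_difference_mul (l : Fin n) (P : MvPolynomial (Fin n) ℝ)
    {m : Option (Fin n × Fin 2)} (hm : m ≠ some (l, 0)) (hm' : m ≠ some (l, 1)) :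
    (fun X : SiteEnv => nu (X.M + 1) X.β X.h (fun σs : Option (Fin n × Fin 2) → Cfg (X.M + 1) =>
        (spin (σs (some (l, 0)) X.site) - spin (σs (some (l, 1)) X.site)) *
          spin (σs m X.site) * eval (X.S some σs) P) -
      X.β ^ 2 * ((1 - X.moment 2 - (X.moment 2 - X.moment 4)) * X.gap l P m +
        (X.moment 2 - X.moment 4) * X.gapSum l P) -
      X.t X.site * (2 * (X.moment 1 - X.moment 3) *
        nu (X.M + 1) X.β X.h (fun σs : Option (Fin n × Fin 2) → Cfg (X.M + 1) =>
          eval (X.S some σs) (pderiv l P)))) =O[⊤] SiteEnv.err := by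
  have hne : (some (l, 0) : Option (Fin n × Fin 2)) ≠ some (l, 1) := by simp
  have hE : ∀ bs : Option (Fin n × Fin 2) → Bool,
      spin (bs (Equiv.swap (some (l, 0)) (some (l, 1)) m)) = spin (bs m) := fun bs => by
    rw [Equiv.swap_apply_of_ne_of_ne hm hm']
  refine (isBigO_antisymm_expansion l P (E := fun bs => spin (bs m)) hE).congr_left fun X => ?_
  have h1 : ∀ j, pairAvg X.β X.h X.q (.inl (some (l, 0))) (.inl (some (l, 1)))
      (fun bs : Trip (Option (Fin n × Fin 2)) → Bool => spin (bs (.inl m))) (.inl j) *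
        X.gap l P j =
      (if j = m then (1 - X.moment 2 - (X.moment 2 - X.moment 4)) * X.gap l P j else 0) +
      if j ≠ some (l, 0) ∧ j ≠ some (l, 1) then (X.moment 2 - X.moment 4) * X.gap l P j
        else 0 := fun j => by
    by_cases hj : j = m
    · rw [hj, pairAvg_spin_self, if_pos rfl, if_pos ⟨hm, hm'⟩]
      · simp only [Env.moment]; ring
      all_goals simp [hm, hm']
    rw [if_neg hj]
    split_ifs with h
    · rw [pairAvg_spin, zero_add]
      · rfl
      all_goals simp [h, hm, hm', Ne.symm hj]
    · rw [pairAvg, if_pos, zero_mul, zero_add]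
      simp only [Sum.inl.injEq]
      tauto
  have h2 : ∀ j, pairAvg X.β X.h X.q (.inl (some (l, 0))) (.inl (some (l, 1)))
      (fun bs : Trip (Option (Fin n × Fin 2)) → Bool => spin (bs (.inl m))) (.inr (.inl j)) =
      X.moment 2 - X.moment 4 := fun j => by
    rw [pairAvg_spin] <;> simp [Env.moment, hm, hm']
  rw [sum_siteAvg_antisymm _ _ _ l (E := fun bs => spin (bs m)) hE,
    siteAvg_sub_mul_spin_mul_sub X.β X.h X.q hne hm hm']
  simp only [h1, h2, Finset.sum_add_distrib, Finset.sum_ite_eq', Finset.mem_univ, if_true]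
  simp only [← Finset.sum_filter, Finset.sum_const, Finset.card_univ, Fintype.card_option,
    Fintype.card_prod, Fintype.card_fin, nsmul_eq_mul, Env.gapSum, ← Finset.mul_sum, Env.moment]
  push_cast
  ring

end AntisymmetricExpansion

section Wick

open Asymptotics MvPolynomial

variable {n : ℕ}

namespace Env

/-- The largest coefficient of the linear statistic. -/
def mx (X : Env) : ℝ := ⨆ i, |X.t i|

lemma abs_t_le_mx (X : Env) (i) : |X.t i| ≤ X.mx :=
  le_ciSup (f := fun i => |X.t i|) (Set.finite_range _).bddAbove i

lemma mx_nonneg (X : Env) : 0 ≤ X.mx := (abs_nonneg _).trans (X.abs_t_le_mx 0)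

lemma d_le_mx (X : Env) : X.d ≤ X.mx := by
  have h1 : ∑ i, X.t i ^ 2 ≤ ∑ _i : Fin (X.M + 1), X.mx ^ 2 := Finset.sum_le_sum fun i _ => by
    rw [← sq_abs]
    exact pow_le_pow_left₀ (abs_nonneg _) (X.abs_t_le_mx i) 2
  rw [X.sum_sq, Finset.sum_const, Finset.card_univ, Fintype.card_fin, nsmul_eq_mul] at h1
  refine (sq_le_sq₀ X.d_pos.le X.mx_nonneg).1 ?_
  calc X.d ^ 2 = X.d ^ 2 * 1 := (mul_one _).symm
    _ ≤ X.d ^ 2 * (((X.M + 1 : ℕ) : ℝ) * X.mx ^ 2) :=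
        mul_le_mul_of_nonneg_left h1 (sq_nonneg _)
    _ = ((X.M + 1 : ℕ) : ℝ) * X.d ^ 2 * X.mx ^ 2 := by ring
    _ = X.mx ^ 2 := by rw [X.card_mul_d_sq, one_mul]

end Env

lemma isBigO_average {f : SiteEnv → ℝ} (hf : f =O[⊤] SiteEnv.err) :
    (fun X : Env => X.d ^ 2 * ∑ i, f ⟨X, i⟩) =O[⊤] fun X => X.d ^ 2 := by
  obtain ⟨C, hC⟩ := isBigO_top.1 hf
  refine isBigO_top.2 ⟨C * 2, fun X => ?_⟩
  rw [norm_mul, mul_comm]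
  refine mul_le_mul_of_nonneg_right ?_ (norm_nonneg _)
  refine (norm_sum_le_of_le univ fun i _ => hC ⟨X, i⟩).trans_eq ?_
  rw [← Finset.mul_sum]
  congr 1
  have : ∀ i, ‖SiteEnv.err ⟨X, i⟩‖ = X.d ^ 2 + X.t i ^ 2 := fun i =>
    Real.norm_of_nonneg (SiteEnv.err_nonneg _)
  simp only [this, Finset.sum_add_distrib, X.sum_sq, Finset.sum_const, Finset.card_univ,
    Fintype.card_fin, nsmul_eq_mul, X.card_mul_d_sq]
  norm_num

lemma abs_sum_t_mul_d_sq_le (X : Env) : (∑ i, |X.t i|) * X.d ^ 2 ≤ X.mx := by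
  calc _ = (∑ i, |X.t i|) * X.d * X.d := by ring
    _ ≤ 1 * X.d := mul_le_mul_of_nonneg_right X.sum_abs_mul_d_le X.d_pos.le
    _ ≤ X.mx := by rw [one_mul]; exact X.d_le_mx

lemma isBigO_weighted {f : SiteEnv → ℝ} (hf : f =O[⊤] SiteEnv.err) :
    (fun X : Env => ∑ i, X.t i * f ⟨X, i⟩) =O[⊤] Env.mx := by
  obtain ⟨C, hC⟩ := isBigO_top.1 hf
  have hC0 : ∀ X, ‖f X‖ ≤ |C| * X.err := fun X => by
    refine (hC X).trans ?_
    rw [Real.norm_of_nonneg X.err_nonneg]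
    exact mul_le_mul_of_nonneg_right (le_abs_self _) X.err_nonneg
  refine isBigO_top.2 ⟨|C| * 2, fun X => ?_⟩
  rw [Real.norm_of_nonneg X.mx_nonneg]
  calc ‖∑ i, X.t i * f ⟨X, i⟩‖ ≤ ∑ i, (|C| * (|X.t i| * X.d ^ 2) + |C| * (X.mx * X.t i ^ 2)) := by
        refine norm_sum_le_of_le univ fun i _ => ?_
        rw [norm_mul, Real.norm_eq_abs, ← mul_add]
        refine (mul_le_mul_of_nonneg_left (hC0 ⟨X, i⟩) (abs_nonneg _)).trans ?_
        rw [← mul_assoc, mul_comm |X.t i|, mul_assoc]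
        refine mul_le_mul_of_nonneg_left ?_ (abs_nonneg _)
        change |X.t i| * (X.d ^ 2 + X.t i ^ 2) ≤ _
        rw [mul_add]
        exact add_le_add le_rfl (mul_le_mul_of_nonneg_right (X.abs_t_le_mx i) (sq_nonneg _))
    _ = |C| * ((∑ i, |X.t i|) * X.d ^ 2) + |C| * X.mx := by
        rw [Finset.sum_add_distrib, ← Finset.mul_sum, ← Finset.mul_sum, ← Finset.mul_sum,
          ← Finset.sum_mul, X.sum_sq, mul_one]
    _ ≤ |C| * X.mx + |C| * X.mx :=
        add_le_add (mul_le_mul_of_nonneg_left (abs_sum_t_mul_d_sq_le X) (abs_nonneg _)) le_rfl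
    _ = _ := by ring

lemma isBigO_one_of_abs_le {b : Env → ℝ} (B : ℝ) (hb : ∀ X, |b X| ≤ B) :
    b =O[⊤] fun _ => (1 : ℝ) :=
  isBigO_top.2 ⟨B, fun X => by simpa using hb X⟩

lemma isBigO_nu_eval {κ : Type} [Fintype κ] [DecidableEq κ] {e : Fin n × Fin 2 → κ}
    (he : Function.Injective e) (P : MvPolynomial (Fin n) ℝ) :
    (fun X : Env => nu (X.M + 1) X.β X.h (fun σs : κ → Cfg (X.M + 1) => eval (X.S e σs) P))
      =O[⊤] fun _ => (1 : ℝ) := by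
  have h1 := (dominated_eval e P).1.isBigO_nu he
  simp only [pow_zero, mul_one] at h1
  obtain ⟨C, hC⟩ := isBigO_top.1 h1
  exact isBigO_top.2 ⟨C, fun X => hC ⟨X, 0⟩⟩

lemma abs_moment_le (X : Env) (k : ℕ) : |X.moment k| ≤ 1 := abs_siteMoment_le _ _ _ _

/-- The product of the spread of the coefficients with the gaps. -/
def Env.source (X : Env) (l : Fin n) (P : MvPolynomial (Fin n) ℝ) : ℝ :=
  (∑ i, X.t i) * X.d ^ 2 * (2 * (X.moment 1 - X.moment 3) *
    nu (X.M + 1) X.β X.h (fun σs : Option (Fin n × Fin 2) → Cfg (X.M + 1) =>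
      eval (X.S some σs) (pderiv l P)))

lemma isBigO_gap_equation (l : Fin n) (P : MvPolynomial (Fin n) ℝ)
    {m : Option (Fin n × Fin 2)} (hm : m ≠ some (l, 0)) (hm' : m ≠ some (l, 1)) :
    (fun X : Env => X.gap l P m -
      X.β ^ 2 * ((1 - X.moment 2 - (X.moment 2 - X.moment 4)) * X.gap l P m +
        (X.moment 2 - X.moment 4) * X.gapSum l P) - X.source l P) =O[⊤] fun X => X.d ^ 2 := by
  refine (isBigO_average (isBigO_difference_mul l P hm hm')).congr_left fun X => ?_
  have h1 : X.gap l P m = X.d ^ 2 * ∑ i, nu (X.M + 1) X.β X.h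
      (fun σs : Option (Fin n × Fin 2) → Cfg (X.M + 1) =>
        (spin (σs (some (l, 0)) i) - spin (σs (some (l, 1)) i)) *
          spin (σs m i) * eval (X.S some σs) P) := by
    rw [← nu_sum, ← nu_const_mul, Env.gap]
    congr 1; ext σs
    rw [overlap, overlap, ← sub_div, ← Finset.sum_sub_distrib, div_eq_mul_inv, ← X.d_sq,
      ← Finset.sum_mul]
    simp only [sub_mul]
    ring
  rw [Finset.sum_sub_distrib, Finset.sum_sub_distrib, mul_sub, mul_sub, ← h1]
  dsimp only
  rw [Finset.sum_const, ← Finset.sum_mul, Finset.card_univ, Fintype.card_fin, nsmul_eq_mul,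
    ← mul_assoc (X.d ^ 2), mul_comm (X.d ^ 2), X.card_mul_d_sq, one_mul, Env.source]
  ring

/-- The variance of the linear statistic in the limit. -/
def Env.alpha (X : Env) : ℝ :=
  2 * (1 - X.moment 2) - 4 * X.β ^ 2 * (X.moment 1 - X.moment 3) ^ 2 *
    ((∑ i, X.t i) ^ 2 * X.d ^ 2) *
      (1 - X.β ^ 2 * (1 - X.moment 2 - 3 * (X.moment 2 - X.moment 4)))⁻¹

lemma half_le_one_sub (X : Env) {x : ℝ} (hx : |x| ≤ 8) : 1 / 2 ≤ 1 - X.β ^ 2 * x := by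
  have h1 : X.β ^ 2 ≤ (1 / 1152) ^ 2 := pow_le_pow_left₀ X.high.pos.le X.high.small.le 2
  have h2 : X.β ^ 2 * |x| ≤ (1 / 1152) ^ 2 * 8 := mul_le_mul h1 hx (abs_nonneg x) (by norm_num)
  have h3 := mul_le_mul_of_nonneg_left (le_abs_self x) (sq_nonneg X.β)
  linarith

lemma isBigO_inv_one_sub {f : Env → ℝ} (hf : ∀ X, |f X| ≤ 8) :
    (fun X : Env => (1 - X.β ^ 2 * f X)⁻¹) =O[⊤] fun _ => (1 : ℝ) :=
  isBigO_one_of_abs_le 2 fun X => by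
    have h := half_le_one_sub X (hf X)
    rw [abs_of_nonneg (by positivity), inv_le_comm₀ (by linarith) two_pos]
    linarith

lemma isBigO_gap_sub (l : Fin n) (P : MvPolynomial (Fin n) ℝ)
    {m : Option (Fin n × Fin 2)} (hm : m ≠ some (l, 0)) (hm' : m ≠ some (l, 1)) :
    (fun X : Env => X.gap l P m - X.gap l P none) =O[⊤] fun X => X.d ^ 2 := by
  have hb : ∀ X : Env, |1 - X.moment 2 - (X.moment 2 - X.moment 4)| ≤ 8 := fun X => by
    have h2 := abs_le.1 (abs_moment_le X 2)
    have h4 := abs_le.1 (abs_moment_le X 4)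
    rw [abs_le]
    constructor <;> linarith
  have h1 := (isBigO_gap_equation l P hm hm').sub
    (isBigO_gap_equation l P (m := none) (by simp) (by simp))
  have h2 := (isBigO_inv_one_sub hb).mul h1
  simp only [one_mul] at h2
  refine h2.congr_left fun X => ?_
  have h3 := half_le_one_sub X (hb X)
  rw [inv_mul_eq_iff_eq_mul₀ (by linarith)]
  ring

lemma isBigO_gapSum (l : Fin n) (P : MvPolynomial (Fin n) ℝ) :
    (fun X : Env => X.gapSum l P + 2 * X.gap l P none) =O[⊤] fun X => X.d ^ 2 := by
  have h1 := IsBigO.sum (s := {m : Option (Fin n × Fin 2) | m ≠ some (l, 0) ∧ m ≠ some (l, 1)})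
    fun m hm => isBigO_gap_sub l P (Finset.mem_filter.1 hm).2.1 (Finset.mem_filter.1 hm).2.2
  refine h1.congr_left fun X => ?_
  have h2 : (#{m : Option (Fin n × Fin 2) | m ≠ some (l, 0) ∧ m ≠ some (l, 1)} : ℝ) =
      2 * n - 1 := by
    have h3 : ({m : Option (Fin n × Fin 2) | m ≠ some (l, 0) ∧ m ≠ some (l, 1)} : Finset _) =
        {some (l, 0), some (l, 1)}ᶜ := by
      ext m; simp
    have h4 := Finset.card_compl_add_card
      ({some (l, 0), some (l, 1)} : Finset (Option (Fin n × Fin 2)))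
    rw [Finset.card_pair (by simp), Fintype.card_option, Fintype.card_prod, Fintype.card_fin,
      Fintype.card_fin] at h4
    rw [h3, eq_sub_iff_add_eq]
    have h5 : (#({some (l, 0), some (l, 1)}ᶜ : Finset (Option (Fin n × Fin 2))) : ℝ) + 2 =
      n * 2 + 1 := by exact_mod_cast h4
    linarith
  rw [Finset.sum_apply, Finset.sum_sub_distrib, Finset.sum_const, nsmul_eq_mul, h2, Env.gapSum]
  ring

lemma isBigO_gapSum_source (l : Fin n) (P : MvPolynomial (Fin n) ℝ) :
    (fun X : Env => X.gapSum l P +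
      2 * ((1 - X.β ^ 2 * (1 - X.moment 2 - 3 * (X.moment 2 - X.moment 4)))⁻¹ * X.source l P))
      =O[⊤] fun X => X.d ^ 2 := by
  have hb : ∀ X : Env, |1 - X.moment 2 - 3 * (X.moment 2 - X.moment 4)| ≤ 8 := fun X => by
    have h2 := abs_le.1 (abs_moment_le X 2)
    have h4 := abs_le.1 (abs_moment_le X 4)
    rw [abs_le]
    constructor <;> linarith
  have h1 := isBigO_gap_equation l P (m := none) (by simp) (by simp)
  have h2 := isBigO_gapSum l P
  have h3 : (fun X : Env => X.β ^ 2 * (X.moment 2 - X.moment 4)) =O[⊤] fun _ => (1 : ℝ) :=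
    isBigO_one_of_abs_le 2 fun X => by
      have h2 := abs_le.1 (abs_moment_le X 2)
      have h4 := abs_le.1 (abs_moment_le X 4)
      have := pow_le_one₀ (n := 2) X.high.pos.le X.high.le_one
      rw [abs_mul, abs_of_nonneg (sq_nonneg X.β)]
      have h5 : |X.moment 2 - X.moment 4| ≤ 2 := abs_le.2 ⟨by linarith, by linarith⟩
      nlinarith [abs_nonneg (X.moment 2 - X.moment 4), sq_nonneg X.β]
  have h4 := h3.mul h2
  simp only [one_mul] at h4
  have h5 := (isBigO_inv_one_sub hb).mul (h1.add h4)
  simp only [one_mul] at h5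
  refine (h2.sub (h5.const_mul_left 2)).congr_left fun X => ?_
  have h6 := half_le_one_sub X (hb X)
  have h7 : (1 - X.β ^ 2 * (1 - X.moment 2 - 3 * (X.moment 2 - X.moment 4)))⁻¹ *
      (1 - X.β ^ 2 * (1 - X.moment 2 - 3 * (X.moment 2 - X.moment 4))) = 1 :=
    inv_mul_cancel₀ (by linarith)
  linear_combination (-2 * X.gap l P none) * h7

/-- Approximate Gaussian integration by parts for the linear statistics. -/
theorem isBigO_wick (l : Fin n) (P : MvPolynomial (Fin n) ℝ) :
    (fun X : Env => nu (X.M + 1) X.β X.h (fun σs : Option (Fin n × Fin 2) → Cfg (X.M + 1) =>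
        X.S some σs l * eval (X.S some σs) P) -
      X.alpha * nu (X.M + 1) X.β X.h (fun σs : Option (Fin n × Fin 2) → Cfg (X.M + 1) =>
        eval (X.S some σs) (pderiv l P))) =O[⊤] Env.mx := by
  have h1 := isBigO_weighted (isBigO_difference l P)
  have h2 : (fun X : Env => X.β ^ 2 * (X.moment 1 - X.moment 3)) =O[⊤] fun _ => (1 : ℝ) :=
    isBigO_one_of_abs_le 2 fun X => by
      have h2 := abs_le.1 (abs_moment_le X 1)
      have h4 := abs_le.1 (abs_moment_le X 3)
      have := pow_le_one₀ (n := 2) X.high.pos.le X.high.le_one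
      rw [abs_mul, abs_of_nonneg (sq_nonneg X.β)]
      have h5 : |X.moment 1 - X.moment 3| ≤ 2 := abs_le.2 ⟨by linarith, by linarith⟩
      nlinarith [abs_nonneg (X.moment 1 - X.moment 3), sq_nonneg X.β]
  have h3 := h2.mul ((isBigO_refl (fun X : Env => ∑ i, X.t i) ⊤).mul (isBigO_gapSum_source l P))
  simp only [one_mul] at h3
  have h4 : (fun X : Env => (∑ i, X.t i) * X.d ^ 2) =O[⊤] Env.mx := isBigO_top.2 ⟨1, fun X => by
    rw [one_mul, Real.norm_of_nonneg X.mx_nonneg, norm_mul, Real.norm_of_nonneg (sq_nonneg X.d)]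
    exact (mul_le_mul_of_nonneg_right (Finset.abs_sum_le_sum_abs _ _) (sq_nonneg _)).trans
      (abs_sum_t_mul_d_sq_le X)⟩
  refine (h1.add (h3.trans h4)).congr_left fun X => ?_
  have h5 : nu (X.M + 1) X.β X.h (fun σs : Option (Fin n × Fin 2) → Cfg (X.M + 1) =>
        X.S some σs l * eval (X.S some σs) P) = ∑ i, X.t i * nu (X.M + 1) X.β X.h
      (fun σs : Option (Fin n × Fin 2) → Cfg (X.M + 1) =>
        (spin (σs (some (l, 0)) i) - spin (σs (some (l, 1)) i)) * eval (X.S some σs) P) := by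
    simp only [← nu_const_mul]
    rw [← nu_sum]
    congr 1; ext σs
    simp only [← mul_assoc, ← Finset.sum_mul]
    rfl
  have h6 : ∀ (a : Fin (X.M + 1) → ℝ) (b c : ℝ), ∑ i, X.t i * (a i - b - X.t i * c) =
      ∑ i, X.t i * a i - (∑ i, X.t i) * b - c := fun a b c => by
    simp only [mul_sub, Finset.sum_sub_distrib, ← mul_assoc, ← Finset.sum_mul, ← sq, X.sum_sq,
      one_mul]
  rw [h5]
  refine (congrArg₂ (· + ·) (h6 (fun i => nu (X.M + 1) X.β X.h
    (fun σs : Option (Fin n × Fin 2) → Cfg (X.M + 1) =>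
      (spin (σs (some (l, 0)) i) - spin (σs (some (l, 1)) i)) * eval (X.S some σs) P))
    (X.β ^ 2 * ((X.moment 1 - X.moment 3) * X.gapSum l P)) (2 * (1 - X.moment 2) *
      nu (X.M + 1) X.β X.h (fun σs : Option (Fin n × Fin 2) → Cfg (X.M + 1) =>
        eval (X.S some σs) (pderiv l P)))) rfl).trans ?_
  simp only [Env.alpha, Env.source]
  ring

end Wick

section Moments

open Asymptotics MvPolynomial

variable {n : ℕ}

/-- The mixed moments of the linear statistics. -/
def Env.mixed (X : Env) (k : Fin n →₀ ℕ) : ℝ :=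
  nu (X.M + 1) X.β X.h (fun σs : Fin n × Fin 2 → Cfg (X.M + 1) =>
    ∏ l, X.S (fun x => x) σs l ^ k l)

lemma nu_eval_some (X : Env) (P : MvPolynomial (Fin n) ℝ) :
    nu (X.M + 1) X.β X.h (fun σs : Option (Fin n × Fin 2) → Cfg (X.M + 1) =>
      eval (X.S some σs) P) =
    nu (X.M + 1) X.β X.h (fun σs : Fin n × Fin 2 → Cfg (X.M + 1) =>
      eval (X.S (fun x => x) σs) P) :=
  nu_comp_injective X.β X.h (Option.some_injective _)
    (fun σs : Fin n × Fin 2 → Cfg (X.M + 1) => eval (X.S (fun x => x) σs) P)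

lemma eval_monomial_fintype (x : Fin n → ℝ) (k : Fin n →₀ ℕ) (a : ℝ) :
    eval x (monomial k a) = a * ∏ l, x l ^ k l := by
  rw [eval_monomial, Finsupp.prod_fintype _ _ fun _ => pow_zero _]

lemma nu_eval_monomial (X : Env) (k : Fin n →₀ ℕ) (a : ℝ) :
    nu (X.M + 1) X.β X.h (fun σs : Option (Fin n × Fin 2) → Cfg (X.M + 1) =>
      eval (X.S some σs) (monomial k a)) = a * X.mixed k := by
  rw [nu_eval_some, Env.mixed, ← nu_const_mul]
  simp only [eval_monomial_fintype]

lemma isBigO_mixed_add_single (k : Fin n →₀ ℕ) (l : Fin n) :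
    (fun X : Env => X.mixed (k + .single l 1) - X.alpha * (k l * X.mixed (k - .single l 1)))
      =O[⊤] Env.mx := by
  refine (isBigO_wick l (monomial k 1)).congr_left fun X => ?_
  have h1 : (fun σs : Option (Fin n × Fin 2) → Cfg (X.M + 1) =>
      X.S some σs l * eval (X.S some σs) (monomial k 1)) =
      fun σs => eval (X.S some σs) (monomial (k + .single l 1) 1) := by
    funext σs
    have h2 : monomial (k + .single l 1) (1 : ℝ) = MvPolynomial.X l * monomial k 1 := by
      rw [MvPolynomial.X, monomial_mul, one_mul, add_comm]
    rw [h2, eval_mul, eval_X]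
  rw [pderiv_monomial, nu_eval_monomial, one_mul, h1, nu_eval_monomial, one_mul]

/-- The second moment of the linear statistic. -/
def Env.secondMoment (X : Env) : ℝ := X.mixed (n := 1) (.single 0 2)

lemma mixed_zero (X : Env) : X.mixed (0 : Fin n →₀ ℕ) = 1 := by
  simp [Env.mixed, nu_const]

lemma secondMoment_nonneg (X : Env) : 0 ≤ X.secondMoment :=
  nu_nonneg fun σs => by simp [sq_nonneg]

lemma isBigO_secondMoment_sub_alpha :
    (fun X : Env => X.secondMoment - X.alpha) =O[⊤] Env.mx := by
  refine (isBigO_mixed_add_single (n := 1) (.single 0 1) 0).congr_left fun X => ?_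
  rw [← Finsupp.single_add, tsub_self, mixed_zero, Finsupp.single_eq_same, Env.secondMoment]
  norm_num

lemma isBigO_mixed_one (k : Fin n →₀ ℕ) :
    (fun X : Env => X.mixed k) =O[⊤] fun _ => (1 : ℝ) := by
  refine (isBigO_nu_eval (Option.some_injective _) (monomial k 1)).congr_left fun X => ?_
  rw [nu_eval_monomial, one_mul]

lemma isBigO_mixed_sub_of_sum (s : ℕ) : ∀ k : Fin n →₀ ℕ, ∑ l, k l = s →
    (fun X : Env => X.mixed k - (∏ l, gaussMoment (k l)) * √X.secondMoment ^ s)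
      =O[⊤] Env.mx := by
  induction s using Nat.strong_induction_on with
  | _ s ih =>
    intro k hk
    by_cases h0 : k = 0
    · subst h0
      simp only [Finsupp.coe_zero, Pi.zero_apply, Finset.sum_const_zero] at hk
      refine (isBigO_zero _ _).congr_left fun X => ?_
      rw [mixed_zero, ← hk]
      simp [gaussMoment_zero]
    obtain ⟨l, hl⟩ := Finsupp.ne_iff.1 h0
    rw [Finsupp.coe_zero, Pi.zero_apply] at hl
    by_cases h1 : k l = 1
    · have hstep := isBigO_mixed_add_single (k - .single l 1) l
      rw [tsub_add_cancel_of_le (Finsupp.single_le_iff.2 h1.ge)] at hstep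
      refine hstep.congr_left fun X => ?_
      rw [Finset.prod_eq_zero (Finset.mem_univ l) (by rw [h1, gaussMoment_one])]
      simp [h1]
    obtain ⟨k, rfl⟩ : ∃ k', k = k' + .single l 2 :=
      ⟨k - .single l 2, (tsub_add_cancel_of_le (Finsupp.single_le_iff.2 (by omega))).symm⟩
    have hstep := isBigO_mixed_add_single (k + .single l 1) l
    rw [add_assoc, ← Finsupp.single_add, add_tsub_cancel_right] at hstep
    have hs : s = ∑ x, k x + 2 := by
      rw [← hk]
      simp [Finset.sum_add_distrib, Finsupp.single_apply]
    have hprod : ∏ x, gaussMoment ((k + .single l 2 : Fin n →₀ ℕ) x) =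
        (k l + 1) * ∏ x, gaussMoment (k x) := by
      rw [← Finset.mul_prod_erase _ _ (Finset.mem_univ l),
        ← Finset.mul_prod_erase _ (fun x => gaussMoment (k x)) (Finset.mem_univ l)]
      simp only [Finsupp.add_apply, Finsupp.single_eq_same, gaussMoment_add_two]
      rw [mul_assoc]
      congr 2
      refine Finset.prod_congr rfl fun x hx => ?_
      rw [Finsupp.single_eq_of_ne (Finset.ne_of_mem_erase hx), add_zero]
    have hα : (fun X : Env => X.secondMoment * (k l + 1 : ℝ)) =O[⊤] fun _ => (1 : ℝ) :=
      ((isBigO_mixed_one (n := 1) (.single 0 2)).const_mul_left (k l + 1 : ℝ)).congr_left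
        fun X => mul_comm _ _
    have a1 := hα.mul (ih _ (by omega) k rfl)
    have a2 := (isBigO_secondMoment_sub_alpha.mul (isBigO_mixed_one k)).const_mul_left
      (k l + 1 : ℝ)
    simp only [one_mul, mul_one] at a1 a2
    refine ((hstep.add a1).sub a2).congr_left fun X => ?_
    rw [hprod, hs, pow_add, Real.sq_sqrt (secondMoment_nonneg X)]
    simp only [Finsupp.add_apply, Finsupp.single_eq_same]
    push_cast
    ring

/-- The mixed moments are approximately Gaussian. -/
theorem isBigO_mixed_sub (k : Fin n →₀ ℕ) :
    (fun X : Env => X.mixed k - (∏ l, gaussMoment (k l)) * √X.secondMoment ^ ∑ l, k l)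
      =O[⊤] Env.mx :=
  isBigO_mixed_sub_of_sum _ k rfl

lemma gibbs_pow {N : ℕ} (β h : ℝ) (g : Fin N → Fin N → ℝ) (t : Fin N → ℝ) (m : ℕ) :
    gibbs N β h g (fun σs : Fin 1 × Fin 2 → Cfg N => Sbar N 1 t σs 0 ^ 2) ^ m =
      gibbs N β h g (fun σs : Fin m × Fin 2 → Cfg N => ∏ l, Sbar N m t σs l ^ 2) := by
  rw [gibbs_eq_sum_boltz, gibbs_eq_sum_boltz, Fintype.sum_pow]
  let e : (Fin m → Fin 1 × Fin 2 → Cfg N) ≃ (Fin m × Fin 2 → Cfg N) :=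
    { toFun := fun p x => p x.1 (0, x.2)
      invFun := fun σs j y => σs (j, y.2)
      left_inv := fun p => by
        ext j ⟨a, b⟩ : 2
        rw [Subsingleton.elim a 0]
      right_inv := fun σs => rfl }
  refine Fintype.sum_equiv e _ _ fun p => ?_
  rw [Finset.prod_mul_distrib]
  congr 1
  simp only [Fintype.prod_prod_type]
  exact Finset.prod_congr rfl fun j _ => by simp [e]

end Moments

section Moments

open Asymptotics

variable {n : ℕ}

lemma integral_gibbs_pow (X : Env) (m : ℕ) :
    ∫ g, gibbs (X.M + 1) X.β X.h g (fun σs : Fin 1 × Fin 2 → Cfg (X.M + 1) =>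
        Sbar (X.M + 1) 1 X.t σs 0 ^ 2) ^ m ∂ gaussN (X.M + 1) =
      X.mixed (n := m) (Finsupp.equivFunOnFinite.symm fun _ => 2) :=
  integral_congr_ae (.of_forall fun g => gibbs_pow X.β X.h g X.t m)

lemma isBigO_mixed_two (m : ℕ) :
    (fun X : Env => X.mixed (n := m) (Finsupp.equivFunOnFinite.symm fun _ => 2) -
      √X.secondMoment ^ (m * 2)) =O[⊤] Env.mx := by
  refine (isBigO_mixed_sub (n := m) (Finsupp.equivFunOnFinite.symm fun _ => 2)).congr_left
    fun X => ?_
  have h2 : gaussMoment 2 = 1 := by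
    simpa [gaussMoment_zero] using gaussMoment_add_two 0
  simp [h2]

/-- The mixed moments are approximately products of Gaussian moments and of the moments of the
quenched variance. -/
theorem isBigO_mixed_sub_integral (k : Fin n → ℕ) :
    (fun X : Env => X.mixed (Finsupp.equivFunOnFinite.symm k) - (∏ l, gaussMoment (k l)) *
      ∫ g, (gibbs (X.M + 1) X.β X.h g (fun σs : Fin 1 × Fin 2 → Cfg (X.M + 1) =>
        Sbar (X.M + 1) 1 X.t σs 0 ^ 2)) ^ (((∑ l, k l : ℕ) : ℝ) / 2) ∂ gaussN (X.M + 1))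
      =O[⊤] Env.mx := by
  have hk := isBigO_mixed_sub (Finsupp.equivFunOnFinite.symm k)
  simp only [Finsupp.equivFunOnFinite_symm_apply_apply] at hk
  rcases Nat.even_or_odd (∑ l, k l) with ⟨m, hm⟩ | hodd
  · have hexp : ((∑ l, k l : ℕ) : ℝ) / 2 = m := by
      rw [hm]
      push_cast
      ring
    refine (hk.sub ((isBigO_mixed_two m).const_mul_left (∏ l, gaussMoment (k l)))).congr_left
      fun X => ?_
    simp only [hexp, Real.rpow_natCast]
    rw [integral_gibbs_pow, hm, mul_two]
    ring
  · obtain ⟨l, hl⟩ : ∃ l, Odd (k l) := by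
      by_contra! h
      exact Nat.not_even_iff_odd.2 hodd
        (Finset.even_sum _ fun l _ => Nat.not_odd_iff_even.1 (h l))
    refine hk.congr_left fun X => ?_
    rw [Finset.prod_eq_zero (Finset.mem_univ l) (gaussMoment_odd _ hl), zero_mul, zero_mul]

end Moments

/-- Theorem 1, main CLT: in the high temperature region, the mixed moments
`E⟨∏_l S_l^{k_l}⟩` of the weighted averages of spins are close to the corresponding products of
Gaussian moments times `E[⟨S₁²⟩^{k/2}]`, up to an error `K · max_i |t_i|` with `K` independent
of `N`. -/
theorem stmt0 :
    ∃ β₀ : ℝ, 0 < β₀ ∧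
      ∀ n : ℕ, 1 ≤ n → ∀ kvec : Fin n → ℕ,
        ∃ K : ℝ, ∀ β : ℝ, 0 < β → β < β₀ → ∀ M : ℕ, ∀ h : ℝ, 0 ≤ h →
          ∀ t : Fin (M + 1) → ℝ, (∑ i, t i ^ 2) = 1 →
            |nu (M + 1) β h
                (fun σs : Fin n × Fin 2 → Cfg (M + 1) =>
                  ∏ l, Sbar (M + 1) n t σs l ^ kvec l) -
              (∏ l, gaussMoment (kvec l)) *
                ∫ g, (gibbs (M + 1) β h g
                    (fun σs : Fin 1 × Fin 2 → Cfg (M + 1) =>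
                      Sbar (M + 1) 1 t σs 0 ^ 2)) ^ (((∑ l, kvec l : ℕ) : ℝ) / 2)
                  ∂ gaussN (M + 1)| ≤ K * ⨆ i, |t i| := by
  refine ⟨betaZero, betaZero_pos, fun n _ kvec => ?_⟩
  obtain ⟨K, hK⟩ := Asymptotics.isBigO_top.1 (isBigO_mixed_sub_integral kvec)
  refine ⟨K, fun β hβ hβ₀ M h _ t ht => ?_⟩
  obtain ⟨q, hq0, hq1, hq⟩ := exists_siteMoment_two_eq β h
  let X : Env := ⟨β, h, q, ⟨hβ, hβ₀, hq0, hq1, hq⟩, M, t, ht⟩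
  have hX := hK X
  rw [Real.norm_eq_abs, Real.norm_of_nonneg X.mx_nonneg] at hX
  exact hX

end
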